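/- In the gl_∞ setting with λ=0, V_θ(0) has a global basis: the triple (L_θ(0), L_θ(0)^-, U_A^-φ_λ) is balanced, i.e. each of the three generates V_θ(0) over K and the natural map E → L_θ(0)/qL_θ(0) is an isomorphism, where E = L_θ(0) ∩ L_θ(0)^- ∩ U_A^-φ_λ. -/

import Mathlib

set_option synthInstance.maxHeartbeats 1000000
set_option maxHeartbeats 1000000

noncomputable section
open scoped BigOperators TensorProduct

abbrev KK : Type := RatFunc ℚ

def qq : KK := RatFunc.X

def qZ (n : ℤ) : KK := qq ^ n

def qInt (d : ℤ) (k : ℕ) : KK := (qq ^ (d * k) - qq ^ (-(d * k : ℤ))) / (qq ^ d - qq ^ (-d : ℤ))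

def qFact (d : ℤ) (k : ℕ) : KK := ∏ m ∈ Finset.range k, qInt d (m + 1)

variable {I : Type} [DecidableEq I]

/-- `b = 1 - (α_i^∨, α_j)` -/
def serreN (A : I → I → ℤ) (i j : I) : ℕ := (1 - 2 * A i j / A i i).toNat

/-- the `q`-Serre element `Σ_k (-1)^k x_i^{(k)} x_j x_i^{(b-k)}` attached to a family
`x : I → R` of elements of a `K`-algebra `R`. -/
def serreElt (A : I → I → ℤ) {R : Type} [Ring R] [Algebra KK R] (x : I → R) (i j : I) : R :=
  ∑ k ∈ Finset.range (serreN A i j + 1),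
    ((-1 : KK) ^ k * (qFact (A i i / 2) k)⁻¹ * (qFact (A i i / 2) (serreN A i j - k))⁻¹) •
      (x i ^ k * x j * x i ^ (serreN A i j - k))

inductive SerreRel (A : I → I → ℤ) : FreeAlgebra KK I → FreeAlgebra KK I → Prop
  | serre (i j : I) (h : i ≠ j) : SerreRel A (serreElt A (FreeAlgebra.ι KK) i j) 0

abbrev Um (A : I → I → ℤ) : Type := RingQuot (SerreRel A)

def fgen (A : I → I → ℤ) (i : I) : Um A := RingQuot.mkAlgHom KK (SerreRel A) (FreeAlgebra.ι KK i)

def fdiv (A : I → I → ℤ) (i : I) (n : ℕ) : Um A :=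
  (qFact (A i i / 2) n)⁻¹ • (fgen A i) ^ n

def IsCartan (A : I → I → ℤ) : Prop :=
  (∀ i j, A i j = A j i) ∧ (∀ i, 0 < A i i) ∧ (∀ i, 2 ∣ A i i) ∧
  (∀ i j, i ≠ j → A i j ≤ 0) ∧ (∀ i j, A i i ∣ 2 * A i j)

/-- `θ` is a Dynkin-diagram involution. -/
def IsTheta (A : I → I → ℤ) (θ : I → I) : Prop :=
  (∀ i, θ (θ i) = i) ∧ (∀ i j, A (θ i) (θ j) = A i j)

/-- generators of `B_θ(g)`: `E_i`, `F_i`, `T_i` and `T_i⁻¹`. -/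
inductive BGen (I : Type) : Type
  | E : I → BGen I
  | F : I → BGen I
  | T : I → BGen I
  | Ti : I → BGen I

def bE (i : I) : FreeAlgebra KK (BGen I) := FreeAlgebra.ι KK (BGen.E i)
def bF (i : I) : FreeAlgebra KK (BGen I) := FreeAlgebra.ι KK (BGen.F i)
def bT (i : I) : FreeAlgebra KK (BGen I) := FreeAlgebra.ι KK (BGen.T i)
def bTi (i : I) : FreeAlgebra KK (BGen I) := FreeAlgebra.ι KK (BGen.Ti i)

/-- the defining relations of `B_θ(g)`. -/
inductive BRel (A : I → I → ℤ) (θ : I → I) :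
    FreeAlgebra KK (BGen I) → FreeAlgebra KK (BGen I) → Prop
  | T_inv_right (i : I) : BRel A θ (bT i * bTi i) 1
  | T_inv_left (i : I) : BRel A θ (bTi i * bT i) 1
  | T_comm (i j : I) : BRel A θ (bT i * bT j) (bT j * bT i)
  | T_theta (i : I) : BRel A θ (bT (θ i)) (bT i)
  | Ti_theta (i : I) : BRel A θ (bTi (θ i)) (bTi i)
  | TE (i j : I) : BRel A θ (bT i * bE j) (qZ (A i j + A (θ i) j) • (bE j * bT i))
  | TF (i j : I) : BRel A θ (bT i * bF j) (qZ (-(A i j + A (θ i) j)) • (bF j * bT i))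
  | EF (i j : I) : BRel A θ (bE i * bF j)
      (qZ (-(A i j)) • (bF j * bE i) + (if i = j then 1 else 0) +
        (if θ i = j then bT i else 0))
  | Eserre (i j : I) (h : i ≠ j) : BRel A θ (serreElt A bE i j) 0
  | Fserre (i j : I) (h : i ≠ j) : BRel A θ (serreElt A bF i j) 0

abbrev Bth (A : I → I → ℤ) (θ : I → I) : Type := RingQuot (BRel A θ)

def Eg (A : I → I → ℤ) (θ : I → I) (i : I) : Bth A θ :=
  RingQuot.mkAlgHom KK (BRel A θ) (bE i)
def Fg (A : I → I → ℤ) (θ : I → I) (i : I) : Bth A θ :=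
  RingQuot.mkAlgHom KK (BRel A θ) (bF i)
def Tg (A : I → I → ℤ) (θ : I → I) (i : I) : Bth A θ :=
  RingQuot.mkAlgHom KK (BRel A θ) (bT i)
def Tig (A : I → I → ℤ) (θ : I → I) (i : I) : Bth A θ :=
  RingQuot.mkAlgHom KK (BRel A θ) (bTi i)

/-- a dominant integral `θ`-invariant weight `λ`, recorded through the pairings
`lam i = (α_i, λ)`. -/
def IsDomWt (A : I → I → ℤ) (θ : I → I) (lam : I → ℤ) : Prop :=
  (∀ i, 0 ≤ lam i) ∧ (∀ i, A i i ∣ 2 * lam i) ∧ (∀ i, lam (θ i) = lam i)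

/-- a representation of `B_θ(g)` together with a marked vector (recording also
the underlying `ℚ`-module structure). -/
structure BRepQ (A : I → I → ℤ) (θ : I → I) where
  carrier : Type
  [ag : AddCommGroup carrier]
  [mo : Module KK carrier]
  [mq : Module ℚ carrier]
  [st : IsScalarTower ℚ KK carrier]
  rho : Bth A θ →ₐ[KK] Module.End KK carrier
  vac : carrier

attribute [instance] BRepQ.ag BRepQ.mo BRepQ.mq BRepQ.st

variable {A : I → I → ℤ} {θ : I → I}

/-- `M` is a highest weight module `V_θ(λ)`. -/
def IsVtheta (A : I → I → ℤ) (θ : I → I) (lam : I → ℤ) (M : BRepQ A θ) : Prop :=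
  (∀ i, M.rho (Eg A θ i) M.vac = 0) ∧
  (∀ i, M.rho (Tg A θ i) M.vac = qZ (lam i) • M.vac) ∧
  (∀ W : Submodule KK M.carrier,
    (∀ x : Bth A θ, ∀ w ∈ W, M.rho x w ∈ W) → M.vac ∈ W → W = ⊤) ∧
  (∀ u : M.carrier, (∀ i, M.rho (Eg A θ i) u = 0) ↔ ∃ c : KK, u = c • M.vac)

/-- the divided power `F_i^{(n)}` acting on `M`. -/
def Fpow (M : BRepQ A θ) (i : I) (n : ℕ) : Module.End KK M.carrier :=
  (qFact (A i i / 2) n)⁻¹ • (M.rho (Fg A θ i)) ^ n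

/-- `Et`, `Ft` are the modified root operators `Ẽ_i`, `F̃_i` on `M`. -/
def ModifiedOpsV (M : BRepQ A θ) (Et Ft : I → M.carrier → M.carrier) : Prop :=
  ∀ (i : I) (c : ℕ →₀ M.carrier), (∀ n : ℕ, M.rho (Eg A θ i) (c n) = 0) →
    (Et i (c.sum fun n x => Fpow M i n x)
        = c.sum fun n x => if n = 0 then 0 else Fpow M i (n - 1) x) ∧
    (Ft i (c.sum fun n x => Fpow M i n x)
        = c.sum fun n x => Fpow M i (n + 1) x)

/-- the subring `A₀` of `K = ℚ(q)`, as a subset. -/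
def A0set : Set KK :=
  {x | ∃ f g : Polynomial ℚ, Polynomial.eval 0 g ≠ 0 ∧
    x = algebraMap (Polynomial ℚ) KK f / algebraMap (Polynomial ℚ) KK g}

/-- the set of all `F̃_{i₁} ⋯ F̃_{i_ℓ} φ_λ`. -/
def CrystalWordsV (M : BRepQ A θ) (Ft : I → M.carrier → M.carrier) : Set M.carrier :=
  {v | ∃ L : List I, v = L.foldr (fun i w => Ft i w) M.vac}

/-- the crystal lattice `L_θ(λ)`: the `A₀`-submodule generated by the
`F̃_{i₁} ⋯ F̃_{i_ℓ} φ_λ`, realized as a `ℚ`-submodule. -/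
def Lth (M : BRepQ A θ) (Ft : I → M.carrier → M.carrier) : Submodule ℚ M.carrier :=
  Submodule.span ℚ {x | ∃ c ∈ A0set, ∃ s ∈ CrystalWordsV M Ft, x = c • s}

/-- `q L_θ(λ)`. -/
def qLth (M : BRepQ A θ) (Ft : I → M.carrier → M.carrier) : Submodule ℚ M.carrier :=
  Submodule.span ℚ {x | ∃ y ∈ Lth M Ft, x = qq • y}

/-- the index set `I = ℤ_odd`. -/
abbrev Iodd : Type := {n : ℤ // Odd n}

/-- the `gl_∞` symmetric bilinear form. -/
def Aodd : Iodd → Iodd → ℤ := fun i j =>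
  if i.1 = j.1 then 2 else if i.1 = j.1 + 2 ∨ i.1 = j.1 - 2 then -1 else 0

/-- the involution `θ(i) = -i`. -/
def thOdd : Iodd → Iodd := fun i => ⟨-i.1, i.2.neg⟩

/-- `λ = 0`. -/
def lam0 : Iodd → ℤ := fun _ => 0

/-- the subring `A = ℚ[q, q⁻¹]` of `K = ℚ(q)`, as a subset. -/
def Aset : Set KK :=
  {x | ∃ (f : Polynomial ℚ) (n : ℕ), x = algebraMap (Polynomial ℚ) KK f * qq ^ (-(n : ℤ))}

/-- `U_A^- φ_λ`, realized as a `ℚ`-submodule of `V_θ(λ)`. -/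
def UAphi (M : BRepQ Aodd thOdd) (Fmap : Um Aodd →ₐ[KK] Bth Aodd thOdd) :
    Submodule ℚ M.carrier :=
  Submodule.span ℚ
    {x | ∃ c ∈ Aset, ∃ L : List (Iodd × ℕ),
      x = M.rho (Fmap (c • (L.map fun p => fdiv Aodd p.1 p.2).prod)) M.vac}

/-- `L_θ(λ)⁻`: the image of `L_θ(λ)` under the bar operator of `V_θ(λ)`. -/
def LthBar (M : BRepQ Aodd thOdd) (Ft : Iodd → M.carrier → M.carrier)
    (barV : M.carrier → M.carrier) : Submodule ℚ M.carrier :=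
  Submodule.span ℚ {x | ∃ y ∈ Lth M Ft, x = barV y}

/-- the natural map `E → L/N` for `E ≤ L`. -/
def balMap (M : BRepQ Aodd thOdd) (L : Submodule ℚ M.carrier)
    (E : Submodule ℚ M.carrier) (hE : E ≤ L) (N : Submodule ℚ L) : E → L ⧸ N :=
  fun x => Submodule.Quotient.mk (⟨x.1, hE x.2⟩ : L)


namespace GLB

section part1
/-- pairs `(a,b)` with `a<b`, `a+b ≥ 0`. -/
abbrev RR : Type := {s : ℤ × ℤ // s.1 < s.2 ∧ 0 ≤ s.1 + s.2}

abbrev Gam : Type := RR →₀ ℤ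

/-- additive functional attached to a weight on pairs. -/
def WW (w : ℤ → ℤ → ℤ) : Gam →+ ℤ :=
  Finsupp.liftAddHom fun s : RR => AddMonoidHom.mulRight (w s.1.1 s.1.2 + w (-s.1.2) (-s.1.1))

lemma WW_single (w : ℤ → ℤ → ℤ) (s : RR) (c : ℤ) :
    WW w (Finsupp.single s c) = c * (w s.1.1 s.1.2 + w (-s.1.2) (-s.1.1)) := by
  simp [WW]

lemma WW_apply (w : ℤ → ℤ → ℤ) (g : Gam) :
    WW w g = g.sum fun s c => c * (w s.1.1 s.1.2 + w (-s.1.2) (-s.1.1)) := by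
  simp [WW, Finsupp.liftAddHom_apply]

def rep (a b : ℤ) (h : a < b) : RR :=
  if h' : 0 ≤ a + b then ⟨(a, b), h, h'⟩ else ⟨(-b, -a), by constructor <;> dsimp only <;> omega⟩

def sgl (a b : ℤ) : Gam := if h : a < b then Finsupp.single (rep a b h) 1 else 0

lemma WW_sgl (w : ℤ → ℤ → ℤ) (a b : ℤ) :
    WW w (sgl a b) = if a < b then w a b + w (-b) (-a) else 0 := by
  unfold sgl
  split_ifs with h
  · rw [WW_single]; unfold rep
    split_ifs with h'
    · simp
    · simp [add_comm]
  · simp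

lemma WW_add (w w' : ℤ → ℤ → ℤ) (g : Gam) : WW (fun x y => w x y + w' x y) g = WW w g + WW w' g := by
  simp only [WW_apply, Finsupp.sum, ← Finset.sum_add_distrib]
  refine Finset.sum_congr rfl fun s _ => by ring

lemma WW_sub (w w' : ℤ → ℤ → ℤ) (g : Gam) : WW (fun x y => w x y - w' x y) g = WW w g - WW w' g := by
  simp only [WW_apply, Finsupp.sum, ← Finset.sum_sub_distrib]
  refine Finset.sum_congr rfl fun s _ => by ring

lemma WW_sum {ι : Type*} (f : Finset ι) (w : ι → ℤ → ℤ → ℤ) (g : Gam) :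
    WW (fun x y => ∑ k ∈ f, w k x y) g = ∑ k ∈ f, WW (w k) g := by
  classical
  induction f using Finset.induction_on with
  | empty => simp [WW_apply]
  | insert a s ha ih =>
    rw [Finset.sum_insert ha, ← ih, ← WW_add]
    simp only [Finset.sum_insert ha]

lemma WW_congr {w w' : ℤ → ℤ → ℤ} (h : ∀ x y, x < y → w x y = w' x y) (g : Gam) :
    WW w g = WW w' g := by
  simp only [WW_apply, Finsupp.sum]
  refine Finset.sum_congr rfl fun s _ => ?_
  rw [h _ _ s.2.1, h (-s.1.2) (-s.1.1) (by have := s.2.1; omega)]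

lemma WW_symm (w : ℤ → ℤ → ℤ) (g : Gam) : WW (fun x y => w (-y) (-x)) g = WW w g := by
  simp only [WW_apply, Finsupp.sum]
  refine Finset.sum_congr rfl fun s _ => ?_
  simp [add_comm]

lemma WW_nonneg {w : ℤ → ℤ → ℤ} (h : ∀ x y, x < y → 0 ≤ w x y) {g : Gam} (hg : 0 ≤ g) :
    0 ≤ WW w g := by
  simp only [WW_apply, Finsupp.sum]
  refine Finset.sum_nonneg fun s _ => mul_nonneg (hg s) ?_
  have := s.2.1
  have := h (-s.1.2) (-s.1.1) (by omega)
  have := h _ _ s.2.1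
  omega

/-- multiplicity of the segment `(a,b)` -/
def tt (a b : ℤ) : Gam →+ ℤ := WW fun x y => if x = a ∧ y = b then 1 else 0

lemma tt_apply_R (s : RR) (g : Gam) :
    tt s.1.1 s.1.2 g = if s.1.1 + s.1.2 = 0 then 2 * g s else g s := by
  unfold tt
  rw [WW_apply, Finsupp.sum]
  have key : ∀ r : RR, (g r * ((if r.1.1 = s.1.1 ∧ r.1.2 = s.1.2 then 1 else 0)
      + (if -r.1.2 = s.1.1 ∧ -r.1.1 = s.1.2 then 1 else 0)) : ℤ)
      = if r = s then (if s.1.1 + s.1.2 = 0 then 2 * g s else g s) else 0 := by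
    intro r
    by_cases hrs : r = s
    · subst hrs
      simp only [and_self, if_true]
      split_ifs <;> omega
    · rw [if_neg hrs, if_neg, if_neg]
      · simp
      · rintro ⟨h1, h2⟩
        apply hrs
        have := s.2.2; have := r.2.2
        apply Subtype.ext; apply Prod.ext <;> omega
      · rintro ⟨h1, h2⟩
        exact hrs (Subtype.ext (Prod.ext h1 h2))
  rw [Finset.sum_congr rfl fun r _ => key r, Finset.sum_ite_eq']
  split_ifs with h1 h2 h2
  · rfl
  · rfl
  · rw [Finsupp.notMem_support_iff.mp h1]; rfl
  · rw [Finsupp.notMem_support_iff.mp h1]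

lemma tt_symm (a b : ℤ) (g : Gam) : tt a b g = tt (-b) (-a) g := by
  unfold tt
  rw [← WW_symm]
  refine WW_congr (fun x y _ => ?_) g
  split_ifs <;> omega

lemma tt_of_ge {a b : ℤ} (h : b ≤ a) (g : Gam) : tt a b g = 0 := by
  unfold tt
  rw [WW_congr (w' := fun _ _ => 0)]
  · simp [WW_apply]
  · intro x y hxy; rw [if_neg]; omega

lemma nonneg_iff (g : Gam) : 0 ≤ g ↔ ∀ a b, 0 ≤ tt a b g := by
  constructor
  · intro h a b
    exact WW_nonneg (fun x y _ => by split_ifs <;> simp) h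
  · intro h s
    have := h s.1.1 s.1.2
    rw [tt_apply_R] at this
    simp only [Finsupp.coe_zero, Pi.zero_apply]
    split_ifs at this <;> omega

lemma gam_ext {g g' : Gam} (h : ∀ a b, tt a b g = tt a b g') : g = g' := by
  ext s
  have := h s.1.1 s.1.2
  rw [tt_apply_R, tt_apply_R] at this
  split_ifs at this <;> omega

lemma tt_sgl (a b c d : ℤ) : tt a b (sgl c d) =
    if c < d then (if c = a ∧ d = b then 1 else 0) + (if -d = a ∧ -c = b then 1 else 0) else 0 := by
  unfold tt; rw [WW_sgl]

lemma tt_even {a b : ℤ} (h : b = -a) (g : Gam) : ∃ k, tt a b g = 2 * k := by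
  by_cases hab : a < b
  · have := tt_apply_R ⟨(a, b), hab, by dsimp only; omega⟩ g
    dsimp only at this
    rw [if_pos (by omega)] at this
    exact ⟨_, this⟩
  · exact ⟨0, by rw [tt_of_ge (by omega)]; rfl⟩

/-- the elementary move at slot `(i,b)` -/
def DD (i b : ℤ) : Gam := sgl i b - sgl (i + 1) b

lemma WW_DD (w : ℤ → ℤ → ℤ) {i b : ℤ} (h : i < b) :
    WW w (DD i b) = w i b + w (-b) (-i) - (if i + 1 < b then w (i+1) b + w (-b) (-(i+1)) else 0) := by
  unfold DD; rw [map_sub, WW_sgl, WW_sgl, if_pos h]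

lemma tt_DD (a c : ℤ) {i b : ℤ} (h : i < b) : tt a c (DD i b) =
    (if i = a ∧ b = c then 1 else 0) + (if -b = a ∧ -i = c then 1 else 0)
     - (if i + 1 < b then ((if i + 1 = a ∧ b = c then 1 else 0)
        + (if -b = a ∧ -(i+1) = c then 1 else 0)) else 0) := by
  unfold tt; rw [WW_DD _ h]

/-- `S_{i,b}` -/
def SS (i b : ℤ) : Gam →+ ℤ :=
  WW fun x y => if b < y then (if x = i + 1 then 1 else 0) - (if x = i then 1 else 0) else 0

def rk (a b : ℤ) : Gam →+ ℤ := WW fun x y => if x ≤ a ∧ b ≤ y then 1 else 0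

/-- Cartan form after reindexing -/
def Ca (i j : ℤ) : ℤ := if i = j then 2 else if i = j + 1 ∨ i = j - 1 then -1 else 0

lemma SS_DD {i b j b' : ℤ} (h : i < b) (h' : j < b') : SS i b (DD j b') =
    (if b < b' then - Ca i j else 0)
    + (if b = -j - 1 then (if b' = -i-1 then 1 else 0) - (if b' = -i then 1 else 0) else 0) := by
  unfold SS Ca
  rw [WW_DD _ h']
  grind (splits := 30)

lemma SS_pred (i b : ℤ) (g : Gam) : SS i (b - 1) g = SS i b g + tt (i+1) b g - tt i b g := by
  unfold SS tt
  rw [← WW_add, ← WW_sub]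
  refine WW_congr (fun x y _ => ?_) g
  split_ifs <;> omega

/-- all ends of segments lie in `[-n,n]` -/
def Bdd (n : ℤ) (g : Gam) : Prop := ∀ a b, tt a b g ≠ 0 → -n ≤ a ∧ b ≤ n

lemma Bdd.add {n : ℤ} {g g' : Gam} (h : Bdd n g) (h' : Bdd n g') : Bdd n (g + g') := by
  intro a b hab
  rw [map_add] at hab
  by_cases h1 : tt a b g = 0
  · exact h' a b (by omega)
  · exact h a b h1

lemma Bdd.neg {n : ℤ} {g : Gam} (h : Bdd n g)  : Bdd n (-g) := by
  intro a b hab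
  rw [map_neg] at hab
  exact h a b (by omega)

lemma Bdd.sub {n : ℤ} {g g' : Gam} (h : Bdd n g) (h' : Bdd n g') : Bdd n (g - g') := by
  rw [sub_eq_add_neg]; exact h.add h'.neg

lemma Bdd.mono {n m : ℤ} {g : Gam} (h : Bdd n g) (hnm : n ≤ m) : Bdd m g := by
  intro a b hab
  have := h a b hab
  omega

lemma Bdd.DD {n i b : ℤ} (h : i < b) (hi : -n ≤ i) (hi' : i < n) (hb : b ≤ n) : Bdd n (DD i b) := by
  intro a c hac
  rw [tt_DD _ _ h] at hac
  omega

lemma exists_Bdd (g : Gam) : ∃ n : ℤ, 0 ≤ n ∧ Bdd n g := by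
  refine ⟨∑ s ∈ g.support, (|s.1.1| + |s.1.2|), Finset.sum_nonneg fun s _ => by positivity, ?_⟩
  have key : ∀ s : RR, g s ≠ 0 → |s.1.1| + |s.1.2| ≤ ∑ s ∈ g.support, (|s.1.1| + |s.1.2|) := by
    intro s hs
    exact Finset.single_le_sum (f := fun s : RR => |s.1.1| + |s.1.2|) (fun s _ => by positivity)
      (Finsupp.mem_support_iff.mpr hs)
  intro a b hab
  have hlt : a < b := by
    by_contra hh
    exact hab (tt_of_ge (by omega) g)
  by_cases hs : 0 ≤ a + b
  · have h1 := tt_apply_R ⟨(a,b), hlt, hs⟩ g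
    dsimp only at h1
    rw [h1] at hab
    have h2 := key ⟨(a,b), hlt, hs⟩ (by split_ifs at hab <;> omega)
    dsimp only at h2
    have := neg_abs_le a; have := le_abs_self b; have := abs_nonneg a; have := abs_nonneg b
    omega
  · have h1 := tt_apply_R ⟨(-b,-a), by dsimp only; omega, by dsimp only; omega⟩ g
    dsimp only at h1
    rw [tt_symm, h1] at hab
    have h2 := key ⟨(-b,-a), by dsimp only; omega, by dsimp only; omega⟩ (by split_ifs at hab <;> omega)
    dsimp only at h2
    rw [abs_neg, abs_neg] at h2
    have := neg_abs_le a; have := le_abs_self b; have := abs_nonneg a; have := abs_nonneg b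
    omega

lemma SS_of_Bdd {n : ℤ} {g : Gam} (h : Bdd n g) (i : ℤ) {b : ℤ} (hb : n ≤ b) : SS i b g = 0 := by
  obtain ⟨m, _, hm⟩ := exists_Bdd g
  -- descend from a large value
  have far : ∀ k : ℕ, SS i b g = SS i (b + k) g := by
    intro k
    induction k with
    | zero => simp
    | succ k ih =>
      rw [ih]
      have h1 := SS_pred i (b + (k + 1 : ℕ)) g
      have h2 : b + ((k + 1 : ℕ) : ℤ) - 1 = b + k := by push_cast; ring
      rw [h2] at h1
      have h3 : tt (i+1) (b + (k+1 : ℕ)) g = 0 := by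
        by_contra hh; have := h _ _ hh; push_cast at this; omega
      have h4 : tt i (b + (k+1 : ℕ)) g = 0 := by
        by_contra hh; have := h _ _ hh; push_cast at this; omega
      omega
  have hz : ∃ c : ℤ, ∀ d ≥ c, SS i d g = 0 := by
    refine ⟨∑ s ∈ g.support, (|s.1.1| + |s.1.2|), fun d hd => ?_⟩
    unfold SS
    rw [WW_apply, Finsupp.sum]
    refine Finset.sum_eq_zero fun s hs => ?_
    have := Finset.single_le_sum (f := fun s : RR => |s.1.1| + |s.1.2|) (fun s _ => by positivity) hs
    have := neg_abs_le s.1.1; have := le_abs_self s.1.2; have := abs_nonneg s.1.1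
    have := abs_nonneg s.1.2
    rw [if_neg (by omega), if_neg (by omega)]; simp
  obtain ⟨c, hc⟩ := hz
  rw [far (c - b).toNat]
  apply hc
  omega
end part1

section part2
lemma qq_ne : qq ≠ 0 := by unfold qq; exact RatFunc.X_ne_zero

lemma qq_pow_ne {n : ℕ} (hn : n ≠ 0) : qq ^ n ≠ 1 := by
  unfold qq
  intro h
  have h1 : algebraMap (Polynomial ℚ) KK (Polynomial.X ^ n) = algebraMap (Polynomial ℚ) KK 1 := by
    rw [map_pow, RatFunc.algebraMap_X, h, map_one]
  have h2 := RatFunc.algebraMap_injective ℚ h1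
  have h3 := congrArg Polynomial.natDegree h2
  simp at h3
  exact hn h3

lemma qq_zpow_ne {n : ℤ} (hn : n ≠ 0) : qq ^ n ≠ 1 := by
  rcases Int.eq_nat_or_neg n with ⟨m, rfl | rfl⟩
  · rw [zpow_natCast]; exact qq_pow_ne (by simpa using hn)
  · rw [zpow_neg, zpow_natCast, Ne, inv_eq_one]; exact qq_pow_ne (by simpa using hn)

/-- `1 - q^{2m}` -/
def uu (m : ℤ) : KK := 1 - qq ^ (2 * m)

lemma uu_zero : uu 0 = 0 := by simp [uu]

lemma uu_ne {m : ℤ} (hm : m ≠ 0) : uu m ≠ 0 := by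
  unfold uu
  exact sub_ne_zero.mpr (qq_zpow_ne (n := 2 * m) (by omega)).symm

/-- symmetric quantum integer -/
def br (m : ℤ) : KK := (qq ^ m - qq ^ (-m)) / (qq - qq⁻¹)

lemma qsub_ne : qq - qq⁻¹ ≠ 0 := by
  have h := qq_ne
  intro h0
  have h1 : qq ^ 2 = 1 := by
    field_simp at h0
    linear_combination h0
  exact qq_pow_ne two_ne_zero h1

lemma br_eq (m : ℤ) : br m = qq ^ (1 - m) * uu m / uu 1 := by
  have h := qq_ne
  have h1 := qsub_ne
  have h2 : uu 1 ≠ 0 := uu_ne one_ne_zero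
  unfold br uu at *
  rw [div_eq_div_iff h1 h2]
  rw [two_mul m, zpow_add₀ h m, zpow_sub₀ h, zpow_neg]
  have : qq ^ m ≠ 0 := zpow_ne_zero _ h
  generalize qq ^ m = x at *
  simp only [mul_one, zpow_one]
  field_simp
  ring

lemma br_zero : br 0 = 0 := by simp [br]
lemma br_one : br 1 = 1 := by simp [br, qsub_ne]
lemma br_ne {m : ℤ} (hm : m ≠ 0) : br m ≠ 0 := by
  rw [br_eq]
  exact div_ne_zero (mul_ne_zero (zpow_ne_zero _ qq_ne) (uu_ne hm)) (uu_ne one_ne_zero)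

abbrev BB : Type := {g : Gam // 0 ≤ g}
abbrev NN : Type := BB →₀ KK

open Classical in
def pp (g : Gam) : NN := if h : 0 ≤ g then Finsupp.single ⟨g, h⟩ 1 else 0

lemma pp_of_nonneg {g : Gam} (h : 0 ≤ g) : pp g = Finsupp.single ⟨g, h⟩ 1 := by simp [pp, h]
lemma pp_of_not {g : Gam} (h : ¬ 0 ≤ g) : pp g = 0 := by simp [pp, h]
lemma pp_of_neg {g : Gam} {a b : ℤ} (h : tt a b g < 0) : pp g = 0 :=
  pp_of_not fun h' => by have := (nonneg_iff g).mp h' a b; omega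

def fco (i b : ℤ) (g : Gam) : KK := qq ^ (SS i b g) * br (tt i b (g + DD i b))

def eco (i b : ℤ) (g : Gam) : KK :=
  qq ^ (SS i b (g - DD i b) + 1 - tt i b g) * (if b = i + 1 then 1 else uu (tt (i+1) b (g - DD i b)))

def Fsum (i n : ℤ) (g : Gam) : NN := ∑ b ∈ Finset.Ioc i n, fco i b g • pp (g + DD i b)
def Esum (i n : ℤ) (g : Gam) : NN := ∑ b ∈ Finset.Ioc i n, eco i b g • pp (g - DD i b)

/-- window condition -/
def Win (n i : ℤ) : Prop := -n ≤ i ∧ i < n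

lemma Fsum_indep_aux {i n m : ℤ} {g : Gam} (h : Bdd n g) (hn : Win n i) (hnm : n ≤ m) :
    Fsum i n g = Fsum i m g := by
  unfold Fsum
  refine Finset.sum_subset (Finset.Ioc_subset_Ioc_right hnm) fun b hb hb' => ?_
  rw [Finset.mem_Ioc] at hb hb'
  unfold Win at hn
  rw [pp_of_neg (a := i+1) (b := b), smul_zero]
  have h1 : tt (i+1) b g = 0 := by by_contra hh; have := h _ _ hh; omega
  rw [map_add, tt_DD _ _ hb.1, h1]
  grind

lemma Esum_indep_aux {i n m : ℤ} {g : Gam} (h : Bdd n g) (hn : Win n i) (hnm : n ≤ m) :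
    Esum i n g = Esum i m g := by
  unfold Esum
  refine Finset.sum_subset (Finset.Ioc_subset_Ioc_right hnm) fun b hb hb' => ?_
  rw [Finset.mem_Ioc] at hb hb'
  unfold Win at hn
  rw [pp_of_neg (a := i) (b := b), smul_zero]
  have h1 : tt i b g = 0 := by by_contra hh; have := h _ _ hh; omega
  rw [map_sub, tt_DD _ _ hb.1, h1]
  grind

def bd (i : ℤ) (g : Gam) : ℤ := max (exists_Bdd g).choose (|i| + 1)

lemma bd_Bdd (i : ℤ) (g : Gam) : Bdd (bd i g) g :=
  (exists_Bdd g).choose_spec.2.mono (le_max_left _ _)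
lemma bd_Win (i : ℤ) (g : Gam) : Win (bd i g) i := by
  have h : |i| + 1 ≤ bd i g := le_max_right _ _
  have := neg_abs_le i; have := le_abs_self i
  constructor <;> omega

lemma Fsum_indep {i n m : ℤ} {g : Gam} (h : Bdd n g) (hn : Win n i) (h' : Bdd m g) (hm : Win m i) :
    Fsum i n g = Fsum i m g := by
  rcases le_total n m with hh | hh
  · exact Fsum_indep_aux h hn hh
  · exact (Fsum_indep_aux h' hm hh).symm
lemma Esum_indep {i n m : ℤ} {g : Gam} (h : Bdd n g) (hn : Win n i) (h' : Bdd m g) (hm : Win m i) :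
    Esum i n g = Esum i m g := by
  rcases le_total n m with hh | hh
  · exact Esum_indep_aux h hn hh
  · exact (Esum_indep_aux h' hm hh).symm

def Fop (i : ℤ) : NN →ₗ[KK] NN := Finsupp.linearCombination KK fun g : BB => Fsum i (bd i g.1) g.1
def Eop (i : ℤ) : NN →ₗ[KK] NN := Finsupp.linearCombination KK fun g : BB => Esum i (bd i g.1) g.1

def tau (i : ℤ) : Gam →+ ℤ := SS i (i+1) + SS (-1-i) (-i) - (tt i (i+1) + tt i (i+1))

def Top (i : ℤ) : NN →ₗ[KK] NN :=
  Finsupp.linearCombination KK fun g : BB => qq ^ (tau i g.1) • pp g.1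

lemma Top_pp (i : ℤ) (g : Gam) : Top i (pp g) = qq ^ (tau i g) • pp g := by
  by_cases h : 0 ≤ g
  · conv_lhs => rw [pp_of_nonneg h]
    unfold Top
    rw [Finsupp.linearCombination_single, one_smul]
  · simp [pp_of_not h]

lemma Fop_pp {i n : ℤ} {g : Gam} (hb : Bdd n g) (hn : Win n i) : Fop i (pp g) = Fsum i n g := by
  by_cases h : 0 ≤ g
  · rw [pp_of_nonneg h]
    unfold Fop
    rw [Finsupp.linearCombination_single, one_smul]
    exact Fsum_indep (bd_Bdd _ _) (bd_Win _ _) hb hn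
  · rw [pp_of_not h, map_zero]
    symm
    unfold Fsum
    refine Finset.sum_eq_zero fun b hb => ?_
    rw [Finset.mem_Ioc] at hb
    by_cases h' : 0 ≤ g + DD i b
    · have h1 : tt i b (g + DD i b) = 0 := by
        by_contra hh
        apply h
        rw [nonneg_iff] at h' ⊢
        intro x y
        have h2 := h' x y
        have h3 := h' i b
        have h6 : b = -i → ∃ k, tt i b g = 2 * k := fun h => tt_even h g
        have h4 : x = -b ∧ y = -i → tt x y g = tt i b g := by
          rintro ⟨rfl, rfl⟩; rw [tt_symm i b]
        have h5 : x = i ∧ y = b → tt x y g = tt i b g := by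
          rintro ⟨rfl, rfl⟩; rfl
        rw [map_add, tt_DD _ _ hb.1] at h2 h3 hh
        grind (splits := 20)
      simp [fco, h1, br_zero]
    · rw [pp_of_not h', smul_zero]

lemma Eop_pp {i n : ℤ} {g : Gam} (hb : Bdd n g) (hn : Win n i) : Eop i (pp g) = Esum i n g := by
  by_cases h : 0 ≤ g
  · rw [pp_of_nonneg h]
    unfold Eop
    rw [Finsupp.linearCombination_single, one_smul]
    exact Esum_indep (bd_Bdd _ _) (bd_Win _ _) hb hn
  · rw [pp_of_not h, map_zero]
    symm
    unfold Esum
    refine Finset.sum_eq_zero fun b hb => ?_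
    rw [Finset.mem_Ioc] at hb
    by_cases h' : 0 ≤ g - DD i b
    · have h1 : b ≠ i + 1 ∧ tt (i+1) b (g - DD i b) = 0 := by
        by_contra hh
        apply h
        rw [nonneg_iff] at h' ⊢
        intro x y
        have h2 := h' x y
        have h3 := h' (i+1) b
        have h6 : b = -(i+1) → ∃ k, tt (i+1) b g = 2 * k := fun h => tt_even h g
        have h4 : x = -b ∧ y = -(i+1) → tt x y g = tt (i+1) b g := by
          rintro ⟨rfl, rfl⟩; rw [tt_symm (i+1) b]
        have h5 : x = i+1 ∧ y = b → tt x y g = tt (i+1) b g := by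
          rintro ⟨rfl, rfl⟩; rfl
        rw [map_sub, tt_DD _ _ hb.1] at h2 h3 hh
        grind (splits := 20)
      simp [eco, h1.1, h1.2, uu_zero]
    · rw [pp_of_not h', smul_zero]

lemma NN_ext {V : Type*} [AddCommGroup V] [Module KK V] {f f' : NN →ₗ[KK] V}
    (h : ∀ g : Gam, 0 ≤ g → f (pp g) = f' (pp g)) : f = f' := by
  refine Finsupp.lhom_ext' fun g => LinearMap.ext_ring ?_
  have := h g.1 g.2
  rw [pp_of_nonneg g.2] at this
  simpa using this
end part2

section part3
lemma zq_add (a b : ℤ) : qq ^ (a + b) = qq ^ a * qq ^ b := zpow_add₀ qq_ne a b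
lemma zq_sub (a b : ℤ) : qq ^ (a - b) = qq ^ a / qq ^ b := zpow_sub₀ qq_ne a b
lemma zq_ne (a : ℤ) : qq ^ a ≠ 0 := zpow_ne_zero _ qq_ne
lemma zq_two (a : ℤ) : qq ^ (2 * a) = qq ^ a * qq ^ a := by rw [two_mul, zq_add]
lemma zq_2 : qq ^ (2 : ℤ) = qq * qq := by
  rw [show (2 : ℤ) = 1 + 1 by norm_num, zq_add, zpow_one]

lemma fco_eq {j b' : ℤ} (g : Gam) :
    fco j b' g = qq ^ (SS j b' g + 1 - (tt j b' g + tt j b' (DD j b')))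
      * uu (tt j b' g + tt j b' (DD j b')) / uu 1 := by
  unfold fco
  rw [br_eq, map_add]
  rw [show SS j b' g + 1 - (tt j b' g + tt j b' (DD j b'))
    = SS j b' g + (1 - (tt j b' g + tt j b' (DD j b'))) by ring, zq_add (SS j b' g)]
  ring

/-- last factor of the E coefficient -/
def xf (i b : ℤ) (m : ℤ) : KK := if b = i + 1 then 1 else uu m

lemma eco_eq (i b : ℤ) (g : Gam) : eco i b g =
    qq ^ (SS i b g - SS i b (DD i b) + 1 - tt i b g)
      * xf i b (tt (i+1) b g - tt (i+1) b (DD i b)) := by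
  unfold eco xf
  rw [map_sub, map_sub]

lemma ef_generic {i b j b' : ℤ} (h : i < b) (h' : j < b') (n1 : ¬(i = j ∧ b = b'))
    (n3 : ¬(b = -j ∧ b' = -i)) (n6 : ¬(b = -j-1 ∧ b' = -i-1)) (g : Gam) :
    fco j b' g * eco i b (g + DD j b') = qq ^ (- Ca i j) * (eco i b g * fco j b' (g - DD i b)) := by
  rw [fco_eq, fco_eq, eco_eq, eco_eq]
  simp only [map_add, map_sub]
  have hx : (j = i + 1 ∧ b' = b) ∨ (j = -b ∧ b' = -(i+1)) → tt j b' g = tt (i+1) b g := by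
    rintro (⟨rfl, rfl⟩ | ⟨rfl, rfl⟩)
    · rfl
    · rw [tt_symm]; simp
  have e : SS j b' g + 1 - (tt j b' g + tt j b' (DD j b'))
      + (SS i b g + SS i b (DD j b') - SS i b (DD i b) + 1 - (tt i b g + tt i b (DD j b')))
      = - Ca i j + ((SS i b g - SS i b (DD i b) + 1 - tt i b g) +
        (SS j b' g - SS j b' (DD i b) + 1 - (tt j b' g - tt j b' (DD i b) + tt j b' (DD j b')))) := by
    rw [SS_DD h h', SS_DD h' h, tt_DD i b h', tt_DD j b' h]
    unfold Ca
    grind (splits := 30)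
  have m : (b = i+1 ∧ tt j b' (DD i b) = 0) ∨
      (b ≠ i + 1 ∧ ((tt j b' (DD i b) = 0 ∧ tt (i+1) b (DD j b') = 0) ∨
      (tt j b' g + tt j b' (DD j b') = tt (i+1) b g - tt (i+1) b (DD i b) ∧
       tt (i+1) b g + tt (i+1) b (DD j b') - tt (i+1) b (DD i b)
        = tt j b' g - tt j b' (DD i b) + tt j b' (DD j b')))) := by
    rw [tt_DD j b' h, tt_DD (i+1) b h', tt_DD j b' h', tt_DD (i+1) b h]
    grind (splits := 40)
  have e' := congrArg (fun z : ℤ => qq ^ z) e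
  rw [zq_add, zq_add (- Ca i j), zq_add (SS i b g - SS i b (DD i b) + 1 - tt i b g)] at e'
  have e2 : ∀ x y x' y' : KK, x * y = x' * y' →
     qq ^ (SS j b' g + 1 - (tt j b' g + tt j b' (DD j b'))) * x / uu 1 *
     (qq ^ (SS i b g + SS i b (DD j b') - SS i b (DD i b) + 1 - (tt i b g + tt i b (DD j b'))) * y)
     = qq ^ (- Ca i j) * (qq ^ (SS i b g - SS i b (DD i b) + 1 - tt i b g) * y' *
      (qq ^ (SS j b' g - SS j b' (DD i b) + 1 - (tt j b' g - tt j b' (DD i b) + tt j b' (DD j b')))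
       * x' / uu 1)) := by
    intro x y x' y' hxy
    linear_combination (x * y) / uu 1 * e' +
      (qq ^ (- Ca i j) * (qq ^ (SS i b g - SS i b (DD i b) + 1 - tt i b g) *
      (qq ^ (SS j b' g - SS j b' (DD i b) + 1 - (tt j b' g - tt j b' (DD i b) + tt j b' (DD j b')))
       / uu 1))) * hxy
  apply e2
  unfold xf
  rcases m with ⟨m1, m2⟩ | ⟨m1, ⟨m2, m3⟩ | ⟨m2, m3⟩⟩
  · rw [if_pos m1, if_pos m1, m2]; simp
  · rw [if_neg m1, if_neg m1, m2, m3]; simp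
  · rw [if_neg m1, if_neg m1, m2, m3]; ring

/-- the pairing Delta -/
def dl (i b j b' : ℤ) (g : Gam) : KK :=
  fco j b' g * eco i b (g + DD j b') - qq ^ (- Ca i j) * (eco i b g * fco j b' (g - DD i b))

lemma dl_eq (i b j b' : ℤ) (g : Gam) : dl i b j b' g =
   qq ^ (SS j b' g + 1 - (tt j b' g + tt j b' (DD j b')))
      * uu (tt j b' g + tt j b' (DD j b')) / uu 1 *
     (qq ^ (SS i b g + SS i b (DD j b') - SS i b (DD i b) + 1 - (tt i b g + tt i b (DD j b')))
       * xf i b (tt (i+1) b g + tt (i+1) b (DD j b') - tt (i+1) b (DD i b)))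
     - qq ^ (- Ca i j) * (qq ^ (SS i b g - SS i b (DD i b) + 1 - tt i b g)
      * xf i b (tt (i+1) b g - tt (i+1) b (DD i b))
      * (qq ^ (SS j b' g - SS j b' (DD i b) + 1 - (tt j b' g - tt j b' (DD i b) + tt j b' (DD j b')))
       * uu (tt j b' g - tt j b' (DD i b) + tt j b' (DD j b')) / uu 1)) := by
  unfold dl
  rw [fco_eq, fco_eq, eco_eq, eco_eq]
  simp only [map_add, map_sub]

lemma uu_one_eq : uu 1 = 1 - qq * qq := by rw [uu, zq_two, zpow_one]
lemma uu_sq (m : ℤ) : uu m = 1 - qq ^ m * qq ^ m := by rw [uu, zq_two]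

lemma dl_three {i j : ℤ} (hij : i ≠ j) (hs : i + j < 0) (g : Gam) :
    dl i (-j) j (-i) g = qq ^ (SS i (-j) g + SS j (-i) g - 2 * tt i (-j) g) *
      xf i (-j) (tt (i+1) (-j) g + 1 + (if j = i + 1 then 1 else 0)) := by
  have h : i < -j := by omega
  have h' : j < -i := by omega
  have hx : tt j (-i) g = tt i (-j) g := by rw [tt_symm]; simp
  have a1 : tt j (-i) (DD j (-i)) = 1 := by rw [tt_DD _ _ h']; grind
  have a2 : tt j (-i) (DD i (-j)) = 1 := by rw [tt_DD _ _ h]; grind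
  have a3 : tt i (-j) (DD j (-i)) = 1 := by rw [tt_DD _ _ h']; grind
  have a4 : tt (i+1) (-j) (DD j (-i)) = 0 := by rw [tt_DD _ _ h']; grind
  have e1 : SS j (-i) g + 1 - (tt j (-i) g + tt j (-i) (DD j (-i))) + (SS i (-j) g + SS i (-j) (DD j (-i))
     - SS i (-j) (DD i (-j)) + 1 - (tt i (-j) g + tt i (-j) (DD j (-i))))
     = SS i (-j) g + SS j (-i) g - 2 * tt i (-j) g := by
    rw [SS_DD h h', SS_DD h h, a1, a3]; unfold Ca; grind (splits := 30)
  have e2 : - Ca i j + ((SS i (-j) g - SS i (-j) (DD i (-j)) + 1 - tt i (-j) g) +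
     (SS j (-i) g - SS j (-i) (DD i (-j)) + 1 - (tt j (-i) g - tt j (-i) (DD i (-j)) + tt j (-i) (DD j (-i)))))
     = (SS i (-j) g + SS j (-i) g - 2 * tt i (-j) g) + 2 := by
    rw [SS_DD h' h, SS_DD h h, a1, a2]; unfold Ca; grind (splits := 30)
  have hX : xf i (-j) (tt (i+1) (-j) g - tt (i+1) (-j) (DD i (-j))) =
      xf i (-j) (tt (i+1) (-j) g + 1 + (if j = i + 1 then 1 else 0)) := by
    unfold xf
    by_cases hb : -j = i + 1
    · simp [hb]
    · rw [if_neg hb, if_neg hb, tt_DD _ _ h]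
      congr 1; grind
  rw [dl_eq, ← hX]
  have hX2 : tt (i+1) (-j) g + tt (i+1) (-j) (DD j (-i)) - tt (i+1) (-j) (DD i (-j))
    = tt (i+1) (-j) g - tt (i+1) (-j) (DD i (-j)) := by rw [a4, add_zero]
  rw [hX2]
  generalize xf i (-j) (tt (i+1) (-j) g - tt (i+1) (-j) (DD i (-j))) = X
  have e1' := congrArg (fun z : ℤ => qq ^ z) e1
  have e2' := congrArg (fun z : ℤ => qq ^ z) e2
  rw [zq_add] at e1'
  rw [zq_add, zq_add (SS i (-j) g - SS i (-j) (DD i (-j)) + 1 - tt i (-j) g), zq_add _ 2, zq_2] at e2'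
  have hu : uu 1 ≠ 0 := uu_ne one_ne_zero
  have hu2 := uu_one_eq
  have e3 : ∀ x x' : KK, x - qq * qq * x' = uu 1 →
     qq ^ (SS j (-i) g + 1 - (tt j (-i) g + tt j (-i) (DD j (-i)))) * x / uu 1 *
     (qq ^ (SS i (-j) g + SS i (-j) (DD j (-i)) - SS i (-j) (DD i (-j)) + 1 - (tt i (-j) g + tt i (-j) (DD j (-i)))) * X)
     - qq ^ (- Ca i j) * (qq ^ (SS i (-j) g - SS i (-j) (DD i (-j)) + 1 - tt i (-j) g) * X *
      (qq ^ (SS j (-i) g - SS j (-i) (DD i (-j)) + 1 - (tt j (-i) g - tt j (-i) (DD i (-j)) + tt j (-i) (DD j (-i))))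
       * x' / uu 1)) = qq ^ (SS i (-j) g + SS j (-i) g - 2 * tt i (-j) g) * X := by
    intro x x' hxx
    rw [← mul_right_inj' hu]
    field_simp
    linear_combination x * e1' * X - x' * e2' * X +
      qq ^ (SS i (-j) g + SS j (-i) g - 2 * tt i (-j) g) * X * hxx
  apply e3
  rw [a1, a2, uu_sq, uu_sq, zq_add _ 1, zpow_one, hu2, sub_add_cancel]
  ring

lemma dl_six {i j : ℤ} (hij : i ≠ j) (hs : i + j < -1) (g : Gam) :
    dl i (-j-1) j (-i-1) g = - (qq ^ (SS i (-j) g + SS j (-i) g - 2 * tt i (-j) g) *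
      uu (tt (i+1) (-j) g + 1 + (if j = i + 1 then 1 else 0))) := by
  have h : i < -j-1 := by omega
  have h' : j < -i-1 := by omega
  have hx : tt j (-i) g = tt i (-j) g := by rw [tt_symm]; simp
  have hy : tt j (-i-1) g = tt (i+1) (-j) g := by rw [tt_symm]; congr 2; ring
  have hz : tt (j+1) (-i) g = tt i (-j-1) g := by rw [tt_symm, neg_neg]; congr 2; ring
  have hS1 := SS_pred i (-j) g
  have hS2 := SS_pred j (-i) g
  have a1 : tt j (-i-1) (DD j (-i-1)) = 1 + (if j = i + 1 then 1 else 0) := by rw [tt_DD _ _ h']; grind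
  have a2 : tt j (-i-1) (DD i (-j-1)) = 0 := by rw [tt_DD _ _ h]; grind
  have a3 : tt i (-j-1) (DD j (-i-1)) = 0 := by rw [tt_DD _ _ h']; grind
  have e1 : SS j (-i-1) g + 1 - (tt j (-i-1) g + tt j (-i-1) (DD j (-i-1))) + (SS i (-j-1) g + SS i (-j-1) (DD j (-i-1))
     - SS i (-j-1) (DD i (-j-1)) + 1 - (tt i (-j-1) g + tt i (-j-1) (DD j (-i-1))))
     = SS i (-j) g + SS j (-i) g - 2 * tt i (-j) g + 2 := by
    rw [SS_DD h h', SS_DD h h, a1, a3]; unfold Ca; grind (splits := 30)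
  have e2 : - Ca i j + ((SS i (-j-1) g - SS i (-j-1) (DD i (-j-1)) + 1 - tt i (-j-1) g) +
     (SS j (-i-1) g - SS j (-i-1) (DD i (-j-1)) + 1 - (tt j (-i-1) g - tt j (-i-1) (DD i (-j-1)) + tt j (-i-1) (DD j (-i-1)))))
     = (SS i (-j) g + SS j (-i) g - 2 * tt i (-j) g) := by
    rw [SS_DD h' h, SS_DD h h, a1, a2]; unfold Ca; grind (splits := 30)
  have hX : qq * qq * xf i (-j-1) (tt (i+1) (-j-1) g + tt (i+1) (-j-1) (DD j (-i-1)) - tt (i+1) (-j-1) (DD i (-j-1)))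
     - xf i (-j-1) (tt (i+1) (-j-1) g - tt (i+1) (-j-1) (DD i (-j-1))) = - uu 1 := by
    unfold xf
    rw [uu_one_eq]
    by_cases hb : -j-1 = i + 1
    · simp [hb]
    · rw [if_neg hb, if_neg hb]
      have : tt (i+1) (-j-1) (DD j (-i-1)) = -1 := by rw [tt_DD _ _ h']; grind
      rw [this, uu_sq, uu_sq,
        show tt (i+1) (-j-1) g - tt (i+1) (-j-1) (DD i (-j-1)) =
         (tt (i+1) (-j-1) g + -1 - tt (i+1) (-j-1) (DD i (-j-1))) + 1 by ring, zq_add _ 1, zpow_one]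
      ring
  have hU : tt j (-i-1) g - tt j (-i-1) (DD i (-j-1)) + tt j (-i-1) (DD j (-i-1)) =
    tt (i+1) (-j) g + 1 + (if j = i + 1 then 1 else 0) := by rw [a1, a2, hy]; ring
  have hU2 : tt j (-i-1) g + tt j (-i-1) (DD j (-i-1)) =
    tt (i+1) (-j) g + 1 + (if j = i + 1 then 1 else 0) := by rw [a1, hy]; ring
  rw [dl_eq]
  have e1' := congrArg (fun z : ℤ => qq ^ z) e1
  have e2' := congrArg (fun z : ℤ => qq ^ z) e2
  rw [hU2] at e1' ⊢
  rw [hU] at e2' ⊢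
  rw [zq_add, zq_add _ 2, zq_2] at e1'
  rw [zq_add, zq_add (SS i (-j-1) g - SS i (-j-1) (DD i (-j-1)) + 1 - tt i (-j-1) g)] at e2'
  have hu : uu 1 ≠ 0 := uu_ne one_ne_zero
  revert hX e1' e2'
  generalize uu (tt (i+1) (-j) g + 1 + (if j = i + 1 then 1 else 0)) = U
  generalize xf i (-j-1) (tt (i+1) (-j-1) g + tt (i+1) (-j-1) (DD j (-i-1)) - tt (i+1) (-j-1) (DD i (-j-1))) = X
  generalize xf i (-j-1) (tt (i+1) (-j-1) g - tt (i+1) (-j-1) (DD i (-j-1))) = X'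
  intro hX e1' e2'
  rw [← mul_right_inj' hu]
  field_simp
  linear_combination X * e1' * U - X' * e2' * U +
      qq ^ (SS i (-j) g + SS j (-i) g - 2 * tt i (-j) g) * U * hX
end part3

section part4
/-- correction term -/
def kap (i : ℤ) (g : Gam) : KK :=
  qq ^ (2 * SS i (-i) g - 2 - 2 * tt i (-i) g) * uu (tt (i+1) (-i) g)

def dl0 (i b : ℤ) (g : Gam) : KK :=
  if b = i + 1 then qq ^ (2 * SS i b g) else qq ^ (2 * SS i b g) - qq ^ (2 * SS i (b-1) g)

lemma dl_diag_gen {i b : ℤ} (h : i < b) (g : Gam) (h1 : b ≠ -i) (h2 : b ≠ -i-1) :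
    dl i b i b g = dl0 i b g := by
  have a1 : tt i b (DD i b) = 1 := by rw [tt_DD _ _ h]; grind
  have s1 : SS i b (DD i b) = 0 := by rw [SS_DD h h]; grind
  have a2 : b ≠ i + 1 → tt (i+1) b (DD i b) = -1 := by intro hb; rw [tt_DD _ _ h]; grind
  have ca : Ca i i = 2 := by simp [Ca]
  rw [dl_eq, a1, s1, ca]
  have hu := uu_one_eq
  have hu1 : uu 1 ≠ 0 := uu_ne one_ne_zero
  rw [hu, ← pow_two] at hu1
  unfold xf dl0
  split_ifs with hb
  · rw [hu, uu_sq, uu_sq]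
    simp only [zq_add, zq_sub, zq_two, zpow_one, zq_2, zpow_neg, zpow_zero]
    have := zq_ne (SS i b g); have := zq_ne (tt i b g); have := qq_ne
    generalize qq ^ (SS i b g) = A1 at *
    generalize qq ^ (tt i b g) = A2 at *
    field_simp
    ring
  · have sp := SS_pred i b g
    rw [sp, a2 hb, hu, uu_sq, uu_sq, uu_sq, uu_sq]
    simp only [zq_add, zq_sub, zq_two, zpow_one, zq_2, zpow_neg, zpow_zero]
    have := zq_ne (SS i b g); have := zq_ne (tt i b g); have := qq_ne
    have := zq_ne (tt (i+1) b g)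
    generalize qq ^ (SS i b g) = A1 at *
    generalize qq ^ (tt i b g) = A2 at *
    generalize qq ^ (tt (i+1) b g) = A3 at *
    field_simp
    ring

lemma dl_diag_c {i : ℤ} (hi : i < 0) (g : Gam) :
    dl i (-i) i (-i) g = dl0 i (-i) g + kap i g := by
  have h : i < -i := by omega
  have a1 : tt i (-i) (DD i (-i)) = 2 := by rw [tt_DD _ _ h]; grind
  have s1 : SS i (-i) (DD i (-i)) = 0 := by rw [SS_DD h h]; grind
  have a2 : tt (i+1) (-i) (DD i (-i)) = -1 := by rw [tt_DD _ _ h]; grind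
  have ca : Ca i i = 2 := by simp [Ca]
  have hb : ¬ (-i = i + 1) := by omega
  rw [dl_eq, a1, s1, ca]
  have hu := uu_one_eq
  have hu1 : uu 1 ≠ 0 := uu_ne one_ne_zero
  rw [hu, ← pow_two] at hu1
  unfold xf dl0 kap
  have sp := SS_pred i (-i) g
  rw [if_neg hb, if_neg hb, if_neg hb]
  rw [sp, a2, hu, uu_sq, uu_sq, uu_sq, uu_sq, uu_sq]
  simp only [zq_add, zq_sub, zq_two, zpow_one, zq_2, zpow_neg, zpow_zero]
  have := zq_ne (SS i (-i) g); have := zq_ne (tt i (-i) g); have := qq_ne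
  have := zq_ne (tt (i+1) (-i) g)
  generalize qq ^ (SS i (-i) g) = A1 at *
  generalize qq ^ (tt i (-i) g) = A2 at *
  generalize qq ^ (tt (i+1) (-i) g) = A3 at *
  field_simp
  ring

lemma dl_diag_d {i : ℤ} (hi : i < 0) (g : Gam) :
    dl i (-i-1) i (-i-1) g = dl0 i (-i-1) g - kap i g := by
  have h : i < -i-1 := by omega
  have a1 : tt i (-i-1) (DD i (-i-1)) = 1 := by rw [tt_DD _ _ h]; grind
  have s1 : SS i (-i-1) (DD i (-i-1)) = 1 := by rw [SS_DD h h]; grind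
  have a2 : -i-1 ≠ i + 1 → tt (i+1) (-i-1) (DD i (-i-1)) = -2 := by
    intro hb; rw [tt_DD _ _ h]; grind
  have ca : Ca i i = 2 := by simp [Ca]
  have sp0 := SS_pred i (-i) g
  have hyd : tt i (-i-1) g = tt (i+1) (-i) g := by rw [tt_symm]; congr 2; ring
  have hS : SS i (-i) g = SS i (-i-1) g - tt i (-i-1) g + tt i (-i) g := by omega
  have hu := uu_one_eq
  have hu1 : uu 1 ≠ 0 := uu_ne one_ne_zero
  rw [hu, ← pow_two] at hu1
  have hk : kap i g = qq ^ (2 * SS i (-i-1) g - 2 - 2 * tt i (-i-1) g) * uu (tt i (-i-1) g) := by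
    unfold kap; rw [hS, hyd]; congr 2; ring
  rw [dl_eq, a1, s1, ca, hk]
  have := zq_ne (SS i (-i-1) g); have := zq_ne (tt i (-i-1) g); have := qq_ne
  have := zq_ne (tt (i+1) (-i-1) g)
  unfold xf dl0
  by_cases hb : -i-1 = i + 1
  · rw [if_pos hb, if_pos hb, if_pos hb, hu, uu_sq, uu_sq, uu_sq]
    simp only [zq_add, zq_sub, zq_two, zpow_one, zq_2, zpow_neg, zpow_zero]
    generalize qq ^ (SS i (-i-1) g) = A1 at *
    generalize qq ^ (tt i (-i-1) g) = A2 at *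
    field_simp
    ring
  · have sp := SS_pred i (-i-1) g
    rw [if_neg hb, if_neg hb, if_neg hb]
    rw [sp, a2 hb, hu, uu_sq, uu_sq, uu_sq, uu_sq, uu_sq]
    simp only [zq_add, zq_sub, zq_two, zpow_one, zq_2, zpow_neg, zpow_zero]
    generalize qq ^ (SS i (-i-1) g) = A1 at *
    generalize qq ^ (tt i (-i-1) g) = A2 at *
    generalize qq ^ (tt (i+1) (-i-1) g) = A3 at *
    field_simp
    ring

lemma sum_dl0 {i n : ℤ} (hn : i < n) (g : Gam) (h : SS i n g = 0) :
    ∑ b ∈ Finset.Ioc i n, dl0 i b g = 1 := by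
  have key : ∀ k : ℕ, ∑ b ∈ Finset.Ioc i (i + 1 + k), dl0 i b g = qq ^ (2 * SS i (i+1+k) g) := by
    intro k
    induction k with
    | zero =>
      have : Finset.Ioc i (i + 1 + ((0:ℕ):ℤ)) = {i+1} := by
        ext x; simp only [Finset.mem_Ioc, Finset.mem_singleton]; push_cast; omega
      rw [this]; simp [dl0]
    | succ k ih =>
      have : Finset.Ioc i (i + 1 + ((k+1:ℕ):ℤ)) = insert (i+1+((k+1:ℕ):ℤ)) (Finset.Ioc i (i+1+k)) := by
        ext x; simp only [Finset.mem_Ioc, Finset.mem_insert]; push_cast; omega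
      rw [this, Finset.sum_insert (by simp), ih]
      unfold dl0
      rw [if_neg (by push_cast; omega)]
      have : i + 1 + ((k+1:ℕ):ℤ) - 1 = i + 1 + k := by push_cast; ring
      rw [this]; ring
  have := key (n - i - 1).toNat
  rw [show i + 1 + ((n - i - 1).toNat : ℤ) = n by omega, h] at this
  simpa using this

lemma sum_dl_diag {i n : ℤ} (hn : Win n i) (g : Gam) (h : SS i n g = 0) :
    ∑ b ∈ Finset.Ioc i n, dl i b i b g = 1 := by
  unfold Win at hn
  rw [← sum_dl0 hn.2 g h]
  by_cases hi : i < 0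
  · have hc : -i ∈ Finset.Ioc i n := by rw [Finset.mem_Ioc]; omega
    have hd : -i-1 ∈ Finset.Ioc i n := by rw [Finset.mem_Ioc]; omega
    have : ∀ b ∈ Finset.Ioc i n, dl i b i b g = dl0 i b g + (if b = -i then kap i g else 0)
        - (if b = -i-1 then kap i g else 0) := by
      intro b hb
      rw [Finset.mem_Ioc] at hb
      by_cases h1 : b = -i
      · subst h1
        rw [dl_diag_c hi, if_pos rfl, if_neg (by omega), sub_zero]
      · by_cases h2 : b = -i-1
        · subst h2
          rw [dl_diag_d hi, if_pos rfl, if_neg (by omega), add_zero]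
        · rw [dl_diag_gen hb.1 g h1 h2, if_neg h1, if_neg h2, add_zero, sub_zero]
    rw [Finset.sum_congr rfl this, Finset.sum_sub_distrib, Finset.sum_add_distrib,
      Finset.sum_ite_eq', Finset.sum_ite_eq', if_pos hc, if_pos hd, add_sub_cancel_right]
  · refine Finset.sum_congr rfl fun b hb => ?_
    rw [Finset.mem_Ioc] at hb
    exact dl_diag_gen hb.1 g (by omega) (by omega)

lemma dl_zero {i b j b' : ℤ} (h : i < b) (h' : j < b') (n1 : ¬(i = j ∧ b = b'))
    (n3 : ¬(b = -j ∧ b' = -i)) (n6 : ¬(b = -j-1 ∧ b' = -i-1)) (g : Gam) : dl i b j b' g = 0 :=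
  sub_eq_zero.mpr (ef_generic h h' n1 n3 n6 g)

lemma EF_expand {i j n : ℤ} (hi : Win n i) (hj : Win n j) {g : Gam} (hg : Bdd n g) :
    Eop i (Fop j (pp g)) - qq ^ (- Ca i j) • Fop j (Eop i (pp g)) =
    ∑ b ∈ Finset.Ioc i n, ∑ b' ∈ Finset.Ioc j n, dl i b j b' g • pp (g + DD j b' - DD i b) := by
  have h1 : Eop i (Fop j (pp g)) = ∑ b ∈ Finset.Ioc i n, ∑ b' ∈ Finset.Ioc j n,
      (fco j b' g * eco i b (g + DD j b')) • pp (g + DD j b' - DD i b) := by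
    rw [Finset.sum_comm, Fop_pp hg hj]
    unfold Fsum
    rw [map_sum]
    refine Finset.sum_congr rfl fun b' hb' => ?_
    rw [Finset.mem_Ioc] at hb'
    rw [map_smul, Eop_pp (hg.add (Bdd.DD hb'.1 hj.1 hj.2 hb'.2)) hi]
    unfold Esum
    rw [Finset.smul_sum]
    refine Finset.sum_congr rfl fun b _ => ?_
    rw [smul_smul]
  have h2 : Fop j (Eop i (pp g)) = ∑ b ∈ Finset.Ioc i n, ∑ b' ∈ Finset.Ioc j n,
      (eco i b g * fco j b' (g - DD i b)) • pp (g + DD j b' - DD i b) := by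
    rw [Eop_pp hg hi]
    unfold Esum
    rw [map_sum]
    refine Finset.sum_congr rfl fun b hb => ?_
    rw [Finset.mem_Ioc] at hb
    rw [map_smul, Fop_pp (hg.sub (Bdd.DD hb.1 hi.1 hi.2 hb.2)) hj]
    unfold Fsum
    rw [Finset.smul_sum]
    refine Finset.sum_congr rfl fun b' _ => ?_
    rw [smul_smul, sub_add_eq_add_sub]
  rw [h1, h2, Finset.smul_sum, ← Finset.sum_sub_distrib]
  refine Finset.sum_congr rfl fun b _ => ?_
  rw [Finset.smul_sum, ← Finset.sum_sub_distrib]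
  refine Finset.sum_congr rfl fun b' _ => ?_
  unfold dl
  rw [sub_smul, smul_smul]

lemma double_sum_single {s s' : Finset ℤ} {x x' : ℤ} (hx : x ∈ s) (hx' : x' ∈ s')
    (f : ℤ → ℤ → NN) (h : ∀ b ∈ s, ∀ b' ∈ s', ¬ (b = x ∧ b' = x') → f b b' = 0) :
    ∑ b ∈ s, ∑ b' ∈ s', f b b' = f x x' := by
  rw [Finset.sum_eq_single_of_mem x hx, Finset.sum_eq_single_of_mem x' hx']
  · intro b' hb' hne; exact h x hx b' hb' (by tauto)
  · intro b hb hne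
    exact Finset.sum_eq_zero fun b' hb' => h b hb b' hb' (by tauto)

lemma tau_eq (i : ℤ) (g : Gam) : tau i g = SS i (i+1) g + SS (-1-i) (-i) g - 2 * tt i (i+1) g := by
  unfold tau
  simp only [AddMonoidHom.sub_apply, AddMonoidHom.add_apply]; ring

lemma sgl_symm (a b : ℤ) : sgl a b = sgl (-b) (-a) := by
  apply gam_ext
  intro x y
  rw [tt_sgl, tt_sgl]; grind (splits := 20)

lemma EF_pp (i j : ℤ) (g : Gam) :
    Eop i (Fop j (pp g)) = qq ^ (- Ca i j) • Fop j (Eop i (pp g)) + (if i = j then pp g else 0)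
      + (if -1 - i = j then Top i (pp g) else 0) := by
  obtain ⟨n, hi, hj, hg⟩ : ∃ n, Win n i ∧ Win n j ∧ Bdd n g := by
    refine ⟨max (bd i g) (bd j g), ?_, ?_, (bd_Bdd i g).mono (le_max_left _ _)⟩
    · have := bd_Win i g; have := le_max_left (bd i g) (bd j g); unfold Win at *; omega
    · have := bd_Win j g; have := le_max_right (bd i g) (bd j g); unfold Win at *; omega
  rw [add_assoc, ← sub_eq_iff_eq_add', EF_expand hi hj hg]
  have hi' := hi; have hj' := hj
  unfold Win at hi' hj'
  by_cases hij : i = j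
  · subst hij
    rw [if_pos rfl, if_neg (by omega), add_zero]
    have : ∀ b ∈ Finset.Ioc i n, ∑ b' ∈ Finset.Ioc i n, dl i b i b' g • pp (g + DD i b' - DD i b)
        = dl i b i b g • pp g := by
      intro b hb
      rw [Finset.sum_eq_single_of_mem b hb, add_sub_cancel_right]
      intro b' hb' hne
      rw [Finset.mem_Ioc] at hb hb'
      rw [dl_zero hb.1 hb'.1 (by omega) (by omega) (by omega), zero_smul]
    rw [Finset.sum_congr rfl this, ← Finset.sum_smul, sum_dl_diag hi g (SS_of_Bdd hg i le_rfl), one_smul]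
  · rw [if_neg hij, zero_add]
    rcases lt_trichotomy (i + j) (-1) with hs | hs | hs
    · rw [if_neg (by omega)]
      have c1 : -j ∈ Finset.Ioc i n := by rw [Finset.mem_Ioc]; omega
      have c2 : -i ∈ Finset.Ioc j n := by rw [Finset.mem_Ioc]; omega
      have d1 : -j-1 ∈ Finset.Ioc i n := by rw [Finset.mem_Ioc]; omega
      have d2 : -i-1 ∈ Finset.Ioc j n := by rw [Finset.mem_Ioc]; omega
      set K := qq ^ (SS i (-j) g + SS j (-i) g - 2 * tt i (-j) g) *
        uu (tt (i+1) (-j) g + 1 + (if j = i + 1 then 1 else 0)) with hK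
      have ht : g + DD j (-i) - DD i (-j) = g + DD j (-i-1) - DD i (-j-1) := by
        unfold DD
        rw [sgl_symm j (-i), sgl_symm (j+1) (-i), sgl_symm j (-i-1), sgl_symm (j+1) (-i-1)]
        rw [show -(-i) = i by ring, show -(-i-1) = i+1 by ring, show -(j+1) = -j-1 by ring]
        abel
      have h3 : dl i (-j) j (-i) g = K := by
        rw [dl_three hij (by omega), hK, xf, if_neg (by omega)]
      have h6 : dl i (-j-1) j (-i-1) g = -K := dl_six hij hs g
      have : ∀ b ∈ Finset.Ioc i n, ∀ b' ∈ Finset.Ioc j n, dl i b j b' g • pp (g + DD j b' - DD i b) =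
          (if b = -j ∧ b' = -i then K • pp (g + DD j (-i) - DD i (-j)) else 0) +
          (if b = -j-1 ∧ b' = -i-1 then - (K • pp (g + DD j (-i) - DD i (-j))) else 0) := by
        intro b hb b' hb'
        rw [Finset.mem_Ioc] at hb hb'
        by_cases q1 : b = -j ∧ b' = -i
        · rw [if_pos q1, if_neg (by omega), add_zero, q1.1, q1.2, h3]
        · by_cases q2 : b = -j-1 ∧ b' = -i-1
          · rw [if_neg q1, if_pos q2, zero_add, q2.1, q2.2, h6, ht, neg_smul]
          · rw [if_neg q1, if_neg q2, dl_zero hb.1 hb'.1 (by omega) q1 q2, zero_smul, add_zero]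
      rw [Finset.sum_congr rfl fun b hb => Finset.sum_congr rfl (this b hb)]
      simp only [Finset.sum_add_distrib]
      rw [double_sum_single c1 c2 (fun b b' => if b = -j ∧ b' = -i then _ else 0)
        (fun b _ b' _ hh => if_neg hh), double_sum_single d1 d2 (fun b b' => if b = -j-1 ∧ b' = -i-1 then _ else 0)
        (fun b _ b' _ hh => if_neg hh)]
      simp
    · obtain rfl : j = -1 - i := by omega
      rw [if_pos rfl, double_sum_single (x := -(-1-i)) (x' := -i)]
      · rw [dl_three hij (by omega), xf, if_pos (by omega), mul_one, Top_pp, tau_eq]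
        have : DD (-1-i) (-i) = DD i (-(-1-i)) := by
          unfold DD
          rw [sgl_symm (-1-i) (-i)]
          rw [neg_neg, show -(-1-i) = i+1 by ring, show -1-i+1 = -i by ring]
          simp [sgl]
        rw [this, add_sub_cancel_right, show -(-1-i) = i+1 by ring]
      · rw [Finset.mem_Ioc]; omega
      · rw [Finset.mem_Ioc]; omega
      · intro b hb b' hb' hne
        rw [Finset.mem_Ioc] at hb hb'
        rw [dl_zero hb.1 hb'.1 (by omega) (by omega) (by omega), zero_smul]
    · rw [if_neg (by omega)]
      refine Finset.sum_eq_zero fun b hb => Finset.sum_eq_zero fun b' hb' => ?_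
      rw [Finset.mem_Ioc] at hb hb'
      rw [dl_zero hb.1 hb'.1 (by omega) (by omega) (by omega), zero_smul]

lemma EF_rel (i j : ℤ) (u : NN) :
    Eop i (Fop j u) = qq ^ (- Ca i j) • Fop j (Eop i u) + (if i = j then u else 0)
      + (if -1 - i = j then Top i u else 0) := by
  have : (Eop i ∘ₗ Fop j) = qq ^ (- Ca i j) • (Fop j ∘ₗ Eop i) + (if i = j then LinearMap.id else 0)
      + (if -1 - i = j then Top i else 0) := by
    apply NN_ext
    intro g _
    simp only [LinearMap.comp_apply, LinearMap.add_apply, LinearMap.smul_apply]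
    rw [EF_pp]
    split_ifs <;> simp
  have := LinearMap.congr_fun this u
  simp only [LinearMap.comp_apply, LinearMap.add_apply, LinearMap.smul_apply] at this
  rw [this]
  split_ifs <;> simp

lemma tau_DD (i : ℤ) {k b : ℤ} (h : k < b) : tau i (DD k b) = -(Ca i k + Ca (-1-i) k) := by
  rw [tau_eq, SS_DD (by omega) h, SS_DD (by omega) h, tt_DD _ _ h]
  unfold Ca
  grind (splits := 40)

lemma TF_rel (i j : ℤ) (u : NN) :
    Top i (Fop j u) = qq ^ (-(Ca i j + Ca (-1-i) j)) • Fop j (Top i u) := by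
  have : (Top i ∘ₗ Fop j) = qq ^ (-(Ca i j + Ca (-1-i) j)) • (Fop j ∘ₗ Top i) := by
    apply NN_ext
    intro g _
    simp only [LinearMap.comp_apply, LinearMap.smul_apply]
    rw [Top_pp, map_smul, Fop_pp (bd_Bdd j g) (bd_Win j g)]
    unfold Fsum
    rw [map_sum, Finset.smul_sum, Finset.smul_sum]
    refine Finset.sum_congr rfl fun b hb => ?_
    rw [Finset.mem_Ioc] at hb
    rw [map_smul, Top_pp, map_add, tau_DD i hb.1, zq_add]
    simp only [smul_smul]
    congr 1; ring
  exact LinearMap.congr_fun this u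
end part4

section part5
/-- degree -/
def dg : Gam →+ ℤ :=
  Finsupp.liftAddHom fun s : RR => AddMonoidHom.mulRight (s.1.2 - s.1.1)

lemma dg_sgl {a b : ℤ} (h : a ≤ b) : dg (sgl a b) = b - a := by
  unfold sgl
  split_ifs with h1
  · unfold dg rep
    split_ifs with h2
    · simp
    · simp; ring
  · rw [map_zero]; omega

lemma dg_DD {i b : ℤ} (h : i < b) : dg (DD i b) = 1 := by
  unfold DD; rw [map_sub, dg_sgl h.le, dg_sgl (by omega)]; ring

lemma dg_nonneg {g : Gam} (h : 0 ≤ g) : 0 ≤ dg g := by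
  simp only [dg, Finsupp.liftAddHom_apply]
  exact Finset.sum_nonneg fun s _ => mul_nonneg (h s) (by have := s.2.1; omega)

lemma dg_eq_zero {g : Gam} (h : 0 ≤ g) (h0 : dg g = 0) : g = 0 := by
  simp only [dg, Finsupp.liftAddHom_apply, Finsupp.sum] at h0
  rw [Finset.sum_eq_zero_iff_of_nonneg] at h0
  · ext s
    by_contra hs
    have := h0 s (Finsupp.mem_support_iff.mpr hs)
    have h2 := s.2.1
    simp only [AddMonoidHom.coe_mulRight, mul_eq_zero] at this
    rcases this with h3 | h3
    · exact hs h3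
    · omega
  · exact fun s _ => mul_nonneg (h s) (by have := s.2.1; omega)

def es (s : RR) : ℤ := if s.1.1 + s.1.2 = 0 then 2 else 1

def prs (s : RR) (c : ℤ) : KK := ∏ k ∈ Finset.range c.toNat, uu (es s * (k + 1))

def muu (g : Gam) : KK := g.prod prs

lemma muu_ne (g : Gam) : muu g ≠ 0 := by
  unfold muu Finsupp.prod prs
  refine Finset.prod_ne_zero_iff.mpr fun s _ => Finset.prod_ne_zero_iff.mpr fun k _ => uu_ne ?_
  unfold es; split_ifs <;> omega

lemma muu_add_single {g : Gam} (h : 0 ≤ g) (s : RR) :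
    muu (g + Finsupp.single s 1) = muu g * uu (es s * (g s + 1)) := by
  unfold muu
  have p0 : ∀ s, prs s 0 = 1 := by intro s; simp [prs]
  rw [← Finsupp.mul_prod_erase' (g + Finsupp.single s 1) s prs p0, ← Finsupp.mul_prod_erase' g s prs p0]
  have h1 : (g + Finsupp.single s 1).erase s = g.erase s := by
    rw [Finsupp.erase_add, Finsupp.erase_single, add_zero]
  rw [h1]
  have h2 : prs s ((g + Finsupp.single s (1:ℤ) : Gam) s) = prs s (g s) * uu (es s * (g s + 1)) := by
    have hs := h s
    simp only [Finsupp.coe_zero, Pi.zero_apply] at hs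
    unfold prs
    rw [Finsupp.add_apply, Finsupp.single_eq_same, show (g s + 1).toNat = (g s).toNat + 1 by omega,
      Finset.prod_range_succ]
    rw [show (((g s).toNat : ℤ)) = g s by omega]
  rw [h2]; ring

lemma tt_rep {a b : ℤ} (h : a < b) (g : Gam) : tt a b g = es (rep a b h) * g (rep a b h) := by
  have h1 := tt_apply_R (rep a b h) g
  have h2 : tt (rep a b h).1.1 (rep a b h).1.2 g = tt a b g := by
    unfold rep
    split_ifs with h3
    · rfl
    · exact (tt_symm a b g).symm
  rw [← h2, h1, es]
  split_ifs <;> ring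

lemma muu_add_sgl {g : Gam} (h : 0 ≤ g) {a b : ℤ} (hab : a < b) :
    muu (g + sgl a b) = muu g * uu (tt a b (g + sgl a b)) := by
  unfold sgl
  rw [dif_pos hab, muu_add_single h, tt_rep hab, Finsupp.add_apply, Finsupp.single_eq_same]

def nu (g : Gam) : KK := uu 1 ^ (dg g) / muu g

lemma nu_ne (g : Gam) : nu g ≠ 0 := div_ne_zero (zpow_ne_zero _ (uu_ne one_ne_zero)) (muu_ne g)

lemma sgl_nonneg (a b : ℤ) : 0 ≤ sgl a b := by
  rw [nonneg_iff]; intro x y; rw [tt_sgl]; split_ifs <;> omega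

lemma sub_sgl_nonneg {g : Gam} (h : 0 ≤ g) {a b : ℤ} (hp : 0 < tt a b g) : 0 ≤ g - sgl a b := by
  have hab : a < b := by
    by_contra hh; rw [tt_of_ge (by omega)] at hp; omega
  rw [nonneg_iff] at h ⊢
  intro x y
  have h1 := h x y
  rw [map_sub, tt_sgl, if_pos hab]
  have h2 := tt_even (a := a) (b := b)
  have h3 : x = -b ∧ y = -a → tt x y g = tt a b g := by rintro ⟨rfl, rfl⟩; rw [tt_symm a b]
  have h4 : x = a ∧ y = b → tt x y g = tt a b g := by rintro ⟨rfl, rfl⟩; rfl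
  by_cases h5 : b = -a
  · obtain ⟨k, hk⟩ := tt_even h5 g
    grind
  · grind

lemma nu_move {g : Gam} {i b : ℤ} (h : i < b) (hg : 0 ≤ g) (hg' : 0 ≤ g + DD i b) :
    nu (g + DD i b) * uu (tt i b (g + DD i b)) = uu 1 * xf i b (tt (i+1) b g) * nu g := by
  unfold nu
  rw [map_add, dg_DD h, zpow_add₀ (uu_ne one_ne_zero), zpow_one]
  have hpos : 0 < tt i b (g + DD i b) := by
    have h1 := (nonneg_iff _).mp hg i b
    rw [map_add, tt_DD _ _ h]
    grind
  by_cases hb : b = i + 1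
  · have : DD i b = sgl i b := by unfold DD; subst hb; simp [sgl]
    rw [this] at hpos ⊢
    rw [muu_add_sgl hg h, xf, if_pos hb]
    have := muu_ne g
    have := uu_ne (m := tt i b (g + sgl i b)) (by omega)
    field_simp
  · rw [xf, if_neg hb]
    have hlt : i + 1 < b := by omega
    have h0 : 0 ≤ g - sgl (i+1) b := by
      apply sub_sgl_nonneg hg
      have := (nonneg_iff _).mp hg' (i+1) b
      rw [map_add, tt_DD _ _ h] at this
      grind
    have e1 : g + DD i b = (g - sgl (i+1) b) + sgl i b := by unfold DD; abel
    have e2 : muu g = muu (g - sgl (i+1) b) * uu (tt (i+1) b g) := by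
      conv_lhs => rw [← sub_add_cancel g (sgl (i+1) b), muu_add_sgl h0 hlt]
      rw [sub_add_cancel]
    have e3 : muu (g + DD i b) = muu (g - sgl (i+1) b) * uu (tt i b (g + DD i b)) := by
      conv_lhs => rw [e1, muu_add_sgl h0 h]
      rw [← e1]
    have n1 := muu_ne g
    rw [e2] at n1
    rw [e2, e3]
    have := left_ne_zero_of_mul n1
    have := right_ne_zero_of_mul n1
    have := uu_ne (m := tt i b (g + DD i b)) (by omega)
    field_simp

lemma co_move {g : Gam} {i b : ℤ} (h : i < b) (hg : 0 ≤ g) (hg' : 0 ≤ g + DD i b) :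
    fco i b g * nu (g + DD i b) = eco i b (g + DD i b) * nu g := by
  have h1 := nu_move h hg hg'
  unfold fco eco
  rw [add_sub_cancel_right, br_eq]
  have : (if b = i + 1 then 1 else uu (tt (i+1) b g)) = xf i b (tt (i+1) b g) := rfl
  rw [this, show SS i b g + 1 - tt i b (g + DD i b) = SS i b g + (1 - tt i b (g + DD i b)) by ring,
    zq_add (SS i b g)]
  have hu : uu 1 ≠ 0 := uu_ne one_ne_zero
  have h2 : uu (tt i b (g + DD i b)) / uu 1 * nu (g + DD i b) = xf i b (tt (i+1) b g) * nu g := by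
    field_simp
    linear_combination h1
  linear_combination qq ^ (SS i b g) * qq ^ (1 - tt i b (g + DD i b)) * h2

/-- the symmetric form -/
def ip : NN →ₗ[KK] NN →ₗ[KK] KK :=
  Finsupp.linearCombination KK fun g : BB => nu g.1 • Finsupp.lapply (R := KK) (M := KK) g

lemma ip_pp {g : Gam} (h : 0 ≤ g) (v : NN) : ip (pp g) v = nu g * v ⟨g, h⟩ := by
  unfold ip
  rw [pp_of_nonneg h, Finsupp.linearCombination_single, one_smul]
  simp

open Classical in
lemma ip_pp_pp (g g' : Gam) : ip (pp g) (pp g') = if g = g' ∧ 0 ≤ g then nu g else 0 := by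
  by_cases h : 0 ≤ g
  · rw [ip_pp h]
    by_cases h' : 0 ≤ g'
    · rw [pp_of_nonneg h']
      by_cases hh : g = g'
      · subst hh; simp [h]
      · rw [Finsupp.single_apply, if_neg, if_neg (by tauto), mul_zero]
        intro h2; exact hh (congrArg Subtype.val h2).symm
    · rw [pp_of_not h', if_neg]
      · simp
      · rintro ⟨rfl, -⟩; exact h' h
  · rw [pp_of_not h, if_neg (by tauto)]; simp

lemma ip_adj (i : ℤ) (u v : NN) : ip (Fop i u) v = ip u (Eop i v) := by
  have key : ∀ g, 0 ≤ g → ∀ g', 0 ≤ g' → ip (Fop i (pp g)) (pp g') = ip (pp g) (Eop i (pp g')) := by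
    intro g hg g' hg'
    have hb1 : Bdd (max (bd i g) (bd i g')) g := (bd_Bdd i g).mono (le_max_left _ _)
    have hb2 : Bdd (max (bd i g) (bd i g')) g' := (bd_Bdd i g').mono (le_max_right _ _)
    have hw : Win (max (bd i g) (bd i g')) i := by
      have := bd_Win i g; have := le_max_left (bd i g) (bd i g'); unfold Win at *; omega
    rw [Fop_pp hb1 hw, Eop_pp hb2 hw]
    unfold Fsum Esum
    rw [map_sum, map_sum, LinearMap.sum_apply]
    refine Finset.sum_congr rfl fun b hb => ?_
    rw [Finset.mem_Ioc] at hb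
    rw [map_smul, map_smul, LinearMap.smul_apply, ip_pp_pp, ip_pp_pp]
    by_cases hh : g + DD i b = g'
    · subst hh
      rw [if_pos ⟨rfl, hg'⟩, if_pos ⟨by abel, hg⟩, smul_eq_mul, smul_eq_mul, co_move hb.1 hg hg']
    · rw [if_neg (by tauto), if_neg]
      · simp
      · rintro ⟨h1, -⟩; apply hh; rw [h1]; abel
  have : ip ∘ₗ Fop i = (LinearMap.lcomp KK KK (Eop i)) ∘ₗ ip := by
    apply NN_ext
    intro g hg
    apply NN_ext
    intro g' hg'
    simpa using key g hg g' hg'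
  exact LinearMap.congr_fun (LinearMap.congr_fun this u) v

lemma ip_symm (u v : NN) : ip u v = ip v u := by
  have : ip = ip.flip := by
    apply NN_ext; intro g hg; apply NN_ext; intro g' hg'
    rw [LinearMap.flip_apply, ip_pp_pp, ip_pp_pp]
    by_cases h : g = g'
    · subst h; rfl
    · rw [if_neg (by tauto), if_neg (by rintro ⟨h1, -⟩; exact h h1.symm)]
  exact LinearMap.congr_fun (LinearMap.congr_fun this u) v

lemma ip_self (u : NN) : ip u u = u.sum fun g c => nu g.1 * c ^ 2 := by
  unfold ip
  rw [Finsupp.linearCombination_apply, Finsupp.sum, LinearMap.sum_apply]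
  refine Finset.sum_congr rfl fun g _ => ?_
  simp only [LinearMap.smul_apply, Finsupp.lapply_apply, smul_eq_mul]
  ring
end part5

section part6
open Polynomial in
/-- `x` is regular at `q = 0` with value `c`. -/
def Rs (x : KK) (c : ℚ) : Prop :=
  ∃ f g : Polynomial ℚ, eval 0 g ≠ 0 ∧ x = algebraMap (Polynomial ℚ) KK f / algebraMap (Polynomial ℚ) KK g ∧
    eval 0 f = c * eval 0 g

lemma am_ne {g : Polynomial ℚ} (h : Polynomial.eval 0 g ≠ 0) : algebraMap (Polynomial ℚ) KK g ≠ 0 := by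
  intro h0
  have : g = 0 := (map_eq_zero_iff _ (RatFunc.algebraMap_injective ℚ)).mp h0
  subst this; simp at h

lemma mem_A0set_iff {x : KK} : x ∈ A0set ↔ ∃ c, Rs x c := by
  constructor
  · rintro ⟨f, g, h, rfl⟩
    exact ⟨Polynomial.eval 0 f / Polynomial.eval 0 g, f, g, h, rfl, by field_simp⟩
  · rintro ⟨c, f, g, h, h2, -⟩
    exact ⟨f, g, h, h2⟩

lemma Rs.add {x y : KK} {c d : ℚ} (hx : Rs x c) (hy : Rs y d) : Rs (x + y) (c + d) := by
  obtain ⟨f, g, hg, rfl, h⟩ := hx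
  obtain ⟨f', g', hg', rfl, h'⟩ := hy
  refine ⟨f * g' + f' * g, g * g', by simp [hg, hg'], ?_, ?_⟩
  · have := am_ne hg; have := am_ne hg'
    rw [map_add, map_mul, map_mul, map_mul]; field_simp
  · simp only [Polynomial.eval_add, Polynomial.eval_mul, h, h']; ring

lemma Rs.mul {x y : KK} {c d : ℚ} (hx : Rs x c) (hy : Rs y d) : Rs (x * y) (c * d) := by
  obtain ⟨f, g, hg, rfl, h⟩ := hx
  obtain ⟨f', g', hg', rfl, h'⟩ := hy
  refine ⟨f * f', g * g', by simp [hg, hg'], ?_, ?_⟩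
  · have := am_ne hg; have := am_ne hg'
    rw [map_mul, map_mul]; field_simp
  · simp only [Polynomial.eval_mul, h, h']; ring

lemma Rs_C (c : ℚ) : Rs (algebraMap ℚ KK c) c :=
  ⟨Polynomial.C c, 1, by simp, by simp, by simp⟩

lemma Rs_one : Rs 1 1 := ⟨1, 1, by simp, by simp, by simp⟩
lemma Rs_zero : Rs 0 0 := ⟨0, 1, by simp, by simp, by simp⟩
lemma Rs_qq : Rs qq 0 := ⟨Polynomial.X, 1, by simp, by simp [qq], by simp⟩

lemma Rs.neg {x : KK} {c : ℚ} (hx : Rs x c) : Rs (-x) (-c) := by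
  have := (Rs_C (-1)).mul hx
  simpa using this

lemma Rs.sub {x y : KK} {c d : ℚ} (hx : Rs x c) (hy : Rs y d) : Rs (x - y) (c - d) := by
  rw [sub_eq_add_neg, sub_eq_add_neg]; exact hx.add hy.neg

lemma Rs.inv {x : KK} {c : ℚ} (hx : Rs x c) (hc : c ≠ 0) : Rs x⁻¹ c⁻¹ := by
  obtain ⟨f, g, hg, rfl, h⟩ := hx
  refine ⟨g, f, by rw [h]; exact mul_ne_zero hc hg, by rw [inv_div], ?_⟩
  rw [h]; field_simp

lemma Rs.unique {x : KK} {c d : ℚ} (hx : Rs x c) (hy : Rs x d) : c = d := by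
  obtain ⟨f, g, hg, rfl, h⟩ := hx
  obtain ⟨f', g', hg', h2, h'⟩ := hy
  have := am_ne hg; have := am_ne hg'
  rw [div_eq_div_iff (am_ne hg) (am_ne hg'), ← map_mul, ← map_mul] at h2
  have h3 := RatFunc.algebraMap_injective ℚ h2
  have h4 := congrArg (Polynomial.eval 0) h3
  simp only [Polynomial.eval_mul, h, h'] at h4
  have : (c - d) * (Polynomial.eval 0 g * Polynomial.eval 0 g') = 0 := by linear_combination h4
  rcases mul_eq_zero.mp this with h5 | h5
  · linarith
  · exact absurd h5 (mul_ne_zero hg hg')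

/-- the subring `A₀` -/
def A0 : Subring KK where
  carrier := A0set
  mul_mem' := by
    intro a b ha hb
    obtain ⟨c, hc⟩ := mem_A0set_iff.mp ha
    obtain ⟨d, hd⟩ := mem_A0set_iff.mp hb
    exact mem_A0set_iff.mpr ⟨_, hc.mul hd⟩
  one_mem' := mem_A0set_iff.mpr ⟨_, Rs_one⟩
  add_mem' := by
    intro a b ha hb
    obtain ⟨c, hc⟩ := mem_A0set_iff.mp ha
    obtain ⟨d, hd⟩ := mem_A0set_iff.mp hb
    exact mem_A0set_iff.mpr ⟨_, hc.add hd⟩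
  zero_mem' := mem_A0set_iff.mpr ⟨_, Rs_zero⟩
  neg_mem' := by
    intro a ha
    obtain ⟨c, hc⟩ := mem_A0set_iff.mp ha
    exact mem_A0set_iff.mpr ⟨_, hc.neg⟩

lemma mem_A0 {x : KK} : x ∈ A0 ↔ ∃ c, Rs x c := mem_A0set_iff

lemma Rs.mem {x : KK} {c : ℚ} (h : Rs x c) : x ∈ A0 := mem_A0.mpr ⟨c, h⟩

lemma qq_mem_A0 : qq ∈ A0 := Rs_qq.mem

lemma C_mem_A0 (c : ℚ) : algebraMap ℚ KK c ∈ A0 := (Rs_C c).mem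

/-- `x ∈ q A₀` -/
lemma Rs_zero_iff {x : KK} : Rs x 0 ↔ ∃ z ∈ A0, x = qq * z := by
  constructor
  · rintro ⟨f, g, hg, rfl, h⟩
    rw [zero_mul] at h
    have hd : Polynomial.X ∣ f := Polynomial.X_dvd_iff.mpr (by rwa [Polynomial.coeff_zero_eq_eval_zero])
    obtain ⟨k, rfl⟩ := hd
    refine ⟨_, ⟨k, g, hg, rfl⟩, ?_⟩
    rw [map_mul, RatFunc.algebraMap_X, qq]; ring
  · rintro ⟨z, hz, rfl⟩
    obtain ⟨c, hc⟩ := mem_A0.mp hz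
    simpa using Rs_qq.mul hc

lemma Rs_pow {x : KK} {c : ℚ} (hx : Rs x c) (n : ℕ) : Rs (x ^ n) (c ^ n) := by
  induction n with
  | zero => simpa using Rs_one
  | succ n ih => rw [pow_succ, pow_succ]; exact ih.mul hx

lemma Rs_sum {ι : Type*} (s : Finset ι) {x : ι → KK} {c : ι → ℚ} (h : ∀ k ∈ s, Rs (x k) (c k)) :
    Rs (∑ k ∈ s, x k) (∑ k ∈ s, c k) := by
  classical
  induction s using Finset.induction_on with
  | empty => simpa using Rs_zero
  | insert a s ha ih =>
    rw [Finset.sum_insert ha, Finset.sum_insert ha]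
    exact (h a (Finset.mem_insert_self _ _)).add (ih fun k hk => h k (Finset.mem_insert_of_mem hk))

lemma Rs_prod_one {ι : Type*} (s : Finset ι) {x : ι → KK} (h : ∀ k ∈ s, Rs (x k) 1) :
    Rs (∏ k ∈ s, x k) 1 := by
  classical
  induction s using Finset.induction_on with
  | empty => simpa using Rs_one
  | insert a s ha ih =>
    rw [Finset.prod_insert ha]
    simpa using (h a (Finset.mem_insert_self _ _)).mul (ih fun k hk => h k (Finset.mem_insert_of_mem hk))

lemma qzpow_mem_A0 {m : ℤ} (h : 0 ≤ m) : qq ^ m ∈ A0 := by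
  obtain ⟨n, rfl⟩ := Int.eq_ofNat_of_zero_le h
  rw [zpow_natCast]; exact pow_mem qq_mem_A0 n

lemma Rs_qzpow {m : ℤ} (h : 0 < m) : Rs (qq ^ m) 0 := by
  rw [Rs_zero_iff]
  refine ⟨qq ^ (m - 1), qzpow_mem_A0 (by omega), ?_⟩
  rw [zpow_sub_one₀ qq_ne]; field_simp [qq_ne]

lemma Rs_uu {m : ℤ} (h : 0 < m) : Rs (uu m) 1 := by
  have := Rs_one.sub (Rs_qzpow (m := 2 * m) (by omega))
  simpa [uu] using this

lemma Rs_nu {g : Gam} (h : 0 ≤ g) : Rs (nu g) 1 := by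
  unfold nu
  obtain ⟨n, hn⟩ := Int.eq_ofNat_of_zero_le (dg_nonneg h)
  rw [hn, zpow_natCast, div_eq_mul_inv]
  have h1 : Rs (muu g) 1 := by
    unfold muu Finsupp.prod prs
    refine Rs_prod_one _ fun s _ => Rs_prod_one _ fun k _ => Rs_uu ?_
    unfold es; split_ifs <;> omega
  simpa using (Rs_pow (Rs_uu one_pos) n).mul (h1.inv one_ne_zero)

lemma positivity_mod {ι : Type*} (s : Finset ι) {n x : ι → KK} (hn : ∀ k ∈ s, Rs (n k) 1)
    (hx : ∀ k ∈ s, x k ∈ A0) (h : Rs (∑ k ∈ s, n k * x k ^ 2) 0) : ∀ k ∈ s, Rs (x k) 0 := by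
  have : ∀ k, ∃ c, k ∈ s → Rs (x k) c := by
    intro k
    by_cases hk : k ∈ s
    · obtain ⟨c, hc⟩ := mem_A0.mp (hx k hk); exact ⟨c, fun _ => hc⟩
    · exact ⟨0, fun h => absurd h hk⟩
  choose c hc using this
  have h2 : Rs (∑ k ∈ s, n k * x k ^ 2) (∑ k ∈ s, 1 * c k ^ 2) :=
    Rs_sum s fun k hk => (hn k hk).mul (Rs_pow (hc k hk) 2)
  have h3 := h2.unique h
  intro k hk
  rw [Finset.sum_eq_zero_iff_of_nonneg (fun k _ => by positivity)] at h3
  have h4 := h3 k hk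
  have : c k = 0 := by simpa using h4
  rw [← this]; exact hc k hk

/-- the subring `A = ℚ[q,q⁻¹]` -/
def AA : Subring KK where
  carrier := Aset
  mul_mem' := by
    rintro _ _ ⟨f, n, rfl⟩ ⟨f', n', rfl⟩
    refine ⟨f * f', n + n', ?_⟩
    rw [map_mul]; push_cast; rw [neg_add, zpow_add₀ qq_ne]; ring
  one_mem' := ⟨1, 0, by simp⟩
  add_mem' := by
    rintro _ _ ⟨f, n, rfl⟩ ⟨f', n', rfl⟩
    refine ⟨f * Polynomial.X ^ n' + f' * Polynomial.X ^ n, n + n', ?_⟩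
    rw [map_add, map_mul, map_mul, map_pow, map_pow, RatFunc.algebraMap_X]
    change _ = (_ * qq ^ n' + _ * qq ^ n) * _
    push_cast; rw [neg_add, zpow_add₀ qq_ne]
    simp only [zpow_neg, zpow_natCast]
    have := qq_ne
    field_simp
  zero_mem' := ⟨0, 0, by simp⟩
  neg_mem' := by
    rintro _ ⟨f, n, rfl⟩
    exact ⟨-f, n, by rw [map_neg]; ring⟩

lemma C_mem_AA (c : ℚ) : algebraMap ℚ KK c ∈ AA := ⟨Polynomial.C c, 0, by simp⟩

lemma qzpow_mem_AA (m : ℤ) : qq ^ m ∈ AA := by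
  rcases le_total 0 m with h | h
  · obtain ⟨n, rfl⟩ := Int.eq_ofNat_of_zero_le h
    exact ⟨Polynomial.X ^ n, 0, by rw [map_pow, RatFunc.algebraMap_X]; simp [qq]⟩
  · obtain ⟨n, hn⟩ := Int.eq_ofNat_of_zero_le (show 0 ≤ -m by omega)
    exact ⟨1, n, by rw [map_one, one_mul, ← hn, neg_neg]⟩

lemma qq_mem_AA : qq ∈ AA := by simpa using qzpow_mem_AA 1

lemma AA_induction {P : KK → Prop} (h1 : ∀ (c : ℚ) (m : ℤ), P (algebraMap ℚ KK c * qq ^ m))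
    (h2 : ∀ x y, P x → P y → P (x + y)) {x : KK} (hx : x ∈ AA) : P x := by
  obtain ⟨f, n, rfl⟩ := hx
  induction f using Polynomial.induction_on' with
  | add p r hp hr => rw [map_add, add_mul]; exact h2 _ _ hp hr
  | monomial k c =>
    have := h1 c (k + (-(n:ℤ)))
    rw [zpow_add₀ qq_ne] at this
    convert this using 1
    rw [← Polynomial.C_mul_X_pow_eq_monomial, map_mul, map_pow, RatFunc.algebraMap_X]
    simp [qq]; ring

lemma AA_split (kbar : KK →+* KK) (hkb : kbar qq = qq⁻¹) {a : KK} (ha : a ∈ AA) :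
    ∃ s ∈ AA, ∃ r ∈ AA, kbar s = s ∧ Rs r 0 ∧ a = s + r := by
  refine AA_induction (P := fun a => ∃ s ∈ AA, ∃ r ∈ AA, kbar s = s ∧ Rs r 0 ∧ a = s + r) ?_ ?_ ha
  · intro c m
    have hC : kbar (algebraMap ℚ KK c) = algebraMap ℚ KK c := by
      rw [eq_ratCast, map_ratCast]
    have hz : ∀ k : ℤ, algebraMap ℚ KK c * qq ^ k ∈ AA := fun k => mul_mem (C_mem_AA c) (qzpow_mem_AA k)
    rcases lt_trichotomy m 0 with h | h | h
    · refine ⟨algebraMap ℚ KK c * qq ^ m + algebraMap ℚ KK c * qq ^ (-m), add_mem (hz _) (hz _),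
        - (algebraMap ℚ KK c * qq ^ (-m)), neg_mem (hz _), ?_, ?_, by ring⟩
      · rw [map_add, map_mul, map_mul, map_zpow₀, map_zpow₀, hkb, hC]; simp [add_comm]
      · simpa using ((Rs_C c).mul (Rs_qzpow (m := -m) (by omega))).neg
    · subst h
      exact ⟨_, hz 0, 0, zero_mem _, by simp [hC], Rs_zero, by simp⟩
    · refine ⟨0, zero_mem _, _, hz m, by simp, ?_, by simp⟩
      simpa using (Rs_C c).mul (Rs_qzpow h)
  · rintro x y ⟨s, hs, r, hr, h1, h2, rfl⟩ ⟨s', hs', r', hr', h1', h2', rfl⟩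
    exact ⟨s + s', add_mem hs hs', r + r', add_mem hr hr', by rw [map_add, h1, h1'],
      by simpa using h2.add h2', by ring⟩

lemma kbar_invol (kbar : KK →+* KK) (hkb : kbar qq = qq⁻¹) (x : KK) : kbar (kbar x) = x := by
  have h1 : ∀ f : Polynomial ℚ, kbar (kbar (algebraMap _ KK f)) = algebraMap _ KK f := by
    intro f
    induction f using Polynomial.induction_on' with
    | add p r hp hr => rw [map_add, map_add, map_add, hp, hr]
    | monomial k c =>
      have hC : kbar (algebraMap ℚ KK c) = algebraMap ℚ KK c := by rw [eq_ratCast, map_ratCast]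
      have : algebraMap (Polynomial ℚ) KK (Polynomial.monomial k c) = algebraMap ℚ KK c * qq ^ k := by
        rw [← Polynomial.C_mul_X_pow_eq_monomial, map_mul, map_pow, RatFunc.algebraMap_X]
        simp [qq]
      rw [this, map_mul, map_pow, hkb, hC, map_mul, map_pow, map_inv₀, hkb, hC, inv_inv]
  induction x using RatFunc.induction_on with
  | f p r hr => rw [map_div₀, map_div₀, h1, h1]

lemma kbar_AA (kbar : KK →+* KK) (hkb : kbar qq = qq⁻¹) {x : KK} (hx : x ∈ AA) : kbar x ∈ AA := by
  refine AA_induction (P := fun x => kbar x ∈ AA) ?_ ?_ hx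
  · intro c m
    have hC : kbar (algebraMap ℚ KK c) = algebraMap ℚ KK c := by rw [eq_ratCast, map_ratCast]
    rw [map_mul, map_zpow₀, hkb, hC, inv_zpow']
    exact mul_mem (C_mem_AA c) (qzpow_mem_AA _)
  · intro x y hx hy; rw [map_add]; exact add_mem hx hy

lemma A_inter (kbar : KK →+* KK) (hkb : kbar qq = qq⁻¹) {x : KK} (hx : x ∈ AA) (h0 : Rs x 0)
    (h1 : kbar x ∈ A0) : x = 0 := by
  obtain ⟨f, n, rfl⟩ := hx
  obtain ⟨z, ⟨k, g, hg, rfl⟩, hz⟩ := Rs_zero_iff.mp h0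
  have hgn := am_ne hg
  have hX : algebraMap (Polynomial ℚ) KK Polynomial.X = qq := RatFunc.algebraMap_X
  have hq := qq_ne
  have e1 : f * g = Polynomial.X ^ (n + 1) * k := by
    apply RatFunc.algebraMap_injective ℚ
    rw [map_mul, map_mul, map_pow, hX]
    rw [zpow_neg, zpow_natCast] at hz
    field_simp at hz
    rw [hz]; ring
  have hcop : IsCoprime (Polynomial.X ^ (n+1)) g := by
    apply IsCoprime.pow_left
    rw [Polynomial.irreducible_X.coprime_iff_not_dvd]
    intro h
    rw [Polynomial.X_dvd_iff, Polynomial.coeff_zero_eq_eval_zero] at h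
    exact hg h
  obtain ⟨f', rfl⟩ : Polynomial.X ^ (n+1) ∣ f := hcop.dvd_of_dvd_mul_right ⟨k, e1⟩
  have e2 : algebraMap (Polynomial ℚ) KK (Polynomial.X ^ (n + 1) * f') * qq ^ (-(n:ℤ)) =
      qq * algebraMap (Polynomial ℚ) KK f' := by
    rw [map_mul, map_pow, hX, zpow_neg, zpow_natCast, pow_succ]; field_simp
  rw [e2] at h1 ⊢
  by_contra hne
  have hf' : f' ≠ 0 := by rintro rfl; simp at hne
  have e3 : kbar (algebraMap _ KK f') = qq ^ (-(f'.natDegree : ℤ)) * algebraMap _ KK f'.reverse := by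
    have a1 : kbar (algebraMap _ KK f') = Polynomial.eval₂ (algebraMap ℚ KK) (qq⁻¹) f' := by
      have : kbar.comp (algebraMap (Polynomial ℚ) KK) = Polynomial.eval₂RingHom (algebraMap ℚ KK) (qq⁻¹) := by
        apply Polynomial.ringHom_ext
        · intro c
          have hC : kbar (algebraMap ℚ KK c) = algebraMap ℚ KK c := by rw [eq_ratCast, map_ratCast]
          simpa using hC
        · simp [← hkb, hX]
      exact RingHom.congr_fun this f'
    have a2 : algebraMap _ KK f'.reverse = Polynomial.eval₂ (algebraMap ℚ KK) qq f'.reverse := by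
      have : (algebraMap (Polynomial ℚ) KK) = Polynomial.eval₂RingHom (algebraMap ℚ KK) qq := by
        apply Polynomial.ringHom_ext
        · intro c; simp
        · simp [qq]
      exact RingHom.congr_fun this _
    letI : Invertible (qq⁻¹) := ⟨qq, mul_inv_cancel₀ hq, inv_mul_cancel₀ hq⟩
    have a3 : Polynomial.eval₂ (algebraMap ℚ KK) qq f'.reverse * (qq⁻¹) ^ f'.natDegree =
      Polynomial.eval₂ (algebraMap ℚ KK) qq⁻¹ f' := Polynomial.eval₂_reverse_mul_pow (algebraMap ℚ KK) (qq⁻¹) f'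
    rw [a1, a2, ← a3, zpow_neg, zpow_natCast, inv_pow]; ring
  rw [map_mul, hkb, e3] at h1
  obtain ⟨k', g', hg', h1⟩ := h1
  have hgn' := am_ne hg'
  have e4 : f'.reverse * g' = Polynomial.X ^ (f'.natDegree + 1) * k' := by
    apply RatFunc.algebraMap_injective ℚ
    rw [map_mul, map_mul, map_pow, hX]
    rw [zpow_neg, zpow_natCast] at h1
    field_simp at h1
    rw [h1]; ring
  have := congrArg (Polynomial.eval 0) e4
  simp only [Polynomial.eval_mul, Polynomial.eval_pow, Polynomial.eval_X, zero_pow (Nat.succ_ne_zero _), zero_mul] at this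
  rcases mul_eq_zero.mp this with h | h
  · rw [← Polynomial.coeff_zero_eq_eval_zero, Polynomial.coeff_zero_reverse] at h
    exact hf' (Polynomial.leadingCoeff_eq_zero.mp h)
  · exact hg' h
end part6

section part7
/-- `T x = x(x-1)/2` -/
def TT (x : ℤ) : ℤ := x * (x - 1) / 2

lemma TT_succ (x : ℤ) : TT (x + 1) = TT x + x := by
  unfold TT
  rw [show (x + 1) * (x + 1 - 1) = x * (x - 1) + x * 2 by ring, Int.add_mul_ediv_right _ _ (by norm_num)]

lemma TT_zero : TT 0 = 0 := rfl

lemma TT_two (x : ℤ) : 2 * TT x = x * (x - 1) := by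
  unfold TT
  apply Int.mul_ediv_cancel'
  have := (Int.even_mul_succ_self (x - 1)).two_dvd
  rw [show x * (x - 1) = (x - 1) * (x - 1 + 1) by ring]; exact this

lemma br_add (a b : ℤ) : br (a + b) = qq ^ (-b) * br a + qq ^ a * br b := by
  unfold br
  have h := qsub_ne
  rw [neg_add, zq_add, zq_add]
  field_simp
  ring

lemma br_sum (s : Finset ℤ) (f : ℤ → ℤ) : br (∑ b ∈ s, f b) =
    ∑ b ∈ s, qq ^ (∑ x ∈ s with x < b, f x - ∑ x ∈ s with b < x, f x) * br (f b) := by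
  induction s using Finset.induction_on_max with
  | empty => simp [br_zero]
  | insert a s h ih =>
    have ha : a ∉ s := fun hh => lt_irrefl _ (h a hh)
    rw [Finset.sum_insert ha, Finset.sum_insert ha, add_comm (f a), br_add, ih, Finset.mul_sum, add_comm]
    congr 1
    · congr 2
      rw [Finset.filter_insert, if_neg (lt_irrefl _), Finset.filter_insert, if_neg (lt_irrefl _),
        Finset.filter_true_of_mem h, Finset.filter_false_of_mem (fun x hx => not_lt.mpr (h x hx).le)]
      simp
    · refine Finset.sum_congr rfl fun b hb => ?_
      rw [← mul_assoc, ← zq_add]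
      congr 2
      rw [Finset.filter_insert, if_neg (not_lt.mpr (h b hb).le), Finset.filter_insert, if_pos (h b hb),
        Finset.sum_insert (by simp [ha])]
      ring

/-- generalized Gaussian binomials -/
def gg (y e : ℤ) (k : ℕ) : KK := ∏ l ∈ Finset.range k, br (y + e * (l + 1)) / br (e * (l + 1))

lemma gg_zero (e : ℤ) (he : 0 < e) (k : ℕ) : gg 0 e k = 1 := by
  unfold gg
  refine Finset.prod_eq_one fun l _ => ?_
  rw [zero_add, div_self]
  exact br_ne (mul_pos he (by positivity)).ne'

lemma gg_succ (y e : ℤ) (he : 0 < e) (k : ℕ) :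
    br (y + e * (k + 1)) * gg y e k = br (e * (k + 1)) * gg y e (k + 1) := by
  unfold gg
  rw [Finset.prod_range_succ]
  have : br (e * ((k:ℤ) + 1)) ≠ 0 := br_ne (mul_pos he (by positivity)).ne'
  field_simp

lemma gg_pascal (e : ℤ) (he : 0 < e) (m k : ℕ) : gg (e * (m + 1 : ℕ)) e (k + 1) =
    qq ^ (-(e * (k + 1))) * gg (e * m) e (k + 1) + qq ^ (e * (m + 1)) * gg (e * (m + 1 : ℕ)) e k := by
  have hq : ∀ n : ℕ, br (e * ((n:ℤ) + 1)) ≠ 0 := fun n => br_ne (mul_pos he (by positivity)).ne'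
  have key : ∀ k : ℕ, br (e * (m + 1)) * gg (e * (m + 1 : ℕ)) e k = br (e * (m + k + 1)) * gg (e * m) e k := by
    intro k
    induction k with
    | zero => simp [gg]
    | succ k ih =>
      have h1 := gg_succ (e * (m + 1 : ℕ)) e he k
      have h2 := gg_succ (e * m) e he k
      have h3 := hq k
      push_cast at *
      rw [show e * (m + 1) + e * ((k:ℤ) + 1) = e * (m + (k + 1) + 1) by ring] at h1
      rw [show e * m + e * ((k:ℤ) + 1) = e * (m + k + 1) by ring] at h2
      apply mul_left_cancel₀ h3
      linear_combination (-br (e * (m+1))) * h1 + br (e * (m + (k + 1) + 1)) * ih + br (e * (m + (k + 1) + 1)) * h2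
  have k1 := key (k + 1)
  have k0 := key k
  have h1 := gg_succ (e * (m + 1 : ℕ)) e he k
  have h2 := gg_succ (e * m) e he k
  have ha := br_add (e * (m + 1)) (e * (k + 1))
  push_cast at *
  rw [show e * (m + 1) + e * ((k:ℤ) + 1) = e * (m + (k + 1) + 1) by ring] at h1 ha
  rw [show e * m + e * ((k:ℤ) + 1) = e * (m + k + 1) by ring] at h2
  apply mul_left_cancel₀ (mul_ne_zero (hq k) (hq m))
  rw [ha] at h1 k1
  linear_combination (-br (e * (m + 1))) * h1 + (br (e * (m+1)) * qq ^ (-(e * ((k:ℤ)+1)))) * (k0 + h2)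

lemma gg_mem (e : ℤ) (he : 0 < e) (m k : ℕ) : gg (e * m) e k ∈ AA := by
  induction m generalizing k with
  | zero => simp only [Nat.cast_zero, mul_zero]; rw [gg_zero e he]; exact one_mem _
  | succ m ihm =>
    induction k with
    | zero => simp only [gg, Finset.range_zero, Finset.prod_empty]; exact one_mem _
    | succ k ihk =>
      rw [gg_pascal e he]
      exact add_mem (mul_mem (qzpow_mem_AA _) (ihm _)) (mul_mem (qzpow_mem_AA _) ihk)
end part7

section part8
def ee (i b : ℤ) : ℤ := if b = -i then 2 else 1

lemma ee_pos (i b : ℤ) : 0 < ee i b := by unfold ee; split_ifs <;> omega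

def vD (i : ℤ) (s : Finset ℤ) (v : ℤ → ℕ) : Gam := ∑ b ∈ s, (v b : ℤ) • DD i b

/-- change of `t(i,b)` -/
def nb (i : ℤ) (v : ℤ → ℕ) (b : ℤ) : ℤ :=
  v b + (if b = -i then (v (-i) : ℤ) else 0) - (if b = -i - 1 then (v (-i) : ℤ) else 0)

def psi (i : ℤ) (s : Finset ℤ) (g : Gam) (v : ℤ → ℕ) : ℤ :=
  ∑ b ∈ s, v b * SS i b g - TT (∑ b ∈ s, (v b : ℤ)) + ∑ b ∈ s, TT (v b) + TT (v (-i)) + v (-i) + TT (v (-i-1))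

def CC (i : ℤ) (s : Finset ℤ) (g : Gam) (v : ℤ → ℕ) : KK :=
  qq ^ (psi i s g v) * ∏ b ∈ s, gg (tt i b g) (ee i b) (v b)

/-- add one at `b` -/
def inc (v : ℤ → ℕ) (b : ℤ) : ℤ → ℕ := fun x => if x = b then v x + 1 else v x

lemma vD_inc (i : ℤ) {s : Finset ℤ} (v : ℤ → ℕ) {b : ℤ} (hb : b ∈ s) :
    vD i s (inc v b) = vD i s v + DD i b := by
  unfold vD inc
  have : ∀ x ∈ s, (((if x = b then v x + 1 else v x : ℕ) : ℤ)) • DD i x = (v x : ℤ) • DD i x + if x = b then DD i x else 0 := by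
    intro x _
    split_ifs
    · push_cast; rw [add_smul, one_smul]
    · simp
  rw [Finset.sum_congr rfl this, Finset.sum_add_distrib, Finset.sum_ite_eq' s b, if_pos hb]

lemma sum_inc {s : Finset ℤ} (v : ℤ → ℕ) {b : ℤ} (hb : b ∈ s) (f : ℤ → ℕ → ℤ) :
    ∑ x ∈ s, f x (inc v b x) = ∑ x ∈ s, f x (v x) + (f b (v b + 1) - f b (v b)) := by
  have : ∀ x ∈ s, f x (inc v b x) = f x (v x) + if x = b then (f x (v x + 1) - f x (v x)) else 0 := by
    intro x _
    unfold inc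
    split_ifs
    · ring
    · simp
  rw [Finset.sum_congr rfl this, Finset.sum_add_distrib, Finset.sum_ite_eq' s b, if_pos hb]

lemma prod_inc {s : Finset ℤ} (v : ℤ → ℕ) {b : ℤ} (hb : b ∈ s) (f : ℤ → ℕ → KK) :
    f b (v b) * ∏ x ∈ s, f x (inc v b x) = f b (v b + 1) * ∏ x ∈ s, f x (v x) := by
  rw [← Finset.mul_prod_erase s _ hb, ← Finset.mul_prod_erase s (fun x => f x (v x)) hb]
  have : ∏ x ∈ s.erase b, f x (inc v b x) = ∏ x ∈ s.erase b, f x (v x) := by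
    refine Finset.prod_congr rfl fun x hx => ?_
    unfold inc; rw [if_neg (Finset.ne_of_mem_erase hx)]
  rw [this]
  unfold inc; rw [if_pos rfl]; ring

lemma psi_inc (i : ℤ) {s : Finset ℤ} (g : Gam) (v : ℤ → ℕ) {b : ℤ} (hb : b ∈ s) :
    psi i s g (inc v b) = psi i s g v + SS i b g - ∑ b ∈ s, (v b : ℤ) + v b
      + (if b = -i then (v (-i) : ℤ) + 1 else 0) + (if b = -i-1 then (v (-i-1) : ℤ) else 0) := by
  unfold psi
  rw [sum_inc v hb fun x k => (k : ℤ) * SS i x g, sum_inc v hb fun x k => (k : ℤ), sum_inc v hb fun x k => TT k]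
  push_cast
  rw [add_sub_cancel_left, TT_succ, TT_succ]
  unfold inc
  by_cases h1 : b = -i
  · rw [if_pos h1.symm, if_pos h1, if_neg (by omega), if_neg (by omega)]
    push_cast; rw [TT_succ]; ring
  · rw [if_neg (fun h => h1 h.symm), if_neg h1]
    by_cases h2 : b = -i-1
    · rw [if_pos h2.symm, if_pos h2]
      push_cast; rw [TT_succ]; ring
    · rw [if_neg (fun h => h2 h.symm), if_neg h2]; ring

lemma tt_vD {i n : ℤ} (v : ℤ → ℕ) (hn : Win n i) {b : ℤ} (hb : b ∈ Finset.Ioc i n)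
    (hv : ∀ x, x ∉ Finset.Ioc i n → v x = 0) : tt i b (vD i (Finset.Ioc i n) v) = nb i v b := by
  unfold vD nb
  rw [map_sum]
  have : ∀ x ∈ Finset.Ioc i n, tt i b ((v x : ℤ) • DD i x) = (if x = b then (v x : ℤ) else 0)
      + (if x = -i then (if b = -i then (v x : ℤ) else 0) - (if b = -i-1 then (v x : ℤ) else 0) else 0) := by
    intro x hx
    rw [Finset.mem_Ioc] at hx hb
    rw [map_zsmul, tt_DD _ _ hx.1, smul_eq_mul]
    grind
  rw [Finset.sum_congr rfl this, Finset.sum_add_distrib, Finset.sum_ite_eq' _ b, if_pos hb,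
    Finset.sum_ite_eq' _ (-i)]
  split_ifs with h1 h2 h3
  all_goals try rw [hv (-i) h1]
  all_goals push_cast
  all_goals ring

lemma SS_vD {i n : ℤ} (v : ℤ → ℕ) (hn : Win n i) {b : ℤ} (hb : b ∈ Finset.Ioc i n)
    (hv : ∀ x, x ∉ Finset.Ioc i n → v x = 0) : SS i b (vD i (Finset.Ioc i n) v) =
     -2 * ∑ x ∈ Finset.Ioc i n with b < x, (v x : ℤ) + if b = -i-1 then (v (-i-1) : ℤ) - v (-i) else 0 := by
  unfold vD
  rw [map_sum]
  have : ∀ x ∈ Finset.Ioc i n, SS i b ((v x : ℤ) • DD i x) = (if b < x then -2 * (v x : ℤ) else 0)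
      + ((if x = -i-1 then (if b = -i-1 then (v x : ℤ) else 0) else 0) - (if x = -i then (if b = -i-1 then (v x : ℤ) else 0) else 0)) := by
    intro x hx
    rw [Finset.mem_Ioc] at hx hb
    rw [map_zsmul, SS_DD hb.1 hx.1, smul_eq_mul]
    unfold Ca
    grind
  rw [Finset.sum_congr rfl this, Finset.sum_add_distrib, Finset.sum_sub_distrib, Finset.sum_ite_eq' _ (-i-1),
    Finset.sum_ite_eq' _ (-i), ← Finset.sum_filter, ← Finset.mul_sum]
  congr 1
  have h1 := hv (-i); have h2 := hv (-i-1)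
  split_ifs <;> simp_all

lemma sum_nb {i n : ℤ} (v : ℤ → ℕ) (hn : Win n i) 
    (hv : ∀ x, x ∉ Finset.Ioc i n → v x = 0) : ∑ b ∈ Finset.Ioc i n, nb i v b = ∑ b ∈ Finset.Ioc i n, (v b : ℤ) := by
  unfold nb
  rw [Finset.sum_sub_distrib, Finset.sum_add_distrib, Finset.sum_ite_eq' _ (-i), Finset.sum_ite_eq' _ (-i-1)]
  have h1 := hv (-i)
  unfold Win at hn
  split_ifs with h2 h3 h3
  · ring
  · exfalso; rw [Finset.mem_Ioc] at h2 h3; omega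
  · rw [h1 h2]; simp
  · ring

lemma sum_nb_lt {i n : ℤ} (v : ℤ → ℕ) (hn : Win n i) {b : ℤ} (hb : b ∈ Finset.Ioc i n)
    (hv : ∀ x, x ∉ Finset.Ioc i n → v x = 0) : 
    ∑ x ∈ Finset.Ioc i n with x < b, nb i v x - ∑ x ∈ Finset.Ioc i n with b < x, nb i v x
     = ∑ x ∈ Finset.Ioc i n with x < b, (v x : ℤ) - ∑ x ∈ Finset.Ioc i n with b < x, (v x : ℤ)
      - (if b = -i ∨ b = -i-1 then (v (-i) : ℤ) else 0) := by
  unfold nb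
  simp only [Finset.sum_sub_distrib, Finset.sum_add_distrib, Finset.sum_ite_eq' _ (-i), Finset.sum_ite_eq' _ (-i-1)]
  have h1 := hv (-i)
  unfold Win at hn
  simp only [Finset.mem_filter, Finset.mem_Ioc] at *
  generalize ∑ x ∈ Finset.Ioc i n with x < b, (v x : ℤ) = A1
  generalize ∑ x ∈ Finset.Ioc i n with b < x, (v x : ℤ) = A2
  grind

lemma sum_three (s : Finset ℤ) {b : ℤ} (hb : b ∈ s) (f : ℤ → ℤ) :
    ∑ x ∈ s, f x = ∑ x ∈ s with x < b, f x + f b + ∑ x ∈ s with b < x, f x := by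
  rw [← Finset.sum_filter_add_sum_filter_not s (fun x => x < b)]
  have : s.filter (fun x => ¬ x < b) = insert b (s.filter (fun x => b < x)) := by
    ext x; simp only [Finset.mem_filter, Finset.mem_insert]
    constructor
    · rintro ⟨h1, h2⟩; rcases eq_or_lt_of_le (not_lt.mp h2) with h | h
      · left; exact h.symm
      · right; exact ⟨h1, h⟩
    · rintro (rfl | h)
      · exact ⟨hb, lt_irrefl _⟩
      · exact ⟨h.1, not_lt.mpr h.2.le⟩
  rw [this, Finset.sum_insert (by simp)]; ring

/-- exponent identity -/
lemma psi_step {i n : ℤ} (g : Gam) (v : ℤ → ℕ) (hn : Win n i) {b : ℤ} (hb : b ∈ Finset.Ioc i n)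
    (hv : ∀ x, x ∉ Finset.Ioc i n → v x = 0) :
    SS i b (g + vD i (Finset.Ioc i n) v) + psi i (Finset.Ioc i n) g v = psi i (Finset.Ioc i n) g (inc v b)
      + (∑ x ∈ Finset.Ioc i n with x < b, nb i (inc v b) x - ∑ x ∈ Finset.Ioc i n with b < x, nb i (inc v b) x) := by
  have hv' : ∀ x, x ∉ Finset.Ioc i n → inc v b x = 0 := by
    intro x hx; unfold inc; rw [if_neg, hv x hx]; rintro rfl; exact hx hb
  rw [map_add, SS_vD v hn hb hv, psi_inc i g v hb, sum_nb_lt _ hn hb hv', sum_three _ hb]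
  have e1 : ∑ x ∈ Finset.Ioc i n with x < b, (inc v b x : ℤ) = ∑ x ∈ Finset.Ioc i n with x < b, (v x : ℤ) := by
    refine Finset.sum_congr rfl fun x hx => ?_
    rw [Finset.mem_filter] at hx; unfold inc; rw [if_neg (by omega)]
  have e2 : ∑ x ∈ Finset.Ioc i n with b < x, (inc v b x : ℤ) = ∑ x ∈ Finset.Ioc i n with b < x, (v x : ℤ) := by
    refine Finset.sum_congr rfl fun x hx => ?_
    rw [Finset.mem_filter] at hx; unfold inc; rw [if_neg (by omega)]
  rw [e1, e2]
  generalize ∑ x ∈ Finset.Ioc i n with x < b, (v x : ℤ) = A1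
  generalize ∑ x ∈ Finset.Ioc i n with b < x, (v x : ℤ) = A2
  unfold inc
  grind

/-- coefficient identity for a single step -/
lemma CC_step {i n : ℤ} (g : Gam) (v : ℤ → ℕ) (hn : Win n i) {b : ℤ} (hb : b ∈ Finset.Ioc i n)
    (hv : ∀ x, x ∉ Finset.Ioc i n → v x = 0) (hd : tt i (-i-1) g = 0) :
    fco i b (g + vD i (Finset.Ioc i n) v) * CC i (Finset.Ioc i n) g v =
      qq ^ (∑ x ∈ Finset.Ioc i n with x < b, nb i (inc v b) x - ∑ x ∈ Finset.Ioc i n with b < x, nb i (inc v b) x)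
       * br (nb i (inc v b) b) * CC i (Finset.Ioc i n) g (inc v b) := by
  have hv' : ∀ x, x ∉ Finset.Ioc i n → inc v b x = 0 := by
    intro x hx; unfold inc; rw [if_neg, hv x hx]; rintro rfl; exact hx hb
  unfold fco CC
  rw [add_assoc, ← vD_inc i v hb, map_add (tt i b), tt_vD _ hn hb hv']
  have h1 := congrArg (fun m : ℤ => qq ^ m) (psi_step g v hn hb hv)
  simp only [zq_add] at h1
  have h2 : br (tt i b g + nb i (inc v b) b) * ∏ b ∈ Finset.Ioc i n, gg (tt i b g) (ee i b) (v b) =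
     br (nb i (inc v b) b) * ∏ x ∈ Finset.Ioc i n, gg (tt i x g) (ee i x) (inc v b x) := by
    by_cases hbd : b = -i-1
    · subst hbd
      rw [hd, zero_add]
      congr 1
      refine Finset.prod_congr rfl fun x hx => ?_
      unfold inc
      split_ifs with h
      · subst h; rw [hd, gg_zero _ (ee_pos _ _), gg_zero _ (ee_pos _ _)]
      · rfl
    · have e1 : nb i (inc v b) b = ee i b * (v b + 1) := by
        unfold nb ee inc; rw [if_pos rfl, if_neg hbd]
        split_ifs with h
        · subst h; push_cast; ring
        · simp_all
        · push_cast; ring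
      rw [e1]
      have p1 := prod_inc v hb fun x k => gg (tt i x g) (ee i x) k
      have p2 := gg_succ (tt i b g) (ee i b) (ee_pos _ _) (v b)
      rw [← Finset.mul_prod_erase _ _ hb, ← Finset.mul_prod_erase _ (fun x => gg (tt i x g) (ee i x) (inc v b x)) hb]
      have : ∏ x ∈ (Finset.Ioc i n).erase b, gg (tt i x g) (ee i x) (inc v b x) = ∏ x ∈ (Finset.Ioc i n).erase b, gg (tt i x g) (ee i x) (v x) := by
        refine Finset.prod_congr rfl fun x hx => ?_
        unfold inc; rw [if_neg (Finset.ne_of_mem_erase hx)]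
      rw [this, ← mul_assoc, p2]
      unfold inc; rw [if_pos rfl]; ring
  linear_combination (qq ^ (SS i b (g + vD i (Finset.Ioc i n) v)) * qq ^ psi i (Finset.Ioc i n) g v) * h2 +
    (br (nb i (inc v b) b) * ∏ x ∈ Finset.Ioc i n, gg (tt i x g) (ee i x) (inc v b x)) * h1
end part8

section part9
lemma qInt_eq (k : ℕ) : qInt 1 k = br k := by
  unfold qInt br; simp

lemma qFact_succ (k : ℕ) : qFact 1 (k + 1) = br (k + 1) * qFact 1 k := by
  unfold qFact; rw [Finset.prod_range_succ, qInt_eq, mul_comm]; push_cast; rfl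

lemma qFact_zero : qFact 1 0 = 1 := by simp [qFact]

lemma qFact_ne (k : ℕ) : qFact 1 k ≠ 0 := by
  unfold qFact
  refine Finset.prod_ne_zero_iff.mpr fun m _ => ?_
  rw [qInt_eq]; exact br_ne (by push_cast; omega)

/-- divided powers on `N` -/
def FF (i : ℤ) (k : ℕ) : NN →ₗ[KK] NN := (qFact 1 k)⁻¹ • (Fop i) ^ k

lemma FF_zero (i : ℤ) (u : NN) : FF i 0 u = u := by simp [FF, qFact_zero]

lemma Fop_FF (i : ℤ) (k : ℕ) (u : NN) : Fop i (FF i k u) = br (k + 1) • FF i (k + 1) u := by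
  unfold FF
  have h1 : br ((k:ℤ) + 1) ≠ 0 := br_ne (by omega)
  have h2 := qFact_ne k
  rw [LinearMap.smul_apply, LinearMap.smul_apply, map_smul, pow_succ', smul_smul, qFact_succ]
  congr 1
  field_simp

lemma FF_succ (i : ℤ) (k : ℕ) (u : NN) : FF i (k + 1) u = (br (k + 1))⁻¹ • Fop i (FF i k u) := by
  rw [Fop_FF, smul_smul, inv_mul_cancel₀ (br_ne (by omega)), one_smul]

lemma Bdd_vD {i n : ℤ} (hn : Win n i) (v : ℤ → ℕ) : Bdd n (vD i (Finset.Ioc i n) v) := by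
  unfold vD
  have : ∀ s ⊆ Finset.Ioc i n, Bdd n (∑ b ∈ s, (v b : ℤ) • DD i b) := by
    intro s
    induction s using Finset.induction_on with
    | empty => intro _ a b h; simp at h
    | insert b s hb ih =>
      intro hs
      rw [Finset.sum_insert hb]
      have hbm := Finset.mem_Ioc.mp (hs (Finset.mem_insert_self _ _))
      refine Bdd.add ?_ (ih fun x hx => hs (Finset.mem_insert_of_mem hx))
      intro x y hxy
      rw [map_zsmul, smul_eq_mul] at hxy
      exact Bdd.DD hbm.1 hn.1 hn.2 hbm.2 x y (right_ne_zero_of_mul hxy)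
  exact this _ subset_rfl

lemma closed {i n : ℤ} {g : Gam} (hn : Win n i) (hB : Bdd n g) (hg : 0 ≤ g) (hd : tt i (-i-1) g = 0) (k : ℕ) :
    FF i k (pp g) = ∑ v ∈ Finset.piAntidiag (Finset.Ioc i n) k,
      CC i (Finset.Ioc i n) g v • pp (g + vD i (Finset.Ioc i n) v) := by
  induction k with
  | zero =>
    rw [FF_zero, Finset.piAntidiag_zero, Finset.sum_singleton]
    have h1 : vD i (Finset.Ioc i n) 0 = 0 := by simp [vD]
    have h2 : CC i (Finset.Ioc i n) g 0 = 1 := by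
      simp [CC, psi, gg, TT_zero]
    rw [h1, h2, one_smul, add_zero]
  | succ k ih =>
    have hk : br ((k:ℤ) + 1) ≠ 0 := br_ne (by omega)
    rw [FF_succ, ih, map_sum]
    have e1 : ∀ v ∈ Finset.piAntidiag (Finset.Ioc i n) k,
        Fop i (CC i (Finset.Ioc i n) g v • pp (g + vD i (Finset.Ioc i n) v)) =
        ∑ b ∈ Finset.Ioc i n, (fco i b (g + vD i (Finset.Ioc i n) v) * CC i (Finset.Ioc i n) g v) •
          pp (g + vD i (Finset.Ioc i n) (inc v b)) := by
      intro v hv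
      rw [map_smul, Fop_pp (hB.add (Bdd_vD hn v)) hn, Fsum, Finset.smul_sum]
      refine Finset.sum_congr rfl fun b hb => ?_
      rw [smul_smul, mul_comm, vD_inc i v hb, add_assoc]
    rw [Finset.sum_congr rfl e1]
    have e2 : ∑ v ∈ Finset.piAntidiag (Finset.Ioc i n) k, ∑ b ∈ Finset.Ioc i n,
        (fco i b (g + vD i (Finset.Ioc i n) v) * CC i (Finset.Ioc i n) g v) •
          pp (g + vD i (Finset.Ioc i n) (inc v b)) =
       ∑ w ∈ Finset.piAntidiag (Finset.Ioc i n) (k+1), ∑ b ∈ (Finset.Ioc i n).filter (fun b => w b ≠ 0),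
        (qq ^ (∑ x ∈ Finset.Ioc i n with x < b, nb i w x - ∑ x ∈ Finset.Ioc i n with b < x, nb i w x)
       * br (nb i w b) * CC i (Finset.Ioc i n) g w) • pp (g + vD i (Finset.Ioc i n) w) := by
      rw [Finset.sum_sigma', Finset.sum_sigma']
      refine Finset.sum_bij' (fun p _ => ⟨inc p.1 p.2, p.2⟩)
        (fun p _ => ⟨fun x => if x = p.2 then p.1 x - 1 else p.1 x, p.2⟩) ?_ ?_ ?_ ?_ ?_
      · rintro ⟨v, b⟩ hp
        simp only [Finset.mem_sigma, Finset.mem_piAntidiag, Finset.mem_filter] at hp ⊢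
        obtain ⟨⟨h1, h2⟩, h3⟩ := hp
        refine ⟨⟨?_, ?_⟩, h3, by simp [inc]⟩
        · have := sum_inc v h3 fun x k => (k : ℤ)
          zify at h1
          zify
          rw [this, h1]; push_cast; ring
        · intro x hx
          unfold inc at hx
          split_ifs at hx with h
          · subst h; exact h3
          · exact h2 x hx
      · rintro ⟨w, b⟩ hp
        simp only [Finset.mem_sigma, Finset.mem_piAntidiag, Finset.mem_filter] at hp ⊢
        obtain ⟨⟨h1, h2⟩, h3, h4⟩ := hp
        refine ⟨⟨?_, ?_⟩, h3⟩
        · have h5 : inc (fun x => if x = b then w x - 1 else w x) b = w := by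
            ext x; simp only [inc]; grind
          have := sum_inc (fun x => if x = b then w x - 1 else w x) h3 fun x k => (k : ℤ)
          rw [h5] at this
          zify at h1
          rw [h1] at this
          zify
          push_cast at this ⊢
          linarith
        · intro x hx
          split_ifs at hx with h
          · subst h; exact h3
          · exact h2 x hx
      · rintro ⟨v, b⟩ hp
        simp only [Sigma.mk.injEq, heq_eq_eq, and_true]
        ext x; unfold inc; split_ifs <;> simp_all
      · rintro ⟨w, b⟩ hp
        simp only [Finset.mem_sigma, Finset.mem_piAntidiag, Finset.mem_filter] at hp
        obtain ⟨⟨h1, h2⟩, h3, h4⟩ := hp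
        simp only [Sigma.mk.injEq, heq_eq_eq, and_true]
        ext x; simp only [inc]; grind
      · rintro ⟨v, b⟩ hp
        simp only [Finset.mem_sigma, Finset.mem_piAntidiag] at hp
        obtain ⟨⟨h1, h2⟩, h3⟩ := hp
        rw [CC_step g v hn h3 (fun x hx => by by_contra hh; exact hx (h2 x hh)) hd]
    rw [e2, Finset.smul_sum]
    refine Finset.sum_congr rfl fun w hw => ?_
    rw [← Finset.sum_smul, smul_smul, ← Finset.sum_mul, ← mul_assoc]
    rw [Finset.mem_piAntidiag] at hw
    have hv : ∀ x, x ∉ Finset.Ioc i n → w x = 0 := fun x hx => by by_contra hh; exact hx (hw.2 x hh)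
    by_cases hnn : 0 ≤ g + vD i (Finset.Ioc i n) w
    · congr 1
      have e3 : ∑ b ∈ (Finset.Ioc i n).filter (fun b => w b ≠ 0),
        qq ^ (∑ x ∈ Finset.Ioc i n with x < b, nb i w x - ∑ x ∈ Finset.Ioc i n with b < x, nb i w x)
         * br (nb i w b) = br (k + 1) := by
        rw [Finset.sum_filter_of_ne, ← br_sum, sum_nb w hn hv]
        · congr 1; exact_mod_cast hw.1
        · intro b hb hne h0
          apply hne
          have : nb i w b = 0 := by
            by_cases hbd : b = -i - 1
            · have h1 := (nonneg_iff _).mp hnn i b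
              rw [map_add, tt_vD w hn hb hv, hbd, hd] at h1
              have : nb i w b = - (w (-i) : ℤ) := by
                unfold nb; rw [if_neg (by omega), if_pos hbd, h0]; simp
              rw [hbd] at this
              rw [hbd]; omega
            · unfold nb; rw [if_neg hbd, h0]; split_ifs with h
              · rw [← h, h0]; rfl
              · rfl
          rw [this, br_zero, mul_zero]
      rw [e3, inv_mul_cancel₀ hk, one_mul]
    · rw [pp_of_not hnn, smul_zero, smul_zero]
end part9

section part10
/-- the lattice of vectors with coordinates in a subring -/
def Lat (R : Subring KK) : AddSubgroup NN where
  carrier := {u | ∀ g, u g ∈ R}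
  add_mem' := fun ha hb g => by rw [Finsupp.add_apply]; exact add_mem (ha g) (hb g)
  zero_mem' := fun g => by rw [Finsupp.zero_apply]; exact zero_mem _
  neg_mem' := fun ha g => by rw [Finsupp.neg_apply]; exact neg_mem (ha g)

lemma mem_Lat {R : Subring KK} {u : NN} : u ∈ Lat R ↔ ∀ g, u g ∈ R := Iff.rfl

lemma Lat_smul {R : Subring KK} {c : KK} {u : NN} (hc : c ∈ R) (hu : u ∈ Lat R) : c • u ∈ Lat R :=
  fun g => by rw [Finsupp.smul_apply, smul_eq_mul]; exact mul_mem hc (hu g)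

lemma Lat_pp (R : Subring KK) (g : Gam) : pp g ∈ Lat R := by
  by_cases h : 0 ≤ g
  · rw [pp_of_nonneg h]; intro x
    rw [Finsupp.single_apply]; split_ifs
    · exact one_mem _
    · exact zero_mem _
  · rw [pp_of_not h]; exact zero_mem _

lemma NN_sum (u : NN) : u = u.sum fun g c => c • pp g.1 := by
  conv_lhs => rw [← Finsupp.sum_single u]
  refine Finsupp.sum_congr fun g _ => ?_
  rw [pp_of_nonneg g.2, Finsupp.smul_single, smul_eq_mul, mul_one]

lemma Lat_map {R : Subring KK} {f : NN →ₗ[KK] NN} (h : ∀ g, 0 ≤ g → f (pp g) ∈ Lat R) {u : NN} (hu : u ∈ Lat R) :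
    f u ∈ Lat R := by
  rw [NN_sum u, Finsupp.sum, map_sum]
  refine sum_mem fun g _ => ?_
  rw [map_smul]; exact Lat_smul (hu g) (h g.1 g.2)

lemma CC_mem {i : ℤ} (s : Finset ℤ) {g : Gam} (hg : 0 ≤ g) (v : ℤ → ℕ) : CC i s g v ∈ AA := by
  unfold CC
  refine mul_mem (qzpow_mem_AA _) (prod_mem fun b _ => ?_)
  have h0 := (nonneg_iff g).mp hg i b
  have : ∃ m : ℕ, tt i b g = ee i b * m := by
    unfold ee
    split_ifs with h
    · obtain ⟨k, hk⟩ := tt_even h g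
      exact ⟨k.toNat, by omega⟩
    · exact ⟨(tt i b g).toNat, by omega⟩
  obtain ⟨m, hm⟩ := this
  rw [hm]; exact gg_mem _ (ee_pos _ _) _ _

lemma FF_FF (i : ℤ) (k r : ℕ) (u : NN) : FF i k (FF i r u) = gg k 1 r • FF i (k + r) u := by
  have h : gg k 1 r = qFact 1 (k + r) / (qFact 1 k * qFact 1 r) := by
    induction r with
    | zero =>
      have := qFact_ne k
      simp only [gg, Finset.range_zero, Finset.prod_empty, add_zero, qFact_zero, mul_one]
      field_simp
    | succ r ih =>
      have h1 := gg_succ k 1 one_pos r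
      have h2 : br ((r:ℤ) + 1) ≠ 0 := br_ne (by omega)
      have h3 := qFact_ne k
      have h4 := qFact_ne r
      rw [one_mul] at h1
      apply mul_left_cancel₀ h2
      rw [← h1, ih, show k + (r + 1) = (k + r) + 1 from rfl, qFact_succ, qFact_succ]
      push_cast
      rw [← add_assoc]
      field_simp
  unfold FF
  simp only [LinearMap.smul_apply, map_smul, smul_smul, h]
  rw [← Module.End.mul_apply, ← pow_add]
  congr 1
  have h3 := qFact_ne k
  have h4 := qFact_ne r
  have h5 := qFact_ne (k + r)
  field_simp

lemma FF_int_pp (i : ℤ) : ∀ (r : ℕ) (g : Gam), 0 ≤ g → tt i (-i-1) g = r → ∀ k, FF i k (pp g) ∈ Lat AA := by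
  classical
  intro r
  induction r using Nat.strong_induction_on with
  | _ r ih =>
  intro g hg hr k
  have closed_mem : ∀ g0 : Gam, 0 ≤ g0 → tt i (-i-1) g0 = 0 → ∀ k, FF i k (pp g0) ∈ Lat AA := by
    intro g0 hg0 hd0 k
    rw [closed (bd_Win i g0) (bd_Bdd i g0) hg0 hd0]
    exact sum_mem fun v _ => Lat_smul (CC_mem _ hg0 v) (Lat_pp _ _)
  rcases Nat.eq_zero_or_pos r with h0 | hrp
  · subst h0
    exact closed_mem g hg (by simpa using hr) k
  · have hi : i < -i-1 := by
      by_contra hh; rw [tt_of_ge (by omega)] at hr; omega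
    set g1 : Gam := g - (r : ℤ) • DD i (-i-1) with hg1
    have hsymm : tt (i+1) (-i) g = r := by
      rw [tt_symm, ← hr]; congr 1; congr 1 <;> ring
    have hg1n : 0 ≤ g1 := by
      rw [nonneg_iff] at hg ⊢
      intro a c
      have h1 := hg a c
      rw [hg1, map_sub, map_zsmul, tt_DD _ _ hi, smul_eq_mul]
      by_cases h2 : i = a ∧ -i-1 = c
      · obtain ⟨rfl, rfl⟩ := h2; grind
      · by_cases h3 : i + 1 = a ∧ -i = c
        · obtain ⟨rfl, rfl⟩ := h3; grind
        · have : 0 ≤ (r:ℤ) := by omega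
          rw [if_neg h2, if_neg (by omega)]
          split_ifs <;> grind
    have hd1 : tt i (-i-1) g1 = 0 := by
      rw [hg1, map_sub, map_zsmul, tt_DD _ _ hi, smul_eq_mul]
      grind
    set n := bd i g1 with hn
    have hw : Win n i := bd_Win i g1
    set s := Finset.Ioc i n with hs
    have hds : -i-1 ∈ s := by rw [hs, Finset.mem_Ioc]; unfold Win at hw; omega
    set w : ℤ → ℕ := fun x => if x = -i-1 then r else 0 with hwdef
    have hwm : w ∈ Finset.piAntidiag s r := by
      rw [Finset.mem_piAntidiag]
      constructor
      · simp only [hwdef]; rw [Finset.sum_ite_eq' s, if_pos hds]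
      · intro x hx; simp only [hwdef] at hx; split_ifs at hx with h
        · subst h; exact hds
        · exact absurd rfl hx
    have hwD : vD i s w = (r : ℤ) • DD i (-i-1) := by
      unfold vD
      rw [Finset.sum_eq_single_of_mem _ hds]
      · simp [hwdef]
      · intro b _ hb; simp [hwdef, hb]
    have hCw : CC i s g1 w = qq ^ (psi i s g1 w) := by
      unfold CC
      rw [Finset.prod_eq_one, mul_one]
      intro b _
      by_cases hb : b = -i-1
      · rw [hb, hd1, gg_zero _ (ee_pos _ _)]
      · simp [hwdef, hb, gg]
    have hcl := closed hw (bd_Bdd i g1) hg1n hd1 r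
    have hgg : g1 + (r : ℤ) • DD i (-i-1) = g := by rw [hg1, sub_add_cancel]
    rw [← hs, ← Finset.add_sum_erase _ _ hwm, hwD, hCw, hgg] at hcl
    have hrest : ∀ v ∈ (Finset.piAntidiag s r).erase w, FF i k (CC i s g1 v • pp (g1 + vD i s v)) ∈ Lat AA := by
      intro v hv
      rw [Finset.mem_erase, Finset.mem_piAntidiag] at hv
      obtain ⟨hvw, hv1, hv2⟩ := hv
      have hv : ∀ x, x ∉ s → v x = 0 := fun x hx => by by_contra hh; exact hx (hv2 x hh)
      rw [map_smul]
      refine Lat_smul (CC_mem _ hg1n v) ?_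
      by_cases hnn : 0 ≤ g1 + vD i s v
      · have h1 := (nonneg_iff _).mp hnn i (-i-1)
        have h2 : tt i (-i-1) (g1 + vD i s v) = v (-i-1) - v (-i) := by
          rw [map_add, hd1, tt_vD v hw hds hv]; unfold nb
          rw [if_neg (by omega), if_pos rfl]; ring
        have h3 : v (-i-1) < r := by
          have hle : v (-i-1) ≤ s.sum v := Finset.single_le_sum (f := v) (fun _ _ => Nat.zero_le _) hds
          rw [hv1] at hle
          refine lt_of_le_of_ne hle fun heq => hvw ?_
          have h4 := Finset.add_sum_erase s v hds
          rw [hv1, heq] at h4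
          have h5 : ∑ x ∈ s.erase (-i-1), v x = 0 := by omega
          rw [Finset.sum_eq_zero_iff] at h5
          ext x
          simp only [hwdef]
          split_ifs with h
          · rw [h, heq]
          · by_cases hx : x ∈ s
            · exact h5 x (Finset.mem_erase.mpr ⟨h, hx⟩)
            · exact hv x hx
        refine ih (v (-i-1) - v (-i)) (by omega) _ hnn ?_ k
        rw [h2]; omega
      · rw [pp_of_not hnn, map_zero]; exact zero_mem _
    have e1 : FF i k (pp g) = qq ^ (-psi i s g1 w) • (gg k 1 r • FF i (k + r) (pp g1) -
        ∑ v ∈ (Finset.piAntidiag s r).erase w, FF i k (CC i s g1 v • pp (g1 + vD i s v))) := by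
      rw [← FF_FF, hcl, map_add, map_sum, add_sub_cancel_right, map_smul, smul_smul, ← zq_add]
      simp
    rw [e1]
    refine Lat_smul (qzpow_mem_AA _) (sub_mem (Lat_smul ?_ (closed_mem g1 hg1n hd1 _)) (sum_mem hrest))
    have := gg_mem 1 one_pos k r
    simpa using this

lemma FF_int (i : ℤ) (k : ℕ) {u : NN} (hu : u ∈ Lat AA) : FF i k u ∈ Lat AA := by
  refine Lat_map (fun g hg => ?_) hu
  have := (nonneg_iff g).mp hg i (-i-1)
  exact FF_int_pp i (tt i (-i-1) g).toNat g hg (by omega) k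
end part10

section part11
/-- rank order -/
def ple (t g : Gam) : Prop := ∀ a b, a < b → rk a b t ≤ rk a b g

lemma ple_refl (g : Gam) : ple g g := fun _ _ _ => le_rfl
lemma ple_trans {a b c : Gam} (h : ple a b) (h' : ple b c) : ple a c := fun x y hxy => (h x y hxy).trans (h' x y hxy)

lemma rk_DD {i b a c : ℤ} (h : i < b) (hac : a < c) : rk a c (DD i b) =
    (if a = i ∧ c ≤ b then 1 else 0) + (if c = -i ∧ -b ≤ a then 1 else 0) := by
  unfold rk; rw [WW_DD _ h]
  grind (splits := 30)

lemma rk_symm (a b : ℤ) (g : Gam) : rk a b g = rk (-b) (-a) g := by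
  unfold rk
  rw [← WW_symm]
  refine WW_congr (fun x y _ => ?_) g
  split_ifs <;> omega

lemma WW_le {w w' : ℤ → ℤ → ℤ} (h : ∀ x y, x < y → w x y ≤ w' x y) {g : Gam} (hg : 0 ≤ g) : WW w g ≤ WW w' g := by
  have := WW_nonneg (w := fun x y => w' x y - w x y) (fun x y hxy => by have := h x y hxy; omega) hg
  rw [WW_sub] at this; omega

lemma rk_mono {g : Gam} (hg : 0 ≤ g) {a a' b b' : ℤ} (ha : a ≤ a') (hb : b' ≤ b) : rk a b g ≤ rk a' b' g := by
  unfold rk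
  refine WW_le (fun x y _ => ?_) hg
  split_ifs <;> omega

lemma rk_nonneg {g : Gam} (hg : 0 ≤ g) (a b : ℤ) : 0 ≤ rk a b g :=
  WW_nonneg (fun x y _ => by split_ifs <;> simp) hg

lemma tt_rk (a b : ℤ) (g : Gam) : tt a b g = rk a b g - rk (a-1) b g - (rk a (b+1) g - rk (a-1) (b+1) g) := by
  unfold tt rk
  rw [← WW_sub, ← WW_sub, ← WW_sub]
  refine WW_congr (fun x y _ => ?_) g
  grind

lemma WW_zero_of {w : ℤ → ℤ → ℤ} {g : Gam} (h : ∀ x y, tt x y g ≠ 0 → w x y = 0) : WW w g = 0 := by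
  rw [WW_apply, Finsupp.sum]
  refine Finset.sum_eq_zero fun s hs => ?_
  have h1 : tt s.1.1 s.1.2 g ≠ 0 := by
    rw [tt_apply_R]
    have := Finsupp.mem_support_iff.mp hs
    split_ifs <;> omega
  have h2 : tt (-s.1.2) (-s.1.1) g ≠ 0 := by rwa [← tt_symm]
  rw [h _ _ h1, h _ _ h2]; simp

lemma rk_of_Bdd {n : ℤ} {g : Gam} (h : Bdd n g) {a b : ℤ} (hab : a < -n ∨ n < b) : rk a b g = 0 := by
  unfold rk
  refine WW_zero_of fun x y hxy => ?_
  have := h x y hxy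
  rw [if_neg]; omega

lemma rk_no_left {g : Gam} {a : ℤ} (h : ∀ y, tt (a+1) y g = 0) (b : ℤ) : rk (a+1) b g = rk a b g := by
  have : WW (fun x y => (if x ≤ a + 1 ∧ b ≤ y then 1 else 0) - (if x ≤ a ∧ b ≤ y then 1 else 0)) g = 0 := by
    refine WW_zero_of fun x y hxy => ?_
    have : x ≠ a + 1 := by rintro rfl; exact hxy (h y)
    grind
  rw [WW_sub] at this
  unfold rk; omega

lemma SS_formula {n : ℤ} {g : Gam} (h : Bdd n g) (i : ℤ) (k : ℕ) (hk : i ≤ n - k) : SS i (n - k) g =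
    ∑ x ∈ Finset.Ioc i n with n - k < x, (tt (i+1) x g - tt i x g) := by
  induction k with
  | zero =>
    rw [SS_of_Bdd h i (by simp), Finset.sum_eq_zero]
    intro x hx
    simp at hx; omega
  | succ k ih =>
    have h1 := SS_pred i (n - k) g
    have h2 : n - ((k + 1 : ℕ) : ℤ) = n - k - 1 := by push_cast; ring
    have h3 : (Finset.Ioc i n).filter (fun x => n - (k:ℤ) - 1 < x) =
      insert (n - (k:ℤ)) ((Finset.Ioc i n).filter (fun x => n - (k:ℤ) < x)) := by
      ext x; simp only [Finset.mem_filter, Finset.mem_insert, Finset.mem_Ioc]; omega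
    rw [h2, h1, ih (by omega), h3, Finset.sum_insert (by simp)]
    ring

lemma e2_formula (s : Finset ℤ) (v : ℤ → ℤ) : ∑ b ∈ s, v b * ∑ x ∈ s with b < x, v x =
    TT (∑ b ∈ s, v b) - ∑ b ∈ s, TT (v b) := by
  have TT_add : ∀ x y, TT (x + y) = TT x + TT y + x * y := by
    intro x y
    have h1 := TT_two (x + y); have h2 := TT_two x; have h3 := TT_two y
    have : 2 * TT (x + y) = 2 * (TT x + TT y + x * y) := by rw [h1]; linear_combination (-1) * h2 - h3
    omega
  induction s using Finset.induction_on_max with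
  | empty => simp [TT_zero]
  | insert a s h ih =>
    have ha : a ∉ s := fun hh => lt_irrefl _ (h a hh)
    rw [Finset.sum_insert ha, Finset.sum_insert ha, Finset.sum_insert ha]
    rw [Finset.filter_insert, if_neg (lt_irrefl _), Finset.filter_false_of_mem (fun x hx => not_lt.mpr (h x hx).le)]
    have : ∀ b ∈ s, v b * ∑ x ∈ insert a s with b < x, v x = v b * ∑ x ∈ s with b < x, v x + v b * v a := by
      intro b hb
      rw [Finset.filter_insert, if_pos (h b hb), Finset.sum_insert (by simp [ha])]; ring
    rw [Finset.sum_congr rfl this, Finset.sum_add_distrib, ih, ← Finset.sum_mul, TT_add]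
    simp; ring

/-- the stripping vector -/
def sv (i : ℤ) (g : Gam) (b : ℤ) : ℕ :=
  (tt i b g - (if b = -i then tt i b g / 2 else 0) + (if b = -i-1 ∧ i < b then tt i (-i) g / 2 else 0)).toNat

section strip
variable {i n : ℤ} {g : Gam}

lemma sv_spec (hg : 0 ≤ g) (hi : ∀ y, tt (i+1) y g = 0) (b : ℤ) : (sv i g b : ℤ) =
   tt i b g - (if b = -i then tt i b g / 2 else 0) + (if b = -i-1 ∧ i < b then tt i (-i) g / 2 else 0) := by
  unfold sv
  have h1 := (nonneg_iff g).mp hg i b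
  have h2 := (nonneg_iff g).mp hg i (-i)
  rw [Int.toNat_of_nonneg]
  split_ifs <;> omega

lemma sv_supp (hw : Win n i) (hB : Bdd n g) (hg : 0 ≤ g) (hi : ∀ y, tt (i+1) y g = 0) :
    ∀ x, x ∉ Finset.Ioc i n → sv i g x = 0 := by
  intro x hx
  have := sv_spec hg hi x
  rw [Finset.mem_Ioc] at hx
  have h1 : tt i x g = 0 := by
    by_contra hh
    have h1 := hB _ _ hh
    by_cases h2 : i < x
    · omega
    · exact hh (tt_of_ge (by omega) g)
  unfold Win at hw
  rw [h1] at this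
  rw [if_neg (show ¬ (x = -i-1 ∧ i < x) by omega)] at this
  split_ifs at this <;> omega

lemma nb_sv (hw : Win n i) (hB : Bdd n g) (hg : 0 ≤ g) (hi : ∀ y, tt (i+1) y g = 0) {b : ℤ} (hb : i < b) : 
    nb i (sv i g) b = tt i b g := by
  unfold nb
  rw [sv_spec hg hi, sv_spec hg hi, if_pos rfl]
  obtain ⟨k, hk⟩ := tt_even (a := i) (b := -i) rfl g
  rw [if_neg (show ¬ (-i = -i-1 ∧ i < -i) by omega)]
  by_cases h1 : b = -i
  · subst h1; grind
  · grind

/-- uniqueness: nb determines v -/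
lemma nb_inj {v w : ℤ → ℕ} (h : ∀ b, i < b → nb i v b = nb i w b) (hv : ∀ x, x ∉ Finset.Ioc i n → v x = 0)
    (hw : ∀ x, x ∉ Finset.Ioc i n → w x = 0) : v = w := by
  have hc : v (-i) = w (-i) := by
    by_cases h1 : i < -i
    · have := h _ h1; unfold nb at this; grind
    · rw [hv, hw] <;> rw [Finset.mem_Ioc] <;> omega
  ext x
  by_cases h1 : i < x
  · have := h _ h1; unfold nb at this; rw [hc] at this
    omega
  · rw [hv, hw] <;> rw [Finset.mem_Ioc] <;> omega

end strip
end part11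

section part12
lemma pp_apply_ne {g : Gam} {x : BB} (h : pp g x ≠ 0) : x.1 = g := by
  by_cases hg : 0 ≤ g
  · rw [pp_of_nonneg hg, Finsupp.single_apply] at h
    split_ifs at h with h1
    · rw [← h1]
    · exact absurd rfl h
  · rw [pp_of_not hg] at h; exact absurd rfl h

lemma pp_self {g : Gam} (h : 0 ≤ g) : pp g ⟨g, h⟩ = 1 := by
  rw [pp_of_nonneg h, Finsupp.single_eq_same]

lemma map_apply_ne {f : NN →ₗ[KK] NN} {u : NN} {x : BB} (h : f u x ≠ 0) : ∃ g : BB, u g ≠ 0 ∧ f (pp g.1) x ≠ 0 := by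
  by_contra hh
  push Not at hh
  apply h
  rw [NN_sum u, Finsupp.sum, map_sum, Finsupp.finset_sum_apply]
  refine Finset.sum_eq_zero fun g hg => ?_
  rw [map_smul, Finsupp.smul_apply, hh g (Finsupp.mem_support_iff.mp hg), smul_zero]

lemma Fop_supp {i n : ℤ} {g : Gam} (hn : Win n i) (hB : Bdd n g) {x : BB} (h : Fop i (pp g) x ≠ 0) :
    ∃ b ∈ Finset.Ioc i n, x.1 = g + DD i b := by
  rw [Fop_pp hB hn] at h
  unfold Fsum at h
  rw [Finsupp.finset_sum_apply] at h
  obtain ⟨b, hb, h1⟩ := Finset.exists_ne_zero_of_sum_ne_zero h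
  refine ⟨b, hb, pp_apply_ne fun h2 => h1 ?_⟩
  rw [Finsupp.smul_apply, h2, smul_zero]

lemma FF_supp {i n : ℤ} {t : Gam} (hn : Win n i) (hB : Bdd n t) (k : ℕ) :
    ∀ x : BB, FF i k (pp t) x ≠ 0 → ∃ v ∈ Finset.piAntidiag (Finset.Ioc i n) k, x.1 = t + vD i (Finset.Ioc i n) v := by
  induction k with
  | zero =>
    intro x hx
    rw [FF_zero] at hx
    exact ⟨0, by simp, by rw [pp_apply_ne hx]; simp [vD]⟩
  | succ k ih =>
    intro x hx
    rw [FF_succ, Finsupp.smul_apply] at hx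
    obtain ⟨g, hg, h1⟩ := map_apply_ne (right_ne_zero_of_smul hx)
    obtain ⟨v, hv, h2⟩ := ih g hg
    have hBg : Bdd n g.1 := by rw [h2]; exact hB.add (Bdd_vD hn v)
    obtain ⟨b, hb, h3⟩ := Fop_supp hn hBg h1
    refine ⟨inc v b, ?_, by rw [h3, h2, vD_inc i v hb, add_assoc]⟩
    rw [Finset.mem_piAntidiag] at hv ⊢
    constructor
    · have := sum_inc v hb fun _ k => (k : ℤ)
      push_cast at this
      zify
      have h4 : (∑ x ∈ Finset.Ioc i n, (v x : ℤ)) = k := by exact_mod_cast hv.1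
      omega
    · intro x hx
      by_cases h4 : x = b
      · rw [h4]; exact hb
      · apply hv.2; unfold inc at hx; rwa [if_neg h4] at hx

lemma dg_vD {i n : ℤ} (v : ℤ → ℕ) : dg (vD i (Finset.Ioc i n) v) = ∑ b ∈ Finset.Ioc i n, (v b : ℤ) := by
  unfold vD
  rw [map_sum]
  refine Finset.sum_congr rfl fun b hb => ?_
  rw [Finset.mem_Ioc] at hb
  rw [map_zsmul, dg_DD hb.1, smul_eq_mul, mul_one]

lemma rk_vD {i n a c : ℤ} (v : ℤ → ℕ) (hac : a < c) : rk a c (vD i (Finset.Ioc i n) v) =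
    (if a = i then ∑ b ∈ Finset.Ioc i n with c ≤ b, (v b : ℤ) else 0) + (if c = -i then ∑ b ∈ Finset.Ioc i n with -b ≤ a, (v b : ℤ) else 0) := by
  unfold vD
  rw [map_sum]
  have : ∀ b ∈ Finset.Ioc i n, rk a c ((v b : ℤ) • DD i b) = (if a = i then (if c ≤ b then (v b : ℤ) else 0) else 0) +
     (if c = -i then (if -b ≤ a then (v b : ℤ) else 0) else 0) := by
    intro b hb
    rw [Finset.mem_Ioc] at hb
    rw [map_zsmul, rk_DD hb.1 hac, smul_eq_mul]
    grind
  rw [Finset.sum_congr rfl this, Finset.sum_add_distrib, Finset.sum_filter, Finset.sum_filter]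
  split_ifs <;> simp

section strip
variable {i n : ℤ} {g : Gam}

/-- the stripped element -/
def gst (i n : ℤ) (g : Gam) : Gam := g - vD i (Finset.Ioc i n) (sv i g)

lemma gst_add (i n : ℤ) (g : Gam) : gst i n g + vD i (Finset.Ioc i n) (sv i g) = g := by simp [gst]

lemma tt_gst (hw : Win n i) (hB : Bdd n g) (hg : 0 ≤ g) (hi : ∀ y, tt (i+1) y g = 0) (b : ℤ) : tt i b (gst i n g) = 0 := by
  have hB' : Bdd n (gst i n g) := hB.sub (Bdd_vD hw _)
  by_cases hb : b ∈ Finset.Ioc i n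
  · unfold gst
    rw [map_sub, tt_vD _ hw hb (sv_supp hw hB hg hi), nb_sv hw hB hg hi (Finset.mem_Ioc.mp hb).1, sub_self]
  · by_contra hh
    have h1 := hB' _ _ hh
    rw [Finset.mem_Ioc] at hb
    by_cases h2 : i < b
    · omega
    · exact hh (tt_of_ge (by omega) _)

lemma gst_nonneg (hw : Win n i) (hB : Bdd n g) (hg : 0 ≤ g) (hi : ∀ y, tt (i+1) y g = 0) : 0 ≤ gst i n g := by
  rw [nonneg_iff]
  intro a c
  by_cases h1 : a = i
  · rw [h1, tt_gst hw hB hg hi]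
  by_cases h2 : c = -i
  · rw [tt_symm, h2, neg_neg, tt_gst hw hB hg hi]
  unfold gst
  rw [map_sub]
  have h3 := (nonneg_iff g).mp hg a c
  have h4 : tt a c (vD i (Finset.Ioc i n) (sv i g)) ≤ 0 := by
    unfold vD
    rw [map_sum]
    refine Finset.sum_nonpos fun b hb => ?_
    rw [Finset.mem_Ioc] at hb
    rw [map_zsmul, tt_DD _ _ hb.1, smul_eq_mul]
    refine mul_nonpos_of_nonneg_of_nonpos (by positivity) ?_
    grind
  omega

lemma Eop_gst (hw : Win n i) (hB : Bdd n g) (hg : 0 ≤ g) (hi : ∀ y, tt (i+1) y g = 0) : Eop i (pp (gst i n g)) = 0 := by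
  have hB' : Bdd n (gst i n g) := hB.sub (Bdd_vD hw _)
  rw [Eop_pp hB' hw]
  unfold Esum
  refine Finset.sum_eq_zero fun b hb => ?_
  rw [Finset.mem_Ioc] at hb
  rw [pp_of_neg (a := i) (b := b), smul_zero]
  rw [map_sub, tt_gst hw hB hg hi, tt_DD _ _ hb.1]
  grind

/-- uniqueness -/
lemma gst_unique (hw : Win n i) (hB : Bdd n g) (hg : 0 ≤ g) (hi : ∀ y, tt (i+1) y g = 0) {t : Gam} (ht : 0 ≤ t)
    {v : ℤ → ℕ} (hv : v ∈ Finset.piAntidiag (Finset.Ioc i n) (∑ b ∈ Finset.Ioc i n, sv i g b))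
    (h : g = t + vD i (Finset.Ioc i n) v) : v = sv i g ∧ t = gst i n g := by
  rw [Finset.mem_piAntidiag] at hv
  have hv' : ∀ x, x ∉ Finset.Ioc i n → v x = 0 := fun x hx => by by_contra hh; exact hx (hv.2 x hh)
  have h1 : ∀ b ∈ Finset.Ioc i n, tt i b g = tt i b t + nb i v b := by
    intro b hb
    conv_lhs => rw [h]
    rw [map_add, tt_vD v hw hb hv']
  have h2 : ∑ b ∈ Finset.Ioc i n, tt i b g = ∑ b ∈ Finset.Ioc i n, (sv i g b : ℤ) := by
    rw [← sum_nb _ hw (sv_supp hw hB hg hi)]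
    exact Finset.sum_congr rfl fun b hb => (nb_sv hw hB hg hi (Finset.mem_Ioc.mp hb).1).symm
  have h3 : ∑ b ∈ Finset.Ioc i n, tt i b t = 0 := by
    rw [Finset.sum_congr rfl h1, Finset.sum_add_distrib, sum_nb v hw hv'] at h2
    have : (∑ x ∈ Finset.Ioc i n, (v x : ℤ)) = ∑ b ∈ Finset.Ioc i n, (sv i g b : ℤ) := by exact_mod_cast hv.1
    omega
  rw [Finset.sum_eq_zero_iff_of_nonneg fun b _ => (nonneg_iff t).mp ht i b] at h3
  have hBt : Bdd n t := by
    have : t = g - vD i (Finset.Ioc i n) v := by rw [h]; simp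
    rw [this]; exact hB.sub (Bdd_vD hw v)
  have h4 : v = sv i g := by
    refine nb_inj (i := i) (n := n) (fun b hb => ?_) hv' (sv_supp hw hB hg hi)
    rw [nb_sv hw hB hg hi hb]
    by_cases hbn : b ≤ n
    · have := h1 b (by simp [hb, hbn]); rw [h3 b (by simp [hb, hbn])] at this; omega
    · unfold Win at hw
      unfold nb
      rw [hv' b (by simp; omega), if_neg (by omega), if_neg (by omega)]
      have : tt i b g = 0 := by by_contra hh; have := hB _ _ hh; omega
      rw [this]; rfl
  refine ⟨h4, ?_⟩
  unfold gst; rw [← h4]; exact eq_sub_of_add_eq h.symm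

lemma sv_c_eq_d (hg : 0 ≤ g) (hi : ∀ y, tt (i+1) y g = 0) : i < -i → sv i g (-i-1) = sv i g (-i) := by
  intro h
  have h1 := sv_spec hg hi (-i)
  have h2 := sv_spec hg hi (-i-1)
  have h3 : tt i (-i-1) g = 0 := by rw [tt_symm]; convert hi (-i) using 3; ring
  obtain ⟨k, hk⟩ := tt_even (a := i) (b := -i) rfl g
  rw [h3, if_neg (by omega)] at h2
  rw [if_pos rfl, if_neg (by omega)] at h1
  by_cases h4 : i < -i-1
  · rw [if_pos ⟨rfl, h4⟩] at h2; omega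
  · omega

lemma SS_gst (hw : Win n i) (hB : Bdd n g) (hg : 0 ≤ g) (hi : ∀ y, tt (i+1) y g = 0) {b : ℤ} (hb : b ∈ Finset.Ioc i n) :
    SS i b (gst i n g) = ∑ x ∈ Finset.Ioc i n with b < x, (sv i g x : ℤ) - if b = -i-1 then (sv i g (-i-1) : ℤ) else 0 := by
  have hs := sv_supp hw hB hg hi
  unfold gst
  rw [map_sub, SS_vD _ hw hb hs]
  have hb' := Finset.mem_Ioc.mp hb
  have h1 := SS_formula hB i (n - b).toNat (by omega)
  rw [show n - ((n - b).toNat : ℤ) = b by omega] at h1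
  have h2 : ∀ x ∈ (Finset.Ioc i n).filter (fun x => b < x), tt (i+1) x g - tt i x g = - nb i (sv i g) x := by
    intro x hx
    rw [Finset.mem_filter, Finset.mem_Ioc] at hx
    rw [hi, nb_sv hw hB hg hi hx.1.1]; ring
  rw [h1, Finset.sum_congr rfl h2, Finset.sum_neg_distrib]
  unfold nb
  simp only [Finset.sum_sub_distrib, Finset.sum_add_distrib, Finset.sum_ite_eq' _ (-i), Finset.sum_ite_eq' _ (-i-1)]
  simp only [Finset.mem_filter]
  generalize ∑ x ∈ Finset.Ioc i n with b < x, (sv i g x : ℤ) = A2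
  have h3 := hs (-i)
  rw [Finset.mem_Ioc] at *
  unfold Win at hw
  grind

lemma psi_gst (hw : Win n i) (hB : Bdd n g) (hg : 0 ≤ g) (hi : ∀ y, tt (i+1) y g = 0) :
    psi i (Finset.Ioc i n) (gst i n g) (sv i g) = 0 := by
  have hs := sv_supp hw hB hg hi
  unfold psi
  rw [Finset.sum_congr rfl fun b hb => by rw [SS_gst hw hB hg hi hb, mul_sub], Finset.sum_sub_distrib,
    e2_formula]
  have h1 : ∑ b ∈ Finset.Ioc i n, (sv i g b : ℤ) * (if b = -i-1 then (sv i g (-i-1) : ℤ) else 0) = (sv i g (-i-1) : ℤ) ^ 2 := by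
    simp only [mul_ite, mul_zero]
    rw [Finset.sum_ite_eq' _ (-i-1)]
    split_ifs with h
    · ring
    · rw [hs _ h]; simp
  rw [h1]
  have h2 : (sv i g (-i-1) : ℤ) = sv i g (-i) := by
    by_cases h : i < -i
    · rw [sv_c_eq_d hg hi h]
    · rw [hs (-i) (by simp; omega), hs (-i-1) (by simp; omega)]
  rw [h2]
  have h3 := TT_two (sv i g (-i))
  linear_combination h3

lemma FF_lead (hw : Win n i) (hB : Bdd n g) (hg : 0 ≤ g) (hi : ∀ y, tt (i+1) y g = 0) :
    (FF i (∑ b ∈ Finset.Ioc i n, sv i g b) (pp (gst i n g))) ⟨g, hg⟩ = 1 := by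
  classical
  have hB' : Bdd n (gst i n g) := hB.sub (Bdd_vD hw _)
  have hs := sv_supp hw hB hg hi
  rw [closed hw hB' (gst_nonneg hw hB hg hi) (tt_gst hw hB hg hi _), Finsupp.finset_sum_apply,
    Finset.sum_eq_single (sv i g)]
  · rw [Finsupp.smul_apply, gst_add, pp_self, smul_eq_mul, mul_one]
    unfold CC
    rw [psi_gst hw hB hg hi, zpow_zero, one_mul]
    refine Finset.prod_eq_one fun b _ => ?_
    rw [tt_gst hw hB hg hi, gg_zero _ (ee_pos i b)]
  · intro v hv hne
    rw [Finsupp.smul_apply]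
    by_contra hh
    have := pp_apply_ne (right_ne_zero_of_smul hh)
    exact hne (gst_unique hw hB hg hi (gst_nonneg hw hB hg hi) hv this).1
  · intro h
    exfalso; apply h
    rw [Finset.mem_piAntidiag]
    exact ⟨rfl, fun x hx => by by_contra hh; exact hx (hs x hh)⟩

/-- order transport -/
lemma ple_transport (hw : Win n i) (hB : Bdd n g) (hg : 0 ≤ g) (hi : ∀ y, tt (i+1) y g = 0) {t : Gam}
    (hp : ple t (gst i n g)) {v : ℤ → ℕ} (hv : v ∈ Finset.piAntidiag (Finset.Ioc i n) (∑ b ∈ Finset.Ioc i n, sv i g b))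
    (h0 : 0 ≤ t + vD i (Finset.Ioc i n) v) : ple (t + vD i (Finset.Ioc i n) v) g := by
  set x := t + vD i (Finset.Ioc i n) v with hx
  have hgen : ∀ a c, a < c → a ≠ i → c ≠ -i → rk a c x ≤ rk a c g := by
    intro a c hac h1 h2
    have h3 := hp a c hac
    conv_rhs => rw [← gst_add i n g]
    rw [hx, map_add, map_add, rk_vD _ hac, rk_vD _ hac, if_neg h1, if_neg h2]
    rw [if_neg h1, if_neg h2]; omega
  have hi' : ∀ b, rk (i+1) b g = rk i b g := rk_no_left hi
  have hsum : (∑ x ∈ Finset.Ioc i n, (v x : ℤ)) = ∑ b ∈ Finset.Ioc i n, (sv i g b : ℤ) := by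
    rw [Finset.mem_piAntidiag] at hv
    exact_mod_cast hv.1
  have hone : rk i (i+1) x ≤ rk i (i+1) g := by
    have hc : i < i + 1 := by omega
    have h3 := hp i (i+1) hc
    conv_rhs => rw [← gst_add i n g]
    rw [hx, map_add, map_add, rk_vD _ hc, rk_vD _ hc, if_pos rfl, if_pos rfl]
    have h4 : (Finset.Ioc i n).filter (fun b => i + 1 ≤ b) = Finset.Ioc i n := by
      apply Finset.filter_true_of_mem; intro b hb; rw [Finset.mem_Ioc] at hb; omega
    rw [h4, hsum, if_neg (by omega), if_neg (by omega)]; omega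
  have hkey : ∀ c, i < c → rk i c x ≤ rk i c g := by
    intro c hc
    by_cases h1 : c = i + 1
    · subst h1; exact hone
    by_cases h2 : c = -i
    · subst h2
      by_cases h5 : i = -1
      · subst h5
        have h6 : rk (-1) 1 x ≤ rk (-1) 0 x := rk_mono h0 le_rfl (by norm_num)
        have h7 := rk_symm 0 1 g
        have h8 := hi' 1
        norm_num at *
        omega
      · have h6 : rk i (-i) x ≤ rk (i+1) (-i-1) x := rk_mono h0 (by omega) (by omega)
        have h7 := hgen (i+1) (-i-1) (by omega) (by omega) (by omega)
        have h8 := hi' (-i-1)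
        have h9 := rk_symm i (-i-1) g
        rw [show -(-i-1) = i + 1 by ring] at h9
        have h10 := hi' (-i)
        omega
    · have h6 : rk i c x ≤ rk (i+1) c x := rk_mono h0 (by omega) le_rfl
      have h7 := hgen (i+1) c (by omega) (by omega) h2
      have h8 := hi' c
      omega
  intro a c hac
  by_cases h1 : a = i
  · subst h1; exact hkey c hac
  by_cases h2 : c = -i
  · rw [rk_symm, rk_symm a c, h2, neg_neg]; exact hkey _ (by omega)
  exact hgen a c hac h1 h2

end strip
end part12

section part13
lemma rk_ple_zero {n : ℤ} {t g : Gam} (hg : Bdd n g) (ht : 0 ≤ t) (h : ple t g) {a b : ℤ} (hlt : a < b) (hab : a < -n ∨ n < b) :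
    rk a b t = 0 :=
  le_antisymm ((h a b hlt).trans (rk_of_Bdd hg hab).le) (rk_nonneg ht a b)

lemma Bdd_of_ple {n : ℤ} {t g : Gam} (hg : Bdd n g) (ht : 0 ≤ t) (h : ple t g) : Bdd n t := by
  intro a b hab
  by_contra hh
  apply hab
  by_cases hlt : a < b
  · have h1 := tt_rk a b t
    have h2 := (nonneg_iff t).mp ht a b
    have h3 := rk_ple_zero hg ht h hlt (by omega)
    have h4 := rk_nonneg ht (a-1) b
    have h5 := rk_mono ht (a := a - 1) (a' := a) (b := b+1) (b' := b+1) (by omega) le_rfl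
    omega
  · exact tt_of_ge (by omega) t

lemma ple_antisymm {t g : Gam} (h : ∀ a b, a < b → rk a b t = rk a b g) : t = g := by
  refine gam_ext fun a b => ?_
  by_cases hlt : a < b
  · rw [tt_rk, tt_rk, h _ _ hlt, h _ _ (by omega), h _ _ (by omega), h _ _ (by omega)]
  · rw [tt_of_ge (by omega), tt_of_ge (by omega)]

/-- order with equal degree -/
def pl (t g : Gam) : Prop := ple t g ∧ dg t = dg g

lemma pl_refl (g : Gam) : pl g g := ⟨ple_refl g, rfl⟩
lemma pl_trans {a b c : Gam} (h : pl a b) (h' : pl b c) : pl a c := ⟨ple_trans h.1 h'.1, h.2.trans h'.2⟩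
lemma pl_antisymm {a b : Gam} (h : pl a b) (h' : pl b a) : a = b :=
  ple_antisymm fun x y hxy => le_antisymm (h.1 x y hxy) (h'.1 x y hxy)

/-- measure -/
def mm (n : ℤ) (g : Gam) : ℤ := ∑ a ∈ Finset.Icc (-n) n, ∑ b ∈ Finset.Icc (-n) n, if a < b then rk a b g else 0

lemma mm_nonneg (n : ℤ) {g : Gam} (hg : 0 ≤ g) : 0 ≤ mm n g :=
  Finset.sum_nonneg fun a _ => Finset.sum_nonneg fun b _ => by
    split_ifs
    · exact rk_nonneg hg a b
    · exact le_rfl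

lemma mm_lt {n : ℤ} {t g : Gam} (hg : Bdd n g) (ht : 0 ≤ t) (h : ple t g) (hne : t ≠ g) : mm n t < mm n g := by
  obtain ⟨a, b, hab, h1⟩ : ∃ a b, a < b ∧ rk a b t ≠ rk a b g := by
    by_contra hh
    push Not at hh
    exact hne (ple_antisymm hh)
  have hw : -n ≤ a ∧ b ≤ n := by
    by_contra hh
    apply h1
    rw [rk_ple_zero hg ht h hab (by omega), rk_of_Bdd hg (by omega)]
  have hle : ∀ x y, (if x < y then rk x y t else 0) ≤ (if x < y then rk x y g else 0) := by
    intro x y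
    split_ifs with hxy
    · exact h x y hxy
    · exact le_rfl
  unfold mm
  refine Finset.sum_lt_sum (fun x _ => Finset.sum_le_sum fun y _ => hle x y) ⟨a, by simp; omega, ?_⟩
  refine Finset.sum_lt_sum (fun y _ => hle a y) ⟨b, by simp; omega, ?_⟩
  rw [if_pos hab, if_pos hab]
  exact lt_of_le_of_ne (h a b hab) h1

lemma gam_ind {P : Gam → Prop} (H : ∀ g, 0 ≤ g → (∀ t, 0 ≤ t → dg t < dg g → P t) → (∀ t, 0 ≤ t → pl t g → t ≠ g → P t) → P g) :
    ∀ g, 0 ≤ g → P g := by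
  have h1 : ∀ d : ℕ, ∀ g, 0 ≤ g → dg g = d → P g := by
    intro d
    induction d using Nat.strong_induction_on with
    | _ d ihd =>
      intro g hg hd
      obtain ⟨n, _, hB⟩ := exists_Bdd g
      have h2 : ∀ m : ℕ, ∀ t, 0 ≤ t → dg t = d → Bdd n t → mm n t = m → P t := by
        intro m
        induction m using Nat.strong_induction_on with
        | _ m ihm =>
          intro t ht htd hBt hm
          refine H t ht (fun s hs hsd => ?_) (fun s hs hst hne => ?_)
          · have := dg_nonneg hs
            exact ihd (dg s).toNat (by omega) s hs (by omega)
          · have h3 := mm_lt hBt hs hst.1 hne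
            have h4 := mm_nonneg n hs
            exact ihm (mm n s).toNat (by omega) s hs (by rw [hst.2, htd]) (Bdd_of_ple hBt hs hst.1) (by omega)
      have h4 := mm_nonneg n hg
      exact h2 (mm n g).toNat g hg hd hB (by omega)
  intro g hg
  have := dg_nonneg hg
  exact h1 (dg g).toNat g hg (by omega)

/-- a maximal element of a finite set of gammas -/
lemma exists_pl_max (s : Finset BB) (hs : s.Nonempty) : ∃ g ∈ s, ∀ t ∈ s, pl g.1 t.1 → t = g := by
  classical
  induction hs using Finset.Nonempty.cons_induction with
  | singleton a => exact ⟨a, by simp, by simp⟩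
  | cons a s ha hs ih =>
    obtain ⟨g, hg, h⟩ := ih
    by_cases h1 : pl g.1 a.1
    · refine ⟨a, by simp, fun t ht hat => ?_⟩
      rw [Finset.mem_cons] at ht
      rcases ht with rfl | ht
      · rfl
      · have := h t ht (pl_trans h1 hat)
        subst this
        exact Subtype.ext (pl_antisymm h1 hat)
    · refine ⟨g, by simp [hg], fun t ht hat => ?_⟩
      rw [Finset.mem_cons] at ht
      rcases ht with rfl | ht
      · exact absurd hat h1
      · exact h t ht hat

theorem strip {g : Gam} (hg : 0 ≤ g) (h0 : g ≠ 0) : ∃ (i : ℤ) (k : ℕ) (g' : Gam), 0 ≤ g' ∧ 1 ≤ k ∧ dg g' + k = dg g ∧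
    Eop i (pp g') = 0 ∧ FF i k (pp g') ⟨g, hg⟩ = 1 ∧
    ∀ t, 0 ≤ t → pl t g' → ∀ x : BB, FF i k (pp t) x ≠ 0 → pl x.1 g ∧ (x.1 = g → t = g') := by
  obtain ⟨n0, hn0, hB0⟩ := exists_Bdd g
  obtain ⟨i, ⟨b, hb⟩, hmax⟩ : ∃ i, (∃ b, tt i b g ≠ 0) ∧ ∀ a, (∃ b, tt a b g ≠ 0) → a ≤ i := by
    refine Int.exists_greatest_of_bdd ⟨n0, ?_⟩ ?_
    · rintro a ⟨b, hb⟩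
      have := hB0 _ _ hb
      by_contra hh
      exact hb (tt_of_ge (by omega) g)
    · by_contra hh
      push Not at hh
      exact h0 (gam_ext fun a b => by rw [hh a b, map_zero])
  have hi : ∀ y, tt (i+1) y g = 0 := by
    intro y
    by_contra hh
    have := hmax _ ⟨y, hh⟩; omega
  obtain ⟨n, hw, hB⟩ : ∃ n, Win n i ∧ Bdd n g := ⟨bd i g, bd_Win i g, bd_Bdd i g⟩
  have hs := sv_supp hw hB hg hi
  have hB' : Bdd n (gst i n g) := hB.sub (Bdd_vD hw _)
  have hdg : dg (gst i n g) + ((∑ b ∈ Finset.Ioc i n, sv i g b : ℕ) : ℤ) = dg g := by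
    conv_rhs => rw [← gst_add i n g]
    rw [map_add, dg_vD]; push_cast; rfl
  have hbi : i < b := by
    by_contra hh
    exact hb (tt_of_ge (by omega) g)
  have hbn : b ∈ Finset.Ioc i n := by
    have := hB _ _ hb
    rw [Finset.mem_Ioc]; exact ⟨hbi, this.2⟩
  refine ⟨i, ∑ b ∈ Finset.Ioc i n, sv i g b, gst i n g, gst_nonneg hw hB hg hi, ?_, hdg,
    Eop_gst hw hB hg hi, FF_lead hw hB hg hi, ?_⟩
  · have h1 : ∑ b ∈ Finset.Ioc i n, tt i b g = ∑ b ∈ Finset.Ioc i n, (sv i g b : ℤ) := by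
      rw [← sum_nb _ hw hs]
      exact Finset.sum_congr rfl fun b hb => (nb_sv hw hB hg hi (Finset.mem_Ioc.mp hb).1).symm
    have h2 : tt i b g ≤ ∑ b ∈ Finset.Ioc i n, tt i b g :=
      Finset.single_le_sum (f := fun b => tt i b g) (fun b _ => (nonneg_iff g).mp hg i b) hbn
    have h3 := (nonneg_iff g).mp hg i b
    zify
    omega
  · intro t ht htg x hx
    have hBt := Bdd_of_ple hB' ht htg.1
    obtain ⟨v, hv, h1⟩ := FF_supp hw hBt _ x hx
    refine ⟨⟨?_, ?_⟩, fun h2 => ?_⟩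
    · rw [h1]; exact ple_transport hw hB hg hi htg.1 hv (h1 ▸ x.2)
    · rw [h1, map_add, dg_vD, htg.2, ← hdg]
      rw [Finset.mem_piAntidiag] at hv
      congr 1
      exact_mod_cast hv.1
    · exact (gst_unique hw hB hg hi ht hv (h2 ▸ h1)).2
end part13

section part14
lemma exists_pow_mem (x : KK) : ∃ m : ℕ, qq ^ m * x ∈ A0 := by
  induction x using RatFunc.induction_on with
  | _ f g hg =>
    obtain ⟨h, h1, h2⟩ := Polynomial.exists_eq_pow_rootMultiplicity_mul_and_not_dvd g hg 0
    generalize Polynomial.rootMultiplicity 0 g = m at h1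
    refine ⟨m, f, h, fun h3 => h2 ?_, ?_⟩
    · rw [Polynomial.dvd_iff_isRoot]; exact h3
    · subst h1
      have : algebraMap (Polynomial ℚ) KK h ≠ 0 := by
        intro h0
        have : h = 0 := (map_eq_zero_iff _ (RatFunc.algebraMap_injective ℚ)).mp h0
        exact hg (by rw [this, mul_zero])
      have hq := qq_ne
      simp only [map_zero, sub_zero, map_mul, map_pow, RatFunc.algebraMap_X]
      unfold qq at *
      field_simp

lemma descent {ι : Type*} (s : Finset ι) {n x : ι → KK} (hn : ∀ k ∈ s, Rs (n k) 1)
    (h : ∑ k ∈ s, n k * x k ^ 2 ∈ A0) : ∀ k ∈ s, x k ∈ A0 := by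
  have h1 : ∀ m : ℕ, (∀ k ∈ s, qq ^ m * x k ∈ A0) → ∀ k ∈ s, x k ∈ A0 := by
    intro m
    induction m with
    | zero => simp
    | succ m ih =>
      intro hm
      refine ih fun k hk => ?_
      have h2 : Rs (∑ k ∈ s, n k * (qq ^ (m+1) * x k) ^ 2) 0 := by
        have h3 : ∑ k ∈ s, n k * (qq ^ (m+1) * x k) ^ 2 = qq * (qq ^ (2 * m + 1) * ∑ k ∈ s, n k * x k ^ 2) := by
          rw [Finset.mul_sum, Finset.mul_sum]
          refine Finset.sum_congr rfl fun k _ => by ring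
        rw [h3, Rs_zero_iff]
        exact ⟨_, mul_mem (pow_mem qq_mem_A0 _) h, rfl⟩
      obtain ⟨z, hz, h4⟩ := Rs_zero_iff.mp (positivity_mod s hn hm h2 k hk)
      have : qq ^ m * x k = z := by
        apply mul_left_cancel₀ qq_ne
        rw [← h4]; ring
      rw [this]; exact hz
  have h2 : ∀ t : Finset ι, ∃ m : ℕ, ∀ k ∈ t, qq ^ m * x k ∈ A0 := by
    classical
    intro t
    induction t using Finset.induction_on with
    | empty => exact ⟨0, by simp⟩
    | insert a t ha ih =>
      obtain ⟨m, hm⟩ := ih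
      obtain ⟨m', hm'⟩ := exists_pow_mem (x a)
      refine ⟨m + m', fun k hk => ?_⟩
      rw [Finset.mem_insert] at hk
      rcases hk with rfl | hk
      · rw [pow_add, mul_assoc]; exact mul_mem (pow_mem qq_mem_A0 _) hm'
      · rw [pow_add, mul_comm (qq ^ m), mul_assoc]; exact mul_mem (pow_mem qq_mem_A0 _) (hm k hk)
  obtain ⟨m, hm⟩ := h2 s
  exact h1 m hm

lemma ip_self_mem {u : NN} (hu : u ∈ Lat A0) : ip u u ∈ A0 := by
  rw [ip_self]
  exact sum_mem fun g _ => mul_mem (Rs_nu g.2).mem (pow_mem (hu g) 2)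

lemma lat_of_ip {N : ℕ} {a : ℕ → KK} {c : ℕ → NN} (ha : ∀ n, Rs (a n) 1)
    (h : ∑ n ∈ Finset.range N, a n * ip (c n) (c n) ∈ A0) : ∀ n < N, c n ∈ Lat A0 := by
  classical
  set T := (Finset.range N).biUnion fun n => (c n).support
  have h1 : ∀ n ∈ Finset.range N, a n * ip (c n) (c n) = ∑ g ∈ T, (a n * nu g.1) * (c n g) ^ 2 := by
    intro n hn
    rw [ip_self, Finsupp.sum, Finset.mul_sum]
    rw [Finset.sum_subset (Finset.subset_biUnion_of_mem (fun n => (c n).support) hn)]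
    · exact Finset.sum_congr rfl fun g _ => by ring
    · intro g _ hg
      rw [Finsupp.notMem_support_iff.mp hg]; simp
  rw [Finset.sum_congr rfl h1, ← Finset.sum_product'] at h
  have h2 := descent (Finset.range N ×ˢ T) (n := fun k => a k.1 * nu k.2.1) (x := fun k => c k.1 k.2)
    (fun k _ => by have := (ha k.1).mul (Rs_nu k.2.2); rwa [mul_one] at this) h
  intro n hn g
  by_cases hg : c n g = 0
  · rw [hg]; exact zero_mem _
  · exact h2 (n, g) (by
      rw [Finset.mem_product]
      exact ⟨Finset.mem_range.mpr hn, Finset.mem_biUnion.mpr ⟨n, Finset.mem_range.mpr hn, Finsupp.mem_support_iff.mpr hg⟩⟩)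

lemma EF_ii (i : ℤ) (u : NN) : Eop i (Fop i u) = qq ^ (-2 : ℤ) • Fop i (Eop i u) + u := by
  rw [EF_rel, if_pos rfl, if_neg (by omega), add_zero]
  simp [Ca]

lemma E_FF (i : ℤ) (n : ℕ) {w : NN} (hw : Eop i w = 0) : Eop i (FF i (n+1) w) = qq ^ (-(n:ℤ)) • FF i n w := by
  induction n with
  | zero =>
    rw [FF_succ, FF_zero, map_smul, EF_ii, hw, map_zero, smul_zero, zero_add]
    simp [br_one]
  | succ n ih =>
    rw [FF_succ, map_smul, EF_ii, ih, map_smul, Fop_FF, smul_smul, smul_smul]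
    nth_rw 2 [← one_smul KK (FF i (n+1) w)]
    rw [← add_smul, smul_smul]
    congr 1
    have h1 : br (((n + 1 : ℕ) : ℤ) + 1) ≠ 0 := br_ne (by positivity)
    have h2 := br_add (n+1) 1
    rw [br_one] at h2
    rw [inv_mul_eq_iff_eq_mul₀ h1]
    push_cast at *
    rw [h2]
    have h3 : qq ^ (-2 : ℤ) * qq ^ (-(n:ℤ)) = qq ^ (-1 : ℤ) * qq ^ (-((n:ℤ) + 1)) := by
      rw [← zpow_add₀ qq_ne, ← zpow_add₀ qq_ne]; congr 1; ring
    have h4 : qq ^ ((n:ℤ) + 1) * qq ^ (-((n:ℤ) + 1)) = 1 := by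
      rw [← zpow_add₀ qq_ne]; simp
    rw [add_mul, mul_one, h4, h3]; ring

lemma Eop_supp {i : ℤ} {g : Gam} {x : BB} (h : Eop i (pp g) x ≠ 0) : dg x.1 + 1 = dg g := by
  rw [Eop_pp (bd_Bdd i g) (bd_Win i g)] at h
  unfold Esum at h
  rw [Finsupp.finset_sum_apply] at h
  obtain ⟨b, hb, h1⟩ := Finset.exists_ne_zero_of_sum_ne_zero h
  have := pp_apply_ne fun h2 => h1 (by rw [Finsupp.smul_apply, h2, smul_zero])
  rw [this, map_sub, dg_DD (Finset.mem_Ioc.mp hb).1]; ring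

/-- all degrees `< m` -/
def Dlt (m : ℤ) (u : NN) : Prop := ∀ g : BB, u g ≠ 0 → dg g.1 < m

lemma Dlt_E {m : ℤ} {u : NN} (h : Dlt (m+1) u) (i : ℤ) : Dlt m (Eop i u) := by
  intro x hx
  obtain ⟨g, hg, h1⟩ := map_apply_ne hx
  have := h g hg
  have := Eop_supp h1
  omega

lemma Dlt_zero {u : NN} (h : Dlt 0 u) : u = 0 := by
  ext g
  by_contra hh
  have := h g hh
  have := dg_nonneg g.2
  omega

lemma exists_Dlt (u : NN) : ∃ m : ℕ, Dlt m u := by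
  refine ⟨(∑ g ∈ u.support, (dg g.1 + 1)).toNat, fun g hg => ?_⟩
  have := Finset.single_le_sum (f := fun g : BB => dg g.1 + 1) (fun g _ => by have := dg_nonneg g.2; omega)
    (Finsupp.mem_support_iff.mpr hg)
  omega

/-- decomposition along `i` -/
lemma decomp (i : ℤ) (u : NN) : ∃ (N : ℕ) (c : ℕ → NN), (∀ n, Eop i (c n) = 0) ∧ u = ∑ n ∈ Finset.range N, FF i n (c n) := by
  have h : ∀ m : ℕ, ∀ u, Dlt m u → ∃ (N : ℕ) (c : ℕ → NN), (∀ n, Eop i (c n) = 0) ∧ u = ∑ n ∈ Finset.range N, FF i n (c n) := by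
    intro m
    induction m with
    | zero => exact fun u hu => ⟨0, 0, by simp, by simp [Dlt_zero hu]⟩
    | succ m ih =>
      intro u hu
      obtain ⟨N, c, hc, h1⟩ := ih (Eop i u) (Dlt_E (by exact_mod_cast hu) i)
      set u' := ∑ n ∈ Finset.range N, FF i (n+1) (qq ^ (n:ℤ) • c n) with hu'
      have h2 : Eop i u' = Eop i u := by
        rw [hu', map_sum, h1]
        refine Finset.sum_congr rfl fun n _ => ?_
        rw [map_smul, map_smul, E_FF i n (hc n), smul_smul, ← zpow_add₀ qq_ne]; simp
      refine ⟨N + 1, fun n => Nat.casesOn n (u - u') (fun n => qq ^ (n:ℤ) • c n), ?_, ?_⟩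
      · intro n
        cases n with
        | zero => simp [h2]
        | succ n => simp [hc]
      · rw [Finset.sum_range_succ', FF_zero]
        dsimp only
        rw [← hu']; simp
  obtain ⟨m, hm⟩ := exists_Dlt u
  exact h m u hm

def gn (n : ℕ) : KK := ∏ l ∈ Finset.range n, uu 1 / uu (l + 1)

lemma Rs_gn (n : ℕ) : Rs (gn n) 1 := by
  refine Rs_prod_one _ fun l _ => ?_
  have := (Rs_uu one_pos).mul ((Rs_uu (m := l + 1) (by positivity)).inv one_ne_zero)
  simpa [div_eq_mul_inv] using this

lemma ip_FF_step (i : ℤ) (n m : ℕ) (u : NN) {v : NN} (hv : Eop i v = 0) :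
    ip (FF i (n+1) u) (FF i (m+1) v) = (br (n+1))⁻¹ * qq ^ (-(m:ℤ)) * ip (FF i n u) (FF i m v) := by
  rw [FF_succ, map_smul, LinearMap.smul_apply, ip_adj, E_FF i m hv, map_smul, smul_eq_mul, smul_eq_mul, mul_assoc]

lemma ip_FF (i : ℤ) (n : ℕ) {u v : NN} (hv : Eop i v = 0) : 
    ip (FF i n u) (FF i n v) = gn n * ip u v := by
  induction n with
  | zero => simp [gn, FF_zero]
  | succ n ih =>
    rw [ip_FF_step i n n u hv, ih]
    unfold gn
    rw [Finset.prod_range_succ, br_eq]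
    have h1 : uu (n+1) ≠ 0 := uu_ne (by positivity)
    have h2 : uu 1 ≠ 0 := uu_ne one_ne_zero
    have h3 : qq ^ (1 - ((n:ℤ)+1)) = qq ^ (-(n:ℤ)) := by congr 1; ring
    have h4 : qq ^ (-(n:ℤ)) ≠ 0 := zpow_ne_zero _ qq_ne
    rw [h3]
    field_simp

lemma ip_FF_zero (i : ℤ) (n : ℕ) (u : NN) {v : NN} (hv : Eop i v = 0) : ip (FF i (n+1) u) v = 0 := by
  rw [FF_succ, map_smul, LinearMap.smul_apply, ip_adj, hv, map_zero, smul_zero]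

lemma ip_FF_ne (i : ℤ) {n m : ℕ} (hnm : n ≠ m) {u v : NN} (hu : Eop i u = 0) (hv : Eop i v = 0) : 
    ip (FF i n u) (FF i m v) = 0 := by
  induction n generalizing m with
  | zero =>
    obtain ⟨m, rfl⟩ := Nat.exists_eq_succ_of_ne_zero hnm.symm
    rw [FF_zero, ip_symm, ip_FF_zero i m v hu]
  | succ n ih =>
    cases m with
    | zero => rw [FF_zero, ip_FF_zero i n u hv]
    | succ m => rw [ip_FF_step i n m u hv, ih (by omega), mul_zero]

lemma ip_decomp (i : ℤ) (N : ℕ) {c : ℕ → NN} (hc : ∀ n, Eop i (c n) = 0) :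
    ip (∑ n ∈ Finset.range N, FF i n (c n)) (∑ n ∈ Finset.range N, FF i n (c n)) = ∑ n ∈ Finset.range N, gn n * ip (c n) (c n) := by
  rw [map_sum]
  refine Finset.sum_congr rfl fun n hn => ?_
  rw [map_sum, LinearMap.sum_apply, Finset.sum_eq_single n, ip_FF i n (hc n)]
  · intro m _ hmn
    exact ip_FF_ne i hmn (hc m) (hc n)
  · intro h; exact absurd hn h

lemma decomp_lat (i : ℤ) (N : ℕ) {c : ℕ → NN} (hc : ∀ n, Eop i (c n) = 0)
    (h : ∑ n ∈ Finset.range N, FF i n (c n) ∈ Lat A0) : ∀ n < N, c n ∈ Lat A0 := by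
  refine lat_of_ip Rs_gn ?_
  rw [← ip_decomp i N hc]
  exact ip_self_mem h

lemma FF_lat (i : ℤ) (n : ℕ) {w : NN} (hw : Eop i w = 0) (h : w ∈ Lat A0) : FF i n w ∈ Lat A0 := by
  refine lat_of_ip (N := 1) (a := fun _ => 1) (c := fun _ => FF i n w) (fun _ => Rs_one) ?_ 0 one_pos
  rw [Finset.sum_range_one, one_mul, ip_FF i n hw]
  exact mul_mem (Rs_gn n).mem (ip_self_mem h)

/-- the Kashiwara operator preserves the lattice -/
lemma Ft_lat (i : ℤ) (N : ℕ) {c : ℕ → NN} (hc : ∀ n, Eop i (c n) = 0)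
    (h : ∑ n ∈ Finset.range N, FF i n (c n) ∈ Lat A0) : ∑ n ∈ Finset.range N, FF i (n+1) (c n) ∈ Lat A0 :=
  sum_mem fun n hn => FF_lat i (n+1) (hc n) (decomp_lat i N hc h n (Finset.mem_range.mp hn))
end part14

section part15
lemma tri_expand {X : NN} {g : Gam} (hg : 0 ≤ g) (h : X ⟨g, hg⟩ = 1) :
    pp g = X - ∑ x ∈ X.support.erase ⟨g, hg⟩, X x • pp x.1 := by
  classical
  have h1 : (⟨g, hg⟩ : BB) ∈ X.support := by rw [Finsupp.mem_support_iff, h]; exact one_ne_zero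
  have h2 := NN_sum X
  rw [Finsupp.sum, ← Finset.add_sum_erase _ _ h1, h, one_smul] at h2
  rw [eq_sub_iff_add_eq]
  exact h2.symm

lemma tri_span {R : Subring KK} {W : AddSubgroup NN} (hW : ∀ c ∈ R, ∀ u ∈ W, c • u ∈ W)
    (h : ∀ g (hg : 0 ≤ g), ∃ X ∈ W, X ∈ Lat R ∧ X ⟨g, hg⟩ = 1 ∧ ∀ x : BB, X x ≠ 0 → pl x.1 g) : Lat R ≤ W := by
  have h1 : ∀ g, 0 ≤ g → pp g ∈ W := by
    refine gam_ind fun g hg _ ih => ?_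
    obtain ⟨X, h1, h2, h3, h4⟩ := h g hg
    rw [tri_expand hg h3]
    refine sub_mem h1 (sum_mem fun x hx => hW _ (h2 x) _ ?_)
    rw [Finset.mem_erase, Finsupp.mem_support_iff] at hx
    exact ih x.1 x.2 (h4 x hx.2) fun hh => hx.1 (Subtype.ext hh)
  intro u hu
  rw [NN_sum u]
  exact sum_mem fun x _ => hW _ (hu x) _ (h1 x.1 x.2)

/-- triangularity is preserved under stripping -/
lemma strip_tri {g : Gam} (hg : 0 ≤ g) {i : ℤ} {k : ℕ} {g' : Gam} (hg' : 0 ≤ g')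
    (h1 : FF i k (pp g') ⟨g, hg⟩ = 1) (h2 : ∀ t, 0 ≤ t → pl t g' → ∀ x : BB, FF i k (pp t) x ≠ 0 → pl x.1 g ∧ (x.1 = g → t = g'))
    {X : NN} (h3 : X ⟨g', hg'⟩ = 1) (h4 : ∀ x : BB, X x ≠ 0 → pl x.1 g') :
    FF i k X ⟨g, hg⟩ = 1 ∧ ∀ x : BB, FF i k X x ≠ 0 → pl x.1 g := by
  constructor
  · have h5 : ∀ t : BB, t ≠ ⟨g', hg'⟩ → X t ≠ 0 → FF i k (pp t.1) ⟨g, hg⟩ = 0 := by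
      intro t ht htX
      by_contra hh
      exact ht (Subtype.ext ((h2 t.1 t.2 (h4 t htX) _ hh).2 rfl))
    have h6 := tri_expand hg' h3
    rw [eq_sub_iff_add_eq] at h6
    rw [← h6, map_add, Finsupp.add_apply, h1, map_sum, Finsupp.finset_sum_apply, Finset.sum_eq_zero, add_zero]
    intro x hx
    rw [Finset.mem_erase, Finsupp.mem_support_iff] at hx
    rw [map_smul, Finsupp.smul_apply, h5 x hx.1 hx.2, smul_zero]
  · intro x hx
    obtain ⟨t, ht, h5⟩ := map_apply_ne hx
    exact (h2 t.1 t.2 (h4 t ht) x h5).1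

lemma zero_nonneg_gam : (0 : Gam) ≤ 0 := le_rfl

lemma pp_tri {g : Gam} {x : BB} (h : pp g x ≠ 0) : pl x.1 g := by
  rw [pp_apply_ne h]; exact pl_refl g

/-- lattice generated by crystal operators -/
lemma lat_le_crystal {S : AddSubgroup NN} (hS : ∀ c ∈ A0, ∀ u ∈ S, c • u ∈ S) (h0 : pp 0 ∈ S)
    (hF : ∀ i (k : ℕ) w, Eop i w = 0 → FF i k w ∈ S → FF i (k+1) w ∈ S) : Lat A0 ≤ S := by
  have h1 : ∀ g, 0 ≤ g → pp g ∈ S := by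
    refine gam_ind fun g hg ihd ih => ?_
    by_cases hg0 : g = 0
    · rw [hg0]; exact h0
    obtain ⟨i, k, g', hg', hk, hd, hE, h1, h2⟩ := strip hg hg0
    have h3 : FF i k (pp g') ∈ S := by
      have h4 : pp g' ∈ S := ihd g' hg' (by omega)
      clear h1 h2 hd hk
      induction k with
      | zero => rwa [FF_zero]
      | succ k ih => exact hF i k _ hE ih
    have h5 := strip_tri hg hg' h1 h2 (pp_self hg') (fun x hx => pp_tri hx)
    rw [tri_expand hg h1]
    refine sub_mem h3 (sum_mem fun x hx => hS _ (FF_lat i k hE (Lat_pp _ _) x) _ ?_)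
    rw [Finset.mem_erase, Finsupp.mem_support_iff] at hx
    exact ih x.1 x.2 (h5.2 x hx.2) fun hh => hx.1 (Subtype.ext hh)
  intro u hu
  rw [NN_sum u]
  exact sum_mem fun x _ => hS _ (hu x) _ (h1 x.1 x.2)

/-- invariance of subsets under divided powers: monomial elements -/
lemma Mon_exists (P : NN → Prop) (h0 : P (pp 0)) (hF : ∀ i (k : ℕ) w, P w → P (FF i k w)) :
    ∀ g (hg : 0 ≤ g), ∃ X, P X ∧ X ∈ Lat AA ∧ X ⟨g, hg⟩ = 1 ∧ ∀ x : BB, X x ≠ 0 → pl x.1 g := by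
  intro g hg
  revert hg
  suffices h : ∀ g, 0 ≤ g → ∀ hg : 0 ≤ g, ∃ X, P X ∧ X ∈ Lat AA ∧ X ⟨g, hg⟩ = 1 ∧ ∀ x : BB, X x ≠ 0 → pl x.1 g from
    fun hg => h g hg hg
  refine gam_ind fun g _ ihd _ hg => ?_
  by_cases hg0 : g = 0
  · subst hg0
    exact ⟨pp 0, h0, Lat_pp _ _, pp_self _, fun x hx => pp_tri hx⟩
  obtain ⟨i, k, g', hg', hk, hd, hE, h1, h2⟩ := strip hg hg0
  obtain ⟨X, hX, hXA, hX1, hX2⟩ := ihd g' hg' (by omega) hg'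
  have h5 := strip_tri hg hg' h1 h2 hX1 hX2
  exact ⟨FF i k X, hF i k X hX, FF_int i k hXA, h5.1, h5.2⟩

/-- generation of `N` -/
lemma NN_gen {W : Submodule KK NN} (h0 : pp 0 ∈ W) (hF : ∀ i, ∀ w ∈ W, Fop i w ∈ W) : W = ⊤ := by
  have hFF : ∀ i (k : ℕ), ∀ w ∈ W, FF i k w ∈ W := by
    intro i k w hw
    induction k with
    | zero => rwa [FF_zero]
    | succ k ih => rw [FF_succ]; exact W.smul_mem _ (hF i _ ih)
  have h1 : Lat (⊤ : Subring KK) ≤ W.toAddSubgroup := by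
    refine tri_span (fun c _ u hu => W.smul_mem c hu) fun g hg => ?_
    obtain ⟨X, h1, _, h3, h4⟩ := Mon_exists (fun u => u ∈ W) h0 (fun i k w hw => hFF i k w hw) g hg
    exact ⟨X, h1, fun _ => Subring.mem_top _, h3, h4⟩
  rw [eq_top_iff]
  intro u _
  exact h1 fun _ => Subring.mem_top _

/-- vacuum condition in `N` -/
lemma NN_vac {u : NN} (h : ∀ i, Eop i u = 0) : u = u ⟨0, le_rfl⟩ • pp 0 := by
  set v := u - u ⟨0, le_rfl⟩ • pp 0 with hv
  have hE0 : ∀ i, Eop i (pp 0) = 0 := by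
    intro i
    refine Dlt_zero (Dlt_E (m := 0) (fun g hg => ?_) i)
    rw [pp_apply_ne hg, map_zero]; norm_num
  have h1 : ∀ i, Eop i v = 0 := by
    intro i; rw [hv, map_sub, h, map_smul, hE0, smul_zero, sub_zero]
  have h2 : v ⟨0, le_rfl⟩ = 0 := by
    rw [hv, Finsupp.sub_apply, Finsupp.smul_apply, pp_self, smul_eq_mul, mul_one, sub_self]
  have h3 : (ip.flip v).ker = ⊤ := by
    have key : (Submodule.span KK {w | w = pp 0 ∨ ∃ i w', w = Fop i w'}) = ⊤ := by
      refine NN_gen (Submodule.subset_span (Or.inl rfl)) fun i w _ => Submodule.subset_span (Or.inr ⟨i, w, rfl⟩)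
    rw [eq_top_iff, ← key, Submodule.span_le]
    rintro w (rfl | ⟨i, w', rfl⟩)
    · change ip.flip v (pp 0) = 0
      rw [LinearMap.flip_apply, ip_pp le_rfl, h2, mul_zero]
    · change ip.flip v (Fop i w') = 0
      rw [LinearMap.flip_apply, ip_adj, h1, map_zero]
  have h4 : v = 0 := by
    ext g
    have h5 : pp g.1 ∈ (ip.flip v).ker := by rw [h3]; trivial
    rw [LinearMap.mem_ker, LinearMap.flip_apply, ip_pp g.2] at h5
    exact (mul_eq_zero.mp h5).resolve_left (nu_ne _)
  exact sub_eq_zero.mp h4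

lemma kbar_br (kbar : KK →+* KK) (hkb : kbar qq = qq⁻¹) (n : ℤ) : kbar (br n) = br n := by
  unfold br
  rw [map_div₀, map_sub, map_sub, map_inv₀, map_zpow₀, map_zpow₀, hkb, inv_zpow', inv_zpow', neg_neg, inv_inv]
  rw [← neg_sub, ← neg_sub qq, neg_div_neg_eq]

lemma bar_FF (kbar : KK →+* KK) (hkb : kbar qq = qq⁻¹) (bN : NN → NN)
    (bsm : ∀ (c : KK) u, bN (c • u) = kbar c • bN u)
    (bF : ∀ i u, bN (Fop i u) = Fop i (bN u)) (i : ℤ) (k : ℕ) (u : NN) : bN (FF i k u) = FF i k (bN u) := by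
  induction k with
  | zero => rw [FF_zero, FF_zero]
  | succ k ih => rw [FF_succ, FF_succ, bsm, bF, ih, map_inv₀, kbar_br kbar hkb]
end part15

section part16
structure BarD (kbar : KK →+* KK) (bN : NN →+ NN) : Prop where
  hkb : kbar qq = qq⁻¹
  sm : ∀ (c : KK) u, bN (c • u) = kbar c • bN u
  b0 : bN (pp 0) = pp 0
  bF : ∀ i u, bN (Fop i u) = Fop i (bN u)

variable {kbar : KK →+* KK} {bN : NN →+ NN}

lemma BarD.FF (h : BarD kbar bN) (i : ℤ) (k : ℕ) (u : NN) : bN (FF i k u) = GLB.FF i k (bN u) :=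
  bar_FF kbar h.hkb bN h.sm h.bF i k u

lemma BarD.pp (h : BarD kbar bN) : ∀ g, 0 ≤ g → ∀ hg : 0 ≤ g, bN (pp g) ⟨g, hg⟩ = 1 ∧
    ∀ x : BB, bN (GLB.pp g) x ≠ 0 → pl x.1 g := by
  refine gam_ind fun g _ _ ih hg => ?_
  obtain ⟨X, h1, _, h3, h4⟩ := Mon_exists (fun u => bN u = u) h.b0 (fun i k w hw => by rw [h.FF, hw]) g hg
  have hp : ∀ x ∈ X.support.erase ⟨g, hg⟩, pl x.1 g ∧ x.1 ≠ g := by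
    intro x hx
    rw [Finset.mem_erase, Finsupp.mem_support_iff] at hx
    exact ⟨h4 x hx.2, fun hh => hx.1 (Subtype.ext hh)⟩
  have e : bN (GLB.pp g) = X - ∑ x ∈ X.support.erase ⟨g, hg⟩, kbar (X x) • bN (GLB.pp x.1) := by
    conv_lhs => rw [tri_expand hg h3]
    rw [map_sub, h1, map_sum]
    simp only [h.sm]
  constructor
  · rw [e, Finsupp.sub_apply, h3, Finsupp.finset_sum_apply, Finset.sum_eq_zero, sub_zero]
    intro x hx
    by_contra hh
    rw [Finsupp.smul_apply, smul_eq_mul] at hh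
    obtain ⟨h5, h6⟩ := hp x hx
    exact h6 (pl_antisymm h5 ((ih x.1 x.2 h5 h6 x.2).2 ⟨g, hg⟩ (right_ne_zero_of_mul hh)))
  · intro y hy
    by_contra hc
    apply hy
    rw [e, Finsupp.sub_apply, Finsupp.finset_sum_apply, Finset.sum_eq_zero, sub_zero]
    · by_contra hh; exact hc (h4 y hh)
    · intro x hx
      by_contra hh
      rw [Finsupp.smul_apply, smul_eq_mul] at hh
      obtain ⟨h5, h6⟩ := hp x hx
      exact hc (pl_trans ((ih x.1 x.2 h5 h6 x.2).2 y (right_ne_zero_of_mul hh)) h5)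

/-- all coordinates vanish at `q = 0` -/
def Sm (u : NN) : Prop := ∀ x, Rs (u x) 0

lemma Sm.add {u v : NN} (hu : Sm u) (hv : Sm v) : Sm (u + v) := fun x => by
  simpa using (hu x).add (hv x)
lemma Sm.neg {u : NN} (hu : Sm u) : Sm (-u) := fun x => by simpa using (hu x).neg
lemma Sm_zero : Sm 0 := fun _ => Rs_zero
lemma Sm_sum {ι : Type*} (s : Finset ι) {f : ι → NN} (h : ∀ k ∈ s, Sm (f k)) : Sm (∑ k ∈ s, f k) := by
  classical
  induction s using Finset.induction_on with
  | empty => exact Sm_zero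
  | insert a s ha ih =>
    rw [Finset.sum_insert ha]
    exact (h a (Finset.mem_insert_self _ _)).add (ih fun k hk => h k (Finset.mem_insert_of_mem hk))

lemma Sm_smul_pp {r : KK} (hr : Rs r 0) (g : Gam) : Sm (r • pp g) := fun x => by
  obtain ⟨c, hc⟩ := mem_A0.mp (Lat_pp A0 g x)
  simpa using hr.mul hc

lemma Sm_mem {u : NN} (h : Sm u) : u ∈ Lat A0 := fun x => (h x).mem

lemma Sm_iff {u : NN} : Sm u ↔ ∃ v ∈ Lat A0, u = qq • v := by
  constructor
  · intro h
    refine ⟨qq⁻¹ • u, fun x => ?_, ?_⟩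
    · obtain ⟨z, hz, e⟩ := Rs_zero_iff.mp (h x)
      rw [Finsupp.smul_apply, e, smul_eq_mul, inv_mul_cancel_left₀ qq_ne]; exact hz
    · rw [smul_smul, mul_inv_cancel₀ qq_ne, one_smul]
  · rintro ⟨v, hv, rfl⟩ x
    exact Rs_zero_iff.mpr ⟨v x, hv x, rfl⟩

lemma BarD.claim (h : BarD kbar bN) {U : AddSubgroup NN} (hU : ∀ c ∈ AA, ∀ u ∈ U, c • u ∈ U)
    (h0 : GLB.pp 0 ∈ U) (hF : ∀ i (k : ℕ), ∀ u ∈ U, GLB.FF i k u ∈ U) :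
    ∀ t, 0 ≤ t → ∀ a ∈ AA, ∃ w, bN w = w ∧ w ∈ U ∧ Sm (a • GLB.pp t - w) := by
  refine gam_ind fun g hg _ ih a ha => ?_
  obtain ⟨s, hs, r, hr, hks, hr0, rfl⟩ := AA_split kbar h.hkb ha
  obtain ⟨X, ⟨h1, h2⟩, hA, h3, h4⟩ := Mon_exists (fun u => bN u = u ∧ u ∈ U) ⟨h.b0, h0⟩
    (fun i k w hw => ⟨by rw [h.FF, hw.1], hF i k w hw.2⟩) g hg
  have hp : ∀ x ∈ X.support.erase ⟨g, hg⟩, ∃ w, bN w = w ∧ w ∈ U ∧ Sm ((-(s * X x)) • GLB.pp x.1 - w) := by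
    intro x hx
    rw [Finset.mem_erase, Finsupp.mem_support_iff] at hx
    exact ih x.1 x.2 (h4 x hx.2) (fun hh => hx.1 (Subtype.ext hh)) _ (neg_mem (mul_mem hs (hA x)))
  choose! w hw1 hw2 hw3 using hp
  refine ⟨s • X + ∑ x ∈ X.support.erase ⟨g, hg⟩, w x, ?_, ?_, ?_⟩
  · rw [map_add, map_sum, h.sm, hks, h1, Finset.sum_congr rfl hw1]
  · exact add_mem (hU _ hs _ h2) (sum_mem hw2)
  · have e : (s + r) • GLB.pp g - (s • X + ∑ x ∈ X.support.erase ⟨g, hg⟩, w x) =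
        r • GLB.pp g + ∑ x ∈ X.support.erase ⟨g, hg⟩, ((-(s * X x)) • GLB.pp x.1 - w x) := by
      have e2 : s • GLB.pp g = s • X - ∑ x ∈ X.support.erase ⟨g, hg⟩, (s * X x) • GLB.pp x.1 := by
        conv_lhs => rw [tri_expand hg h3]
        rw [smul_sub, Finset.smul_sum]
        simp only [smul_smul]
      rw [add_smul, e2, Finset.sum_sub_distrib]
      simp only [neg_smul, Finset.sum_neg_distrib]
      abel
    rw [e]
    exact (Sm_smul_pp hr0 g).add (Sm_sum _ hw3)

lemma BarD.surj (h : BarD kbar bN) {U : AddSubgroup NN} (hU : ∀ c ∈ AA, ∀ u ∈ U, c • u ∈ U)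
    (h0 : GLB.pp 0 ∈ U) (hF : ∀ i (k : ℕ), ∀ u ∈ U, GLB.FF i k u ∈ U) {y : NN} (hy : y ∈ Lat A0) :
    ∃ w, bN w = w ∧ w ∈ U ∧ w ∈ Lat A0 ∧ Sm (y - w) := by
  have h1 : ∀ x : BB, ∃ c, Rs (y x) c := fun x => mem_A0.mp (hy x)
  choose c hc using h1
  have h2 : ∀ x : BB, ∃ w, bN w = w ∧ w ∈ U ∧ Sm (algebraMap ℚ KK (c x) • GLB.pp x.1 - w) :=
    fun x => h.claim hU h0 hF x.1 x.2 _ (C_mem_AA _)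
  choose w hw1 hw2 hw3 using h2
  have h3 : Sm (y - ∑ x ∈ y.support, w x) := by
    have e : y - ∑ x ∈ y.support, w x = ∑ x ∈ y.support, ((y x - algebraMap ℚ KK (c x)) • GLB.pp x.1 +
        (algebraMap ℚ KK (c x) • GLB.pp x.1 - w x)) := by
      have := NN_sum y
      rw [Finsupp.sum] at this
      conv_lhs => enter [1]; rw [this]
      rw [← Finset.sum_sub_distrib]
      refine Finset.sum_congr rfl fun x _ => ?_
      rw [sub_smul]; abel
    rw [e]
    refine Sm_sum _ fun x _ => (Sm_smul_pp ?_ _).add (hw3 x)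
    simpa using (hc x).sub (Rs_C (c x))
  refine ⟨∑ x ∈ y.support, w x, ?_, sum_mem fun x _ => hw2 x, ?_, h3⟩
  · rw [map_sum]; simp only [hw1]
  · have := sub_mem hy (Sm_mem h3)
    simpa using this

lemma BarD.inj (h : BarD kbar bN) {y : NN} (hy : y ∈ Lat A0) (hA : bN y ∈ Lat AA) (hS : Sm (bN y)) : bN y = 0 := by
  by_contra hne
  have hy0 : y.support.Nonempty := by
    rw [Finsupp.support_nonempty_iff]; rintro rfl; exact hne (map_zero _)
  obtain ⟨g, hg, hmax⟩ := exists_pl_max y.support hy0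
  have e : (bN y) g = kbar (y g) := by
    conv_lhs => rw [NN_sum y]
    rw [Finsupp.sum, map_sum, Finsupp.finset_sum_apply, Finset.sum_eq_single g]
    · rw [h.sm, Finsupp.smul_apply, (h.pp g.1 g.2 g.2).1, smul_eq_mul, mul_one]
    · intro t ht htg
      by_contra hh
      rw [h.sm, Finsupp.smul_apply, smul_eq_mul] at hh
      exact htg (hmax t ht ((h.pp t.1 t.2 t.2).2 g (right_ne_zero_of_mul hh)))
    · intro hh; exact absurd hg hh
  have h1 : kbar (y g) = 0 := by
    rw [← e]
    refine A_inter kbar h.hkb (hA g) (hS g) ?_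
    rw [e, kbar_invol kbar h.hkb]; exact hy g
  have h2 : y g = 0 := by rw [← kbar_invol kbar h.hkb (y g), h1, map_zero]
  exact (Finsupp.mem_support_iff.mp hg) h2

lemma span_of_pp {W : Submodule KK NN} (h : ∀ g (hg : 0 ≤ g), ∃ X ∈ W, X ⟨g, hg⟩ = 1 ∧ ∀ x : BB, X x ≠ 0 → pl x.1 g) :
    W = ⊤ := by
  have h1 : Lat (⊤ : Subring KK) ≤ W.toAddSubgroup := by
    refine tri_span (fun c _ u hu => W.smul_mem c hu) fun g hg => ?_
    obtain ⟨X, h1, h3, h4⟩ := h g hg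
    exact ⟨X, h1, fun _ => Subring.mem_top _, h3, h4⟩
  rw [eq_top_iff]
  intro u _
  exact h1 fun _ => Subring.mem_top _
end part16

section part17
/-- pre-highest weight modules -/
structure PHW (V : Type) [AddCommGroup V] [Module KK V] where
  E : ℤ → V →ₗ[KK] V
  F : ℤ → V →ₗ[KK] V
  T : ℤ → V →ₗ[KK] V
  φ : V
  EF : ∀ i j u, E i (F j u) = qq ^ (-Ca i j) • F j (E i u) + (if i = j then u else 0)
    + (if -1-i = j then T i u else 0)
  TF : ∀ i j u, T i (F j u) = qq ^ (-(Ca i j + Ca (-1-i) j)) • F j (T i u)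
  E0 : ∀ i, E i φ = 0
  T0 : ∀ i, T i φ = φ

variable {V V' : Type} [AddCommGroup V] [Module KK V] [AddCommGroup V'] [Module KK V']

namespace PHW

def wd (P : PHW V) (L : List ℤ) : V := L.foldr (fun i w => P.F i w) P.φ

def ee (i : ℤ) (L : List ℤ) : ℤ := (L.map fun j => -(Ca i j + Ca (-1-i) j)).sum

lemma wd_nil (P : PHW V) : P.wd [] = P.φ := rfl
lemma wd_cons (P : PHW V) (j : ℤ) (L : List ℤ) : P.wd (j :: L) = P.F j (P.wd L) := rfl

lemma T_wd (P : PHW V) (i : ℤ) (L : List ℤ) : P.T i (P.wd L) = qq ^ ee i L • P.wd L := by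
  induction L with
  | nil => simp [ee, wd_nil, P.T0]
  | cons j L ih =>
    rw [wd_cons, P.TF, ih, map_smul, smul_smul, ← zpow_add₀ qq_ne]
    simp [ee]

def Sn (P : PHW V) (n : ℕ) : Submodule KK V := Submodule.span KK {x | ∃ L : List ℤ, L.length < n ∧ x = P.wd L}

lemma wd_mem (P : PHW V) {L : List ℤ} {n : ℕ} (h : L.length < n) : P.wd L ∈ P.Sn n :=
  Submodule.subset_span ⟨L, h, rfl⟩

lemma Sn_map (P : PHW V) (f : V →ₗ[KK] V) {n : ℕ} {W : Submodule KK V} (h : ∀ L : List ℤ, L.length < n → f (P.wd L) ∈ W)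
    {x : V} (hx : x ∈ P.Sn n) : f x ∈ W := by
  have : P.Sn n ≤ W.comap f := by
    rw [Sn, Submodule.span_le]
    rintro _ ⟨L, hL, rfl⟩
    exact h L hL
  exact this hx

lemma Sn_mono (P : PHW V) {m n : ℕ} (h : m ≤ n) : P.Sn m ≤ P.Sn n := fun _ hx =>
  P.Sn_map LinearMap.id (fun _ hL => P.wd_mem (lt_of_lt_of_le hL h)) hx

lemma F_Sn (P : PHW V) (j : ℤ) {n : ℕ} {x : V} (hx : x ∈ P.Sn n) : P.F j x ∈ P.Sn (n+1) :=
  P.Sn_map _ (fun L hL => by rw [← wd_cons]; exact P.wd_mem (by simpa using hL)) hx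

lemma T_Sn (P : PHW V) (j : ℤ) {n : ℕ} {x : V} (hx : x ∈ P.Sn n) : P.T j x ∈ P.Sn n :=
  P.Sn_map _ (fun L hL => by rw [T_wd]; exact Submodule.smul_mem _ _ (P.wd_mem hL)) hx

lemma E_wd (P : PHW V) (i : ℤ) (L : List ℤ) : P.E i (P.wd L) ∈ P.Sn L.length := by
  induction L with
  | nil => rw [wd_nil, P.E0]; exact zero_mem _
  | cons j L ih =>
    rw [wd_cons, P.EF]
    have h1 : P.wd L ∈ P.Sn (L.length + 1) := P.wd_mem (Nat.lt_succ_self _)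
    refine add_mem (add_mem (Submodule.smul_mem _ _ (P.F_Sn j ih)) ?_) ?_
    · split_ifs
      · exact h1
      · exact zero_mem _
    · split_ifs
      · exact P.T_Sn _ h1
      · exact zero_mem _

lemma E_Sn (P : PHW V) (j : ℤ) {n : ℕ} {x : V} (hx : x ∈ P.Sn (n+1)) : P.E j x ∈ P.Sn n :=
  P.Sn_map _ (fun L hL => P.Sn_mono (Nat.lt_succ_iff.mp hL) (P.E_wd j L)) hx

lemma Sn_zero (P : PHW V) : P.Sn 0 = ⊥ := by
  simp [Sn]

/-- the span of all words -/
def Z (P : PHW V) : Submodule KK V := Submodule.span KK {x | ∃ L : List ℤ, x = P.wd L}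

lemma mem_Z (P : PHW V) {x : V} : x ∈ P.Z ↔ ∃ n, x ∈ P.Sn n := by
  constructor
  · intro hx
    refine Submodule.span_induction (p := fun x _ => ∃ n, x ∈ P.Sn n) ?_ ⟨0, zero_mem _⟩ ?_ ?_ hx
    · rintro _ ⟨L, rfl⟩; exact ⟨L.length + 1, P.wd_mem (Nat.lt_succ_self _)⟩
    · rintro x y _ _ ⟨m, hm⟩ ⟨n, hn⟩
      exact ⟨max m n, add_mem (P.Sn_mono (le_max_left _ _) hm) (P.Sn_mono (le_max_right _ _) hn)⟩
    · rintro c x _ ⟨m, hm⟩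
      exact ⟨m, Submodule.smul_mem _ _ hm⟩
  · rintro ⟨n, hn⟩
    exact P.Sn_map (W := P.Z) LinearMap.id (fun L _ => Submodule.subset_span ⟨L, rfl⟩) hn

lemma φ_Z (P : PHW V) : P.φ ∈ P.Z := Submodule.subset_span ⟨[], rfl⟩
lemma F_Z (P : PHW V) (j : ℤ) {x : V} (hx : x ∈ P.Z) : P.F j x ∈ P.Z := by
  obtain ⟨n, hn⟩ := P.mem_Z.mp hx
  exact P.mem_Z.mpr ⟨_, P.F_Sn j hn⟩
lemma E_Z (P : PHW V) (j : ℤ) {x : V} (hx : x ∈ P.Z) : P.E j x ∈ P.Z := by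
  obtain ⟨n, hn⟩ := P.mem_Z.mp hx
  exact P.mem_Z.mpr ⟨n, P.E_Sn j (P.Sn_mono (Nat.le_succ n) hn)⟩
lemma T_Z (P : PHW V) (j : ℤ) {x : V} (hx : x ∈ P.Z) : P.T j x ∈ P.Z := by
  obtain ⟨n, hn⟩ := P.mem_Z.mp hx
  exact P.mem_Z.mpr ⟨n, P.T_Sn j hn⟩

/-- separation of nonempty words from the vacuum -/
lemma ee_aux (m : ℤ) (hm : 0 ≤ m) (L : List ℤ) (hL : ∀ j ∈ L, j ≤ m ∧ -1-j ≤ m) :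
    0 ≤ ee (m+1) L ∧ ((m ∈ L ∨ -1-m ∈ L) → 0 < ee (m+1) L) := by
  induction L with
  | nil => simp [ee]
  | cons j L ih =>
    obtain ⟨h1, h2⟩ := ih fun k hk => hL k (List.mem_cons_of_mem _ hk)
    have hj := hL j List.mem_cons_self
    have e : ee (m+1) (j :: L) = -(Ca (m+1) j + Ca (-1-(m+1)) j) + ee (m+1) L := by simp [ee]
    have e1 : 0 ≤ -(Ca (m+1) j + Ca (-1-(m+1)) j) := by
      unfold Ca; split_ifs <;> omega
    have e2 : (m = j ∨ -1-m = j) → 0 < -(Ca (m+1) j + Ca (-1-(m+1)) j) := by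
      unfold Ca; split_ifs <;> omega
    rw [e]
    refine ⟨by omega, ?_⟩
    rw [List.mem_cons, List.mem_cons]
    intro h
    by_cases h3 : m = j ∨ -1-m = j
    · have := e2 h3; omega
    · have := h2 (by tauto); omega

lemma exists_ee {L : List ℤ} (hL : L ≠ []) : ∃ i, ee i L ≠ 0 := by
  have h : ∃ m, 0 ≤ m ∧ (∀ j ∈ L, j ≤ m ∧ -1-j ≤ m) ∧ (m ∈ L ∨ -1-m ∈ L) := by
    clear * - hL
    induction L with
    | nil => exact absurd rfl hL
    | cons j L ih =>
      by_cases hL' : L = []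
      · subst hL'
        refine ⟨max j (-1-j), by omega, by simp, ?_⟩
        simp only [List.mem_singleton]; omega
      · obtain ⟨m, h0, h1, h2⟩ := ih hL'
        by_cases hj : j ≤ m ∧ -1-j ≤ m
        · refine ⟨m, h0, ?_, ?_⟩
          · intro k hk
            rcases List.mem_cons.mp hk with rfl | hk
            · exact hj
            · exact h1 k hk
          · rw [List.mem_cons, List.mem_cons]; tauto
        · refine ⟨max j (-1-j), by omega, ?_, ?_⟩
          · intro k hk
            rcases List.mem_cons.mp hk with rfl | hk
            · omega
            · have := h1 k hk; omega
          · rw [List.mem_cons, List.mem_cons]; omega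
  obtain ⟨m, h0, h1, h2⟩ := h
  exact ⟨m+1, ((ee_aux m h0 L h1).2 h2).ne'⟩

def Zp (P : PHW V) : Submodule KK V := Submodule.span KK {x | ∃ L : List ℤ, L ≠ [] ∧ x = P.wd L}

lemma killer (P : PHW V) (s : Finset V) (hs : ∀ x ∈ s, ∃ L : List ℤ, L ≠ [] ∧ x = P.wd L) :
    ∃ D : V →ₗ[KK] V, (∀ x ∈ s, D x = 0) ∧ D P.φ = P.φ ∧ ∀ L, ∃ c : KK, D (P.wd L) = c • P.wd L := by
  classical
  induction s using Finset.induction_on with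
  | empty => exact ⟨LinearMap.id, by simp, rfl, fun L => ⟨1, by simp⟩⟩
  | insert a s ha ih =>
    obtain ⟨D, h1, h2, h3⟩ := ih fun x hx => hs x (Finset.mem_insert_of_mem hx)
    obtain ⟨L, hL, rfl⟩ := hs a (Finset.mem_insert_self _ _)
    obtain ⟨i, hi⟩ := exists_ee hL
    have hq : 1 - qq ^ ee i L ≠ 0 := sub_ne_zero.mpr (qq_zpow_ne hi).symm
    set D' : V →ₗ[KK] V := (1 - qq ^ ee i L)⁻¹ • (P.T i - (qq ^ ee i L) • LinearMap.id) with hD'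
    have hd : ∀ L', D' (P.wd L') = ((1 - qq ^ ee i L)⁻¹ * (qq ^ ee i L' - qq ^ ee i L)) • P.wd L' := by
      intro L'
      rw [hD', LinearMap.smul_apply, LinearMap.sub_apply, T_wd, LinearMap.smul_apply, LinearMap.id_apply, ← sub_smul, smul_smul]
    refine ⟨D ∘ₗ D', ?_, ?_, ?_⟩
    · intro x hx
      rcases Finset.mem_insert.mp hx with rfl | hx
      · rw [LinearMap.comp_apply, hd, sub_self, mul_zero, zero_smul, map_zero]
      · obtain ⟨L', _, rfl⟩ := hs x (Finset.mem_insert_of_mem hx)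
        rw [LinearMap.comp_apply, hd, map_smul, h1 _ hx, smul_zero]
    · rw [LinearMap.comp_apply, ← wd_nil, hd, map_smul, wd_nil, h2]
      have : ee i [] = 0 := by simp [ee]
      rw [this, zpow_zero, inv_mul_cancel₀ hq, one_smul]
    · intro L'
      obtain ⟨c, hc⟩ := h3 L'
      rw [LinearMap.comp_apply, hd, map_smul, hc, smul_smul]
      exact ⟨_, rfl⟩

lemma φ_Zp (P : PHW V) (h : P.φ ∈ P.Zp) : P.φ = 0 := by
  obtain ⟨s, hs, hm⟩ := Submodule.mem_span_finite_of_mem_span h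
  obtain ⟨D, h1, h2, _⟩ := P.killer s (fun x hx => hs hx)
  have : Submodule.span KK (s : Set V) ≤ D.ker := by
    rw [Submodule.span_le]; intro x hx; exact h1 x hx
  rw [← h2]; exact this hm

lemma Z_split (P : PHW V) {x : V} (hx : x ∈ P.Z) : ∃ c : KK, ∃ z ∈ P.Zp, x = c • P.φ + z := by
  refine Submodule.span_induction (p := fun x _ => ∃ c : KK, ∃ z ∈ P.Zp, x = c • P.φ + z) ?_ ⟨0, 0, zero_mem _, by simp⟩ ?_ ?_ hx
  · rintro _ ⟨L, rfl⟩
    by_cases hL : L = []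
    · subst hL; exact ⟨1, 0, zero_mem _, by simp [wd_nil]⟩
    · exact ⟨0, P.wd L, Submodule.subset_span ⟨L, hL, rfl⟩, by simp⟩
  · rintro _ _ _ _ ⟨c, z, hz, rfl⟩ ⟨d, w, hw, rfl⟩
    exact ⟨c + d, z + w, add_mem hz hw, by rw [add_smul]; abel⟩
  · rintro a _ _ ⟨c, z, hz, rfl⟩
    exact ⟨a * c, a • z, Submodule.smul_mem _ _ hz, by rw [smul_add, smul_smul]⟩

/-- product -/
def prod (P : PHW V) (P' : PHW V') : PHW (V × V') where
  E i := (P.E i).prodMap (P'.E i)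
  F i := (P.F i).prodMap (P'.F i)
  T i := (P.T i).prodMap (P'.T i)
  φ := (P.φ, P'.φ)
  EF i j u := by
    obtain ⟨u, v⟩ := u
    simp only [LinearMap.prodMap_apply, P.EF, P'.EF, Prod.smul_mk]
    split_ifs <;> simp
  TF i j u := by
    obtain ⟨u, v⟩ := u
    simp only [LinearMap.prodMap_apply, P.TF, P'.TF, Prod.smul_mk]
  E0 i := by simp [P.E0, P'.E0]
  T0 i := by simp [P.T0, P'.T0]

lemma prod_wd (P : PHW V) (P' : PHW V') (L : List ℤ) : (P.prod P').wd L = (P.wd L, P'.wd L) := by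
  induction L with
  | nil => rfl
  | cons j L ih => rw [wd_cons, ih]; rfl

lemma prod_Zp (P : PHW V) (P' : PHW V') {x : V × V'} (hx : x ∈ (P.prod P').Zp) : x.1 ∈ P.Zp ∧ x.2 ∈ P'.Zp := by
  have : (P.prod P').Zp ≤ P.Zp.prod P'.Zp := by
    rw [Zp, Submodule.span_le]
    rintro _ ⟨L, hL, rfl⟩
    rw [prod_wd]
    exact ⟨Submodule.subset_span ⟨L, hL, rfl⟩, Submodule.subset_span ⟨L, hL, rfl⟩⟩
  exact this hx

lemma not_right (P : PHW V) (P' : PHW V') (h : P.φ ≠ 0) (h' : P'.φ ≠ 0) : ((0 : V), P'.φ) ∉ (P.prod P').Z := by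
  intro hm
  obtain ⟨c, z, hz, e⟩ := Z_split _ hm
  obtain ⟨h1, h2⟩ := prod_Zp P P' hz
  have e1 : 0 = c • P.φ + z.1 := congrArg Prod.fst e
  have e2 : P'.φ = c • P'.φ + z.2 := congrArg Prod.snd e
  by_cases hc : c = 0
  · rw [hc, zero_smul, zero_add] at e2
    rw [← e2] at h2
    exact h' (P'.φ_Zp h2)
  · apply h
    apply P.φ_Zp
    have : P.φ = (-c⁻¹) • z.1 := by
      rw [eq_comm, add_comm, add_eq_zero_iff_eq_neg] at e1
      rw [e1, smul_neg, neg_smul, neg_neg, smul_smul, inv_mul_cancel₀ hc, one_smul]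
    rw [this]
    exact Submodule.smul_mem _ _ h1

lemma not_left (P : PHW V) (P' : PHW V') (h : P.φ ≠ 0) (h' : P'.φ ≠ 0) : (P.φ, (0 : V')) ∉ (P.prod P').Z := by
  intro hm
  obtain ⟨c, z, hz, e⟩ := Z_split _ hm
  obtain ⟨h1, h2⟩ := prod_Zp P P' hz
  have e1 : P.φ = c • P.φ + z.1 := congrArg Prod.fst e
  have e2 : 0 = c • P'.φ + z.2 := congrArg Prod.snd e
  by_cases hc : c = 0
  · rw [hc, zero_smul, zero_add] at e1
    rw [← e1] at h1
    exact h (P.φ_Zp h1)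
  · apply h'
    apply P'.φ_Zp
    have : P'.φ = (-c⁻¹) • z.2 := by
      rw [eq_comm, add_comm, add_eq_zero_iff_eq_neg] at e2
      rw [e2, smul_neg, neg_smul, neg_neg, smul_smul, inv_mul_cancel₀ hc, one_smul]
    rw [this]
    exact Submodule.smul_mem _ _ h2

/-- vacuum condition -/
def Vac (P : PHW V) : Prop := ∀ u, (∀ i, P.E i u = 0) → ∃ c : KK, u = c • P.φ

lemma inj_right (P : PHW V) (P' : PHW V') (h : P.φ ≠ 0) (h' : P'.φ ≠ 0) (hv : P'.Vac) (n : ℕ) :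
    ∀ v, ((0 : V), v) ∈ (P.prod P').Sn n → v = 0 := by
  induction n with
  | zero =>
    intro v hv
    rw [Sn_zero, Submodule.mem_bot] at hv
    exact congrArg Prod.snd hv
  | succ n ih =>
    intro v hm
    have h1 : ∀ i, P'.E i v = 0 := by
      intro i
      apply ih
      have := (P.prod P').E_Sn i hm
      have e : (P.prod P').E i (0, v) = (0, P'.E i v) := by simp [prod]
      rwa [e] at this
    obtain ⟨c, rfl⟩ := hv v h1
    by_contra hne
    have hc : c ≠ 0 := by rintro rfl; exact hne (zero_smul _ _)
    apply not_right P P' h h'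
    have h2 := Submodule.smul_mem _ c⁻¹ ((P.prod P').mem_Z.mpr ⟨_, hm⟩)
    rwa [Prod.smul_mk, smul_zero, smul_smul, inv_mul_cancel₀ hc, one_smul] at h2

lemma inj_left (P : PHW V) (P' : PHW V') (h : P.φ ≠ 0) (h' : P'.φ ≠ 0) (hv : P.Vac) (n : ℕ) :
    ∀ v, (v, (0 : V')) ∈ (P.prod P').Sn n → v = 0 := by
  induction n with
  | zero =>
    intro v hv
    rw [Sn_zero, Submodule.mem_bot] at hv
    exact congrArg Prod.fst hv
  | succ n ih =>
    intro v hm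
    have h1 : ∀ i, P.E i v = 0 := by
      intro i
      apply ih
      have := (P.prod P').E_Sn i hm
      have e : (P.prod P').E i (v, 0) = (P.E i v, 0) := by simp [prod]
      rwa [e] at this
    obtain ⟨c, rfl⟩ := hv v h1
    by_contra hne
    have hc : c ≠ 0 := by rintro rfl; exact hne (zero_smul _ _)
    apply not_left P P' h h'
    have h2 := Submodule.smul_mem _ c⁻¹ ((P.prod P').mem_Z.mpr ⟨_, hm⟩)
    rwa [Prod.smul_mk, smul_zero, smul_smul, inv_mul_cancel₀ hc, one_smul] at h2

theorem iso (P : PHW V) (P' : PHW V') (h : P.φ ≠ 0) (h' : P'.φ ≠ 0) (hv : P.Vac) (hv' : P'.Vac)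
    (hZ : P.Z = ⊤) (hZ' : P'.Z = ⊤) : ∃ Ψ : V ≃ₗ[KK] V', Ψ P.φ = P'.φ ∧ (∀ i u, Ψ (P.F i u) = P'.F i (Ψ u)) ∧
      (∀ i u, Ψ (P.E i u) = P'.E i (Ψ u)) := by
  set ZZ := (P.prod P').Z with hZZ
  have bij1 : Function.Bijective ((LinearMap.fst KK V V').comp ZZ.subtype) := by
    constructor
    · rw [← LinearMap.ker_eq_bot, LinearMap.ker_eq_bot']
      rintro ⟨⟨u, v⟩, hm⟩ hu
      have hu' : u = 0 := hu
      subst hu'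
      obtain ⟨n, hn⟩ := (P.prod P').mem_Z.mp hm
      have := inj_right P P' h h' hv' n v hn
      subst this; rfl
    · rw [← LinearMap.range_eq_top, eq_top_iff, ← hZ, Z, Submodule.span_le]
      rintro _ ⟨L, rfl⟩
      exact ⟨⟨(P.wd L, P'.wd L), Submodule.subset_span ⟨L, (prod_wd P P' L).symm⟩⟩, rfl⟩
  have bij2 : Function.Bijective ((LinearMap.snd KK V V').comp ZZ.subtype) := by
    constructor
    · rw [← LinearMap.ker_eq_bot, LinearMap.ker_eq_bot']
      rintro ⟨⟨u, v⟩, hm⟩ hu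
      have hu' : v = 0 := hu
      subst hu'
      obtain ⟨n, hn⟩ := (P.prod P').mem_Z.mp hm
      have := inj_left P P' h h' hv n u hn
      subst this; rfl
    · rw [← LinearMap.range_eq_top, eq_top_iff, ← hZ', Z, Submodule.span_le]
      rintro _ ⟨L, rfl⟩
      exact ⟨⟨(P.wd L, P'.wd L), Submodule.subset_span ⟨L, (prod_wd P P' L).symm⟩⟩, rfl⟩
  set Ψ : V ≃ₗ[KK] V' := (LinearEquiv.ofBijective _ bij1).symm ≪≫ₗ LinearEquiv.ofBijective _ bij2 with hΨ
  have key : ∀ z : ZZ, Ψ z.1.1 = z.1.2 := by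
    intro z
    have : z.1.1 = LinearEquiv.ofBijective _ bij1 z := rfl
    rw [this, hΨ, LinearEquiv.trans_apply, LinearEquiv.symm_apply_apply]
    rfl
  have key2 : ∀ u, (u, Ψ u) ∈ ZZ := by
    intro u
    obtain ⟨z, rfl⟩ := bij1.2 u
    have : Ψ (((LinearMap.fst KK V V').comp ZZ.subtype) z) = z.1.2 := key z
    rw [this]; exact z.2
  refine ⟨Ψ, key ⟨(P.φ, P'.φ), φ_Z _⟩, fun i u => ?_, fun i u => ?_⟩
  · exact key ⟨(P.F i u, P'.F i (Ψ u)), F_Z (P.prod P') i (key2 u)⟩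
  · exact key ⟨(P.E i u, P'.E i (Ψ u)), E_Z (P.prod P') i (key2 u)⟩

end PHW

/-- the combinatorial module -/
def NP : PHW NN where
  E := Eop
  F := Fop
  T := Top
  φ := pp 0
  EF := EF_rel
  TF := TF_rel
  E0 i := by
    refine Dlt_zero (Dlt_E (m := 0) (fun g hg => ?_) i)
    rw [pp_apply_ne hg, map_zero]; norm_num
  T0 i := by rw [Top_pp, map_zero, zpow_zero, one_smul]

lemma NP_vac : NP.Vac := fun _ hu => ⟨_, NN_vac hu⟩
lemma NP_Z : NP.Z = ⊤ := NN_gen NP.φ_Z fun i _ hw => NP.F_Z i hw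
lemma NP_ne : NP.φ ≠ 0 := by
  intro h
  have := pp_self (g := 0) le_rfl
  rw [show pp 0 = 0 from h] at this
  exact zero_ne_one this
end part17

section part18
def od (r : ℤ) : Iodd := ⟨2 * r + 1, ⟨r, rfl⟩⟩

lemma od_surj (i : Iodd) : ∃ r, i = od r := by
  obtain ⟨n, r, rfl⟩ := i
  exact ⟨r, rfl⟩

lemma od_inj {r s : ℤ} : od r = od s ↔ r = s := by
  constructor
  · intro h
    have : 2 * r + 1 = 2 * s + 1 := congrArg Subtype.val h
    omega
  · rintro rfl; rfl

lemma th_od (r : ℤ) : thOdd (od r) = od (-1-r) := by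
  apply Subtype.ext
  change -(2 * r + 1) = 2 * (-1-r) + 1
  ring

lemma A_od (r s : ℤ) : Aodd (od r) (od s) = Ca r s := by
  unfold Aodd Ca od
  simp only
  split_ifs <;> omega

lemma A_diag (i : Iodd) : Aodd i i / 2 = 1 := by
  simp [Aodd]

section
variable (M : BRepQ Aodd thOdd) (hM : IsVtheta Aodd thOdd lam0 M)

lemma rho_EF (i j : ℤ) (u : M.carrier) : M.rho (Eg Aodd thOdd (od i)) (M.rho (Fg Aodd thOdd (od j)) u)
    = qq ^ (-Ca i j) • M.rho (Fg Aodd thOdd (od j)) (M.rho (Eg Aodd thOdd (od i)) u) + (if i = j then u else 0)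
    + (if -1-i = j then M.rho (Tg Aodd thOdd (od i)) u else 0) := by
  have h := RingQuot.mkAlgHom_rel KK (BRel.EF (A := Aodd) (θ := thOdd) (od i) (od j))
  have h2 := congrArg (fun x => M.rho x u) h
  simp only [map_mul, map_add, map_smul] at h2
  simp only [A_od, th_od, od_inj] at h2
  rw [Module.End.mul_apply] at h2
  refine h2.trans ?_
  simp only [qZ, LinearMap.add_apply, LinearMap.smul_apply, Module.End.mul_apply]
  congr 1
  · congr 1
    split_ifs <;> simp
  · split_ifs
    · rfl
    · simp

lemma rho_TF (i j : ℤ) (u : M.carrier) : M.rho (Tg Aodd thOdd (od i)) (M.rho (Fg Aodd thOdd (od j)) u)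
    = qq ^ (-(Ca i j + Ca (-1-i) j)) • M.rho (Fg Aodd thOdd (od j)) (M.rho (Tg Aodd thOdd (od i)) u) := by
  have h := RingQuot.mkAlgHom_rel KK (BRel.TF (A := Aodd) (θ := thOdd) (od i) (od j))
  have h2 := congrArg (fun x => M.rho x u) h
  simp only [map_mul, map_smul] at h2
  simp only [A_od, th_od] at h2
  rw [Module.End.mul_apply] at h2
  exact h2

lemma rho_TiT (i : Iodd) (u : M.carrier) : M.rho (Tig Aodd thOdd i) (M.rho (Tg Aodd thOdd i) u) = u := by
  have h := RingQuot.mkAlgHom_rel KK (BRel.T_inv_left (A := Aodd) (θ := thOdd) i)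
  have h2 := congrArg (fun x => M.rho x u) h
  simp only [map_mul, map_one] at h2
  exact h2

def MP : PHW M.carrier where
  E i := M.rho (Eg Aodd thOdd (od i))
  F i := M.rho (Fg Aodd thOdd (od i))
  T i := M.rho (Tg Aodd thOdd (od i))
  φ := M.vac
  EF := rho_EF M
  TF := rho_TF M
  E0 i := hM.1 _
  T0 i := by rw [hM.2.1, lam0, qZ, zpow_zero, one_smul]

lemma MP_vac : (MP M hM).Vac := by
  intro u hu
  refine (hM.2.2.2 u).mp fun i => ?_
  obtain ⟨r, rfl⟩ := od_surj i
  exact hu r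

lemma MP_Z : (MP M hM).Z = ⊤ := by
  set P := MP M hM with hP
  refine hM.2.2.1 _ ?_ P.φ_Z
  intro x
  obtain ⟨y, rfl⟩ := RingQuot.mkAlgHom_surjective KK (BRel Aodd thOdd) x
  induction y using FreeAlgebra.induction with
  | grade0 c =>
    intro w hw
    rw [AlgHom.commutes, AlgHom.commutes, Module.algebraMap_end_apply]
    exact Submodule.smul_mem _ _ hw
  | grade1 b =>
    intro w hw
    cases b with
    | E i => obtain ⟨r, rfl⟩ := od_surj i; exact P.E_Z r hw
    | F i => obtain ⟨r, rfl⟩ := od_surj i; exact P.F_Z r hw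
    | T i => obtain ⟨r, rfl⟩ := od_surj i; exact P.T_Z r hw
    | Ti i =>
      obtain ⟨r, rfl⟩ := od_surj i
      have : P.Z ≤ P.Z.comap (M.rho (Tig Aodd thOdd (od r))) := by
        conv_lhs => rw [PHW.Z]
        rw [Submodule.span_le]
        rintro _ ⟨L, rfl⟩
        change M.rho (Tig Aodd thOdd (od r)) (P.wd L) ∈ P.Z
        have h1 : M.rho (Tig Aodd thOdd (od r)) (P.T r (P.wd L)) = P.wd L := rho_TiT M _ _
        rw [P.T_wd, map_smul] at h1
        have h2 : M.rho (Tig Aodd thOdd (od r)) (P.wd L) = (qq ^ PHW.ee r L)⁻¹ • P.wd L := by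
          rw [eq_inv_smul_iff₀ (zpow_ne_zero _ qq_ne)]; exact h1
        rw [h2]
        exact Submodule.smul_mem _ _ (Submodule.subset_span ⟨L, rfl⟩)
      exact this hw
  | mul a b ha hb =>
    intro w hw
    rw [map_mul, map_mul, Module.End.mul_apply]
    exact ha _ (hb _ hw)
  | add a b ha hb =>
    intro w hw
    rw [map_add, map_add, LinearMap.add_apply]
    exact add_mem (ha _ hw) (hb _ hw)

theorem MN_iso (hM : IsVtheta Aodd thOdd lam0 M) (hv : M.vac ≠ 0) : ∃ Ψ : M.carrier ≃ₗ[KK] NN, Ψ M.vac = pp 0 ∧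
    (∀ i u, Ψ (M.rho (Fg Aodd thOdd (od i)) u) = Fop i (Ψ u)) ∧
    (∀ i u, Ψ (M.rho (Eg Aodd thOdd (od i)) u) = Eop i (Ψ u)) :=
  PHW.iso (MP M hM) NP hv NP_ne (MP_vac M hM) NP_vac (MP_Z M hM) NP_Z

lemma triv_of_vac (hM : IsVtheta Aodd thOdd lam0 M) (hv : M.vac = 0) : Subsingleton M.carrier := by
  have : (⊥ : Submodule KK M.carrier) = ⊤ := by
    refine hM.2.2.1 _ ?_ ?_
    · intro x w hw
      rw [Submodule.mem_bot] at hw ⊢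
      rw [hw, map_zero]
    · rw [hv]; exact zero_mem _
  exact (Submodule.subsingleton_iff KK).mp (subsingleton_of_bot_eq_top this)

end
end part18

section part19
structure Dat (M : BRepQ Aodd thOdd) where
  Ψ : M.carrier ≃ₗ[KK] NN
  h0 : Ψ M.vac = pp 0
  hF : ∀ i u, Ψ (M.rho (Fg Aodd thOdd (od i)) u) = Fop i (Ψ u)
  hE : ∀ i u, Ψ (M.rho (Eg Aodd thOdd (od i)) u) = Eop i (Ψ u)

namespace Dat
variable {M : BRepQ Aodd thOdd}

lemma Fpow_Ψ (D : Dat M) (i : ℤ) (n : ℕ) (u : M.carrier) : D.Ψ (Fpow M (od i) n u) = FF i n (D.Ψ u) := by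
  have h : ∀ n : ℕ, D.Ψ ((M.rho (Fg Aodd thOdd (od i)) ^ n) u) = (Fop i ^ n) (D.Ψ u) := by
    intro n
    induction n with
    | zero => simp
    | succ n ih => rw [pow_succ', pow_succ', Module.End.mul_apply, Module.End.mul_apply, D.hF, ih]
  rw [Fpow, A_diag, LinearMap.smul_apply, map_smul, h, FF, LinearMap.smul_apply]

lemma qsmul (D : Dat M) (r : ℚ) (x : M.carrier) : D.Ψ (r • x) = algebraMap ℚ KK r • D.Ψ x := by
  rw [← algebraMap_smul KK r x, map_smul]

lemma exists_c (i : ℤ) (u : NN) : ∃ c : ℕ →₀ NN, (∀ n, Eop i (c n) = 0) ∧ u = (c.sum fun n x => FF i n x) ∧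
    (u ∈ Lat A0 → (c.sum fun n x => FF i (n+1) x) ∈ Lat A0) := by
  classical
  obtain ⟨N, c, hc, e⟩ := decomp i u
  set d : ℕ →₀ NN := Finsupp.onFinset (Finset.range N) (fun n => if n < N then c n else 0)
    (fun n hn => by rw [Finset.mem_range]; by_contra h; simp [h] at hn) with hd
  have hs : ∀ f : ℕ → NN →ₗ[KK] NN, (d.sum fun n x => f n x) = ∑ n ∈ Finset.range N, f n (c n) := by
    intro f
    rw [Finsupp.sum_of_support_subset d (s := Finset.range N) Finsupp.support_onFinset_subset _ (by simp)]
    refine Finset.sum_congr rfl fun n hn => ?_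
    rw [hd, Finsupp.onFinset_apply, if_pos (Finset.mem_range.mp hn)]
  refine ⟨d, ?_, ?_, ?_⟩
  · intro n
    rw [hd, Finsupp.onFinset_apply]
    split_ifs
    · exact hc n
    · exact map_zero _
  · rw [hs]; exact e
  · intro hu
    rw [hs fun n => FF i (n+1)]
    rw [e] at hu
    exact Ft_lat i N hc hu

variable {Et Ft : Iodd → M.carrier → M.carrier}

lemma Ft_sum (D : Dat M) (hEF : ModifiedOpsV M Et Ft) (i : ℤ) (c : ℕ →₀ NN) (hc : ∀ n, Eop i (c n) = 0) :
    D.Ψ (Ft (od i) (D.Ψ.symm (c.sum fun n x => FF i n x))) = c.sum fun n x => FF i (n+1) x := by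
  have h := (hEF (od i) (c.mapRange D.Ψ.symm (map_zero _)) (fun n => by
    apply D.Ψ.injective
    rw [Finsupp.mapRange_apply, D.hE, LinearEquiv.apply_symm_apply, hc, map_zero])).2
  rw [Finsupp.sum_mapRange_index (by simp), Finsupp.sum_mapRange_index (by simp)] at h
  have e1 : (c.sum fun n x => Fpow M (od i) n (D.Ψ.symm x)) = D.Ψ.symm (c.sum fun n x => FF i n x) := by
    apply D.Ψ.injective
    rw [LinearEquiv.apply_symm_apply, map_finsuppSum]
    simp only [Fpow_Ψ, LinearEquiv.apply_symm_apply]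
  rw [← e1, h, map_finsuppSum]
  simp only [Fpow_Ψ, LinearEquiv.apply_symm_apply]

lemma Ft_add (D : Dat M) (hEF : ModifiedOpsV M Et Ft) (i : ℤ) (x y : M.carrier) : Ft (od i) (x + y) = Ft (od i) x + Ft (od i) y := by
  obtain ⟨c, hc, ec, -⟩ := exists_c i (D.Ψ x)
  obtain ⟨d, hd, ed, -⟩ := exists_c i (D.Ψ y)
  have e : D.Ψ (x + y) = (c + d).sum fun n x => FF i n x := by
    rw [Finsupp.sum_add_index' (by simp) (by simp), ← ec, ← ed, map_add]
  have h1 := D.Ft_sum hEF i c hc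
  have h2 := D.Ft_sum hEF i d hd
  have h3 := D.Ft_sum hEF i (c + d) (fun n => by rw [Finsupp.add_apply, map_add, hc, hd, add_zero])
  rw [← ec, LinearEquiv.symm_apply_apply] at h1
  rw [← ed, LinearEquiv.symm_apply_apply] at h2
  rw [← e, LinearEquiv.symm_apply_apply, Finsupp.sum_add_index' (by simp) (by simp), ← h1, ← h2, ← map_add] at h3
  exact D.Ψ.injective h3

lemma Ft_smul (D : Dat M) (hEF : ModifiedOpsV M Et Ft) (i : ℤ) (a : KK) (x : M.carrier) : Ft (od i) (a • x) = a • Ft (od i) x := by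
  obtain ⟨c, hc, ec, -⟩ := exists_c i (D.Ψ x)
  have hs : ∀ f : ℕ → NN →ₗ[KK] NN, ((a • c).sum fun n x => f n x) = a • c.sum fun n x => f n x := by
    intro f
    rw [Finsupp.sum_smul_index' (by simp), Finsupp.smul_sum]
    simp only [map_smul]
  have h1 := D.Ft_sum hEF i c hc
  have h3 := D.Ft_sum hEF i (a • c) (fun n => by rw [Finsupp.smul_apply, map_smul, hc, smul_zero])
  rw [hs, hs fun n => FF i (n+1)] at h3
  rw [← ec, LinearEquiv.symm_apply_apply] at h1
  rw [← ec, map_smul, LinearEquiv.symm_apply_apply, ← h1, ← map_smul] at h3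
  exact D.Ψ.injective h3

lemma Ft_Lat (D : Dat M) (hEF : ModifiedOpsV M Et Ft) (i : ℤ) {x : M.carrier} (hx : D.Ψ x ∈ Lat A0) : D.Ψ (Ft (od i) x) ∈ Lat A0 := by
  obtain ⟨c, hc, ec, h⟩ := exists_c i (D.Ψ x)
  have h1 := D.Ft_sum hEF i c hc
  rw [← ec, LinearEquiv.symm_apply_apply] at h1
  rw [h1]; exact h hx

lemma Lth_A0 {a : KK} (ha : a ∈ A0) {x : M.carrier} (hx : x ∈ Lth M Ft) : a • x ∈ Lth M Ft := by
  refine Submodule.span_induction (p := fun x _ => a • x ∈ Lth M Ft) ?_ ?_ ?_ ?_ hx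
  · rintro _ ⟨c, hc, s, hs, rfl⟩
    exact Submodule.subset_span ⟨a * c, A0.mul_mem ha hc, s, hs, smul_smul _ _ _⟩
  · rw [smul_zero]; exact zero_mem _
  · intro x y _ _ h1 h2; rw [smul_add]; exact add_mem h1 h2
  · intro r x _ h
    have : a • r • x = r • a • x := by
      rw [← algebraMap_smul KK r x, ← algebraMap_smul KK r (a • x), smul_smul, smul_smul, mul_comm]
    rw [this]
    exact Submodule.smul_mem _ _ h

lemma Lth_Ft (D : Dat M) (hEF : ModifiedOpsV M Et Ft) (i : ℤ) {x : M.carrier} (hx : x ∈ Lth M Ft) : Ft (od i) x ∈ Lth M Ft := by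
  refine Submodule.span_induction (p := fun x _ => Ft (od i) x ∈ Lth M Ft) ?_ ?_ ?_ ?_ hx
  · rintro _ ⟨c, hc, s, ⟨L, rfl⟩, rfl⟩
    rw [D.Ft_smul hEF]
    exact Submodule.subset_span ⟨c, hc, _, ⟨od i :: L, rfl⟩, rfl⟩
  · have := D.Ft_smul hEF i 0 0
    rw [zero_smul, zero_smul] at this
    rw [this]; exact zero_mem _
  · intro x y _ _ h1 h2; rw [D.Ft_add hEF]; exact add_mem h1 h2
  · intro r x _ h
    rw [← algebraMap_smul KK r x, D.Ft_smul hEF, algebraMap_smul]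
    exact Submodule.smul_mem _ _ h

lemma mem_Lth (D : Dat M) (hEF : ModifiedOpsV M Et Ft) {x : M.carrier} : x ∈ Lth M Ft ↔ D.Ψ x ∈ Lat A0 := by
  constructor
  · intro hx
    refine Submodule.span_induction (p := fun x _ => D.Ψ x ∈ Lat A0) ?_ ?_ ?_ ?_ hx
    · rintro _ ⟨c, hc, s, ⟨L, rfl⟩, rfl⟩
      rw [map_smul]
      refine Lat_smul hc ?_
      induction L with
      | nil => change D.Ψ M.vac ∈ _; rw [D.h0]; exact Lat_pp _ _
      | cons i L ih =>
        obtain ⟨r, rfl⟩ := od_surj i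
        exact D.Ft_Lat hEF r ih
    · rw [map_zero]; exact zero_mem _
    · intro x y _ _ h1 h2; rw [map_add]; exact add_mem h1 h2
    · intro r x _ h; rw [D.qsmul]; exact Lat_smul (C_mem_A0 r) h
  · intro hx
    let S : AddSubgroup NN := (Lth M Ft).toAddSubgroup.comap (D.Ψ.symm : NN →+ M.carrier)
    have hS : ∀ u, u ∈ S ↔ D.Ψ.symm u ∈ Lth M Ft := fun u => Iff.rfl
    have h : Lat A0 ≤ S := by
      refine lat_le_crystal ?_ ?_ ?_
      · intro c hc u hu
        rw [hS, map_smul]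
        exact Lth_A0 hc hu
      · rw [hS, ← D.h0, LinearEquiv.symm_apply_apply]
        exact Submodule.subset_span ⟨1, A0.one_mem, M.vac, ⟨[], rfl⟩, (one_smul _ _).symm⟩
      · intro i k w hw hk
        rw [hS] at hk ⊢
        have h1 := D.Ft_sum hEF i (Finsupp.single k w) (fun n => by
          rw [Finsupp.single_apply]; split_ifs
          · exact hw
          · exact map_zero _)
        rw [Finsupp.sum_single_index (by simp), Finsupp.sum_single_index (by simp)] at h1
        rw [← h1, LinearEquiv.symm_apply_apply]
        exact D.Lth_Ft hEF i hk
    have := h hx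
    rwa [hS, LinearEquiv.symm_apply_apply] at this

lemma mem_qLth (D : Dat M) (hEF : ModifiedOpsV M Et Ft) {x : M.carrier} : x ∈ qLth M Ft ↔ Sm (D.Ψ x) := by
  constructor
  · intro hx
    refine Submodule.span_induction (p := fun x _ => Sm (D.Ψ x)) ?_ ?_ ?_ ?_ hx
    · rintro _ ⟨y, hy, rfl⟩
      rw [map_smul]
      exact Sm_iff.mpr ⟨_, (D.mem_Lth hEF).mp hy, rfl⟩
    · rw [map_zero]; exact Sm_zero
    · intro x y _ _ h1 h2; rw [map_add]; exact h1.add h2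
    · intro r x _ h g
      rw [D.qsmul]; simpa using (Rs_C r).mul (h g)
  · intro hx
    obtain ⟨v, hv, e⟩ := Sm_iff.mp hx
    refine Submodule.subset_span ⟨D.Ψ.symm v, ?_, ?_⟩
    · rw [D.mem_Lth hEF, LinearEquiv.apply_symm_apply]; exact hv
    · rw [← map_smul, ← e, LinearEquiv.symm_apply_apply]

lemma span_top (D : Dat M) {S : Set M.carrier} (h : ∀ g (hg : 0 ≤ g), ∃ x ∈ S, D.Ψ x ⟨g, hg⟩ = 1 ∧ ∀ t : BB, D.Ψ x t ≠ 0 → pl t.1 g) :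
    Submodule.span KK S = ⊤ := by
  have h1 : (Submodule.span KK S).comap (D.Ψ.symm : NN →ₗ[KK] M.carrier) = ⊤ := by
    refine span_of_pp fun g hg => ?_
    obtain ⟨x, hx, h1, h2⟩ := h g hg
    refine ⟨D.Ψ x, ?_, h1, h2⟩
    change D.Ψ.symm (D.Ψ x) ∈ Submodule.span KK S
    rw [LinearEquiv.symm_apply_apply]; exact Submodule.subset_span hx
  rw [eq_top_iff]
  intro x _
  have h2 : D.Ψ x ∈ (Submodule.span KK S).comap (D.Ψ.symm : NN →ₗ[KK] M.carrier) := by rw [h1]; trivial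
  change D.Ψ.symm (D.Ψ x) ∈ Submodule.span KK S at h2
  rwa [LinearEquiv.symm_apply_apply] at h2

section U
variable {Fmap : Um Aodd →ₐ[KK] Bth Aodd thOdd}

lemma rho_fdiv (hF : ∀ i, Fmap (fgen Aodd i) = Fg Aodd thOdd i) (i : Iodd) (n : ℕ) : M.rho (Fmap (fdiv Aodd i n)) = Fpow M i n := by
  rw [fdiv, map_smul, map_smul, map_pow, map_pow, hF, Fpow]

def U (D : Dat M) (Fmap : Um Aodd →ₐ[KK] Bth Aodd thOdd) : AddSubgroup NN :=
  (UAphi M Fmap).toAddSubgroup.comap (D.Ψ.symm : NN →+ M.carrier)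

lemma mem_U (D : Dat M) (u : NN) : u ∈ D.U Fmap ↔ D.Ψ.symm u ∈ UAphi M Fmap := Iff.rfl

lemma U_AA (D : Dat M) : ∀ a ∈ AA, ∀ u ∈ D.U Fmap, a • u ∈ D.U Fmap := by
  intro a ha u hu
  rw [mem_U] at hu ⊢
  rw [map_smul]
  refine Submodule.span_induction (p := fun x _ => a • x ∈ UAphi M Fmap) ?_ ?_ ?_ ?_ hu
  · rintro _ ⟨c, hc, L, rfl⟩
    refine Submodule.subset_span ⟨a * c, AA.mul_mem ha hc, L, ?_⟩
    rw [mul_smul, map_smul Fmap a, map_smul M.rho a, LinearMap.smul_apply]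
  · rw [smul_zero]; exact zero_mem _
  · intro x y _ _ h1 h2; rw [smul_add]; exact add_mem h1 h2
  · intro r x _ h
    have : a • r • x = r • a • x := by
      rw [← algebraMap_smul KK r x, ← algebraMap_smul KK r (a • x), smul_smul, smul_smul, mul_comm]
    rw [this]
    exact Submodule.smul_mem _ _ h

lemma U_zero (D : Dat M) : pp 0 ∈ D.U Fmap := by
  rw [mem_U, ← D.h0, LinearEquiv.symm_apply_apply]
  exact Submodule.subset_span ⟨1, AA.one_mem, [], by simp⟩

lemma U_FF (D : Dat M) (hF : ∀ i, Fmap (fgen Aodd i) = Fg Aodd thOdd i) (i : ℤ) (k : ℕ) : ∀ u ∈ D.U Fmap, FF i k u ∈ D.U Fmap := by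
  intro u hu
  rw [mem_U] at hu ⊢
  have e : D.Ψ.symm (FF i k u) = Fpow M (od i) k (D.Ψ.symm u) := by
    apply D.Ψ.injective
    rw [Fpow_Ψ, LinearEquiv.apply_symm_apply, LinearEquiv.apply_symm_apply]
  rw [e]
  refine Submodule.span_induction (p := fun x _ => Fpow M (od i) k x ∈ UAphi M Fmap) ?_ ?_ ?_ ?_ hu
  · rintro _ ⟨c, hc, L, rfl⟩
    refine Submodule.subset_span ⟨c, hc, (od i, k) :: L, ?_⟩
    rw [List.map_cons, List.prod_cons, ← rho_fdiv hF, ← mul_smul_comm, map_mul, map_mul, Module.End.mul_apply]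
  · rw [map_zero]; exact zero_mem _
  · intro x y _ _ h1 h2; rw [map_add]; exact add_mem h1 h2
  · intro r x _ h
    rw [← algebraMap_smul KK r x, map_smul, algebraMap_smul]
    exact Submodule.smul_mem _ _ h

lemma UA_Lat (D : Dat M) (hF : ∀ i, Fmap (fgen Aodd i) = Fg Aodd thOdd i) {x : M.carrier} (hx : x ∈ UAphi M Fmap) : D.Ψ x ∈ Lat AA := by
  refine Submodule.span_induction (p := fun x _ => D.Ψ x ∈ Lat AA) ?_ ?_ ?_ ?_ hx
  · rintro _ ⟨c, hc, L, rfl⟩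
    rw [map_smul, map_smul, LinearMap.smul_apply, map_smul]
    refine Lat_smul hc ?_
    induction L with
    | nil => simp only [List.map_nil, List.prod_nil, map_one, Module.End.one_apply, D.h0]; exact Lat_pp _ _
    | cons p L ih =>
      obtain ⟨i, k⟩ := p
      obtain ⟨r, rfl⟩ := od_surj i
      rw [List.map_cons, List.prod_cons, map_mul, map_mul, Module.End.mul_apply, rho_fdiv hF, Fpow_Ψ]
      exact FF_int r k ih
  · rw [map_zero]; exact zero_mem _
  · intro x y _ _ h1 h2; rw [map_add]; exact add_mem h1 h2
  · intro r x _ h; rw [D.qsmul]; exact Lat_smul (C_mem_AA r) h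

end U
end Dat

lemma exists_a {M : BRepQ Aodd thOdd} (hM : IsVtheta Aodd thOdd lam0 M)
    {Fmap : Um Aodd →ₐ[KK] Bth Aodd thOdd} (hF : ∀ i, Fmap (fgen Aodd i) = Fg Aodd thOdd i)
    (x : M.carrier) : ∃ a, x = M.rho (Fmap a) M.vac := by
  have hx : x ∈ (MP M hM).Z := by rw [MP_Z]; trivial
  refine Submodule.span_induction (p := fun x _ => ∃ a, x = M.rho (Fmap a) M.vac) ?_ ⟨0, by simp⟩ ?_ ?_ hx
  · rintro _ ⟨L, rfl⟩
    induction L with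
    | nil => exact ⟨1, by simp [PHW.wd_nil, MP]⟩
    | cons i L ih =>
      obtain ⟨a, ha⟩ := ih
      refine ⟨fgen Aodd (od i) * a, ?_⟩
      rw [PHW.wd_cons, ha, map_mul, map_mul, hF]; rfl
  · rintro _ _ _ _ ⟨a, rfl⟩ ⟨b, rfl⟩
    exact ⟨a + b, by simp⟩
  · rintro c _ _ ⟨a, rfl⟩
    exact ⟨c • a, by rw [map_smul, map_smul, LinearMap.smul_apply]⟩

theorem main (M : BRepQ Aodd thOdd) (hM : IsVtheta Aodd thOdd lam0 M)
    (Et Ft : Iodd → M.carrier → M.carrier) (hEF : ModifiedOpsV M Et Ft)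
    (Fmap : Um Aodd →ₐ[KK] Bth Aodd thOdd)
    (hF : ∀ i, Fmap (fgen Aodd i) = Fg Aodd thOdd i)
    (kbar : KK →+* KK) (hkb : kbar qq = qq⁻¹)
    (bar : Um Aodd →+* Um Aodd) (hbarf : ∀ i : Iodd, bar (fgen Aodd i) = fgen Aodd i)
    (hbars : ∀ (c : KK) (x : Um Aodd), bar (c • x) = kbar c • bar x)
    (barV : M.carrier → M.carrier)
    (hbarV : ∀ a : Um Aodd, barV (M.rho (Fmap a) M.vac) = M.rho (Fmap (bar a)) M.vac)
    (hv : M.vac ≠ 0) :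
    Submodule.span KK ((Lth M Ft : Set M.carrier)) = ⊤ ∧
    Submodule.span KK ((LthBar M Ft barV : Set M.carrier)) = ⊤ ∧
    Submodule.span KK ((UAphi M Fmap : Set M.carrier)) = ⊤ ∧
    Function.Bijective
      (balMap M (Lth M Ft) (Lth M Ft ⊓ LthBar M Ft barV ⊓ UAphi M Fmap)
        (le_trans inf_le_left inf_le_left)
        ((qLth M Ft).comap (Lth M Ft).subtype)) := by
  obtain ⟨Ψ, h0, hΨF, hΨE⟩ := MN_iso M hM hv
  let D : Dat M := ⟨Ψ, h0, hΨF, hΨE⟩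
  -- the bar operator
  have badd : ∀ x y, barV (x + y) = barV x + barV y := by
    intro x y
    obtain ⟨a, rfl⟩ := exists_a hM hF x
    obtain ⟨b, rfl⟩ := exists_a hM hF y
    rw [← LinearMap.add_apply, ← map_add, ← map_add, hbarV, hbarV, hbarV, map_add, map_add, map_add, LinearMap.add_apply]
  have bsm : ∀ (c : KK) x, barV (c • x) = kbar c • barV x := by
    intro c x
    obtain ⟨a, rfl⟩ := exists_a hM hF x
    rw [← LinearMap.smul_apply, ← map_smul, ← map_smul, hbarV, hbarV, hbars, map_smul, map_smul, LinearMap.smul_apply]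
  have bvac : barV M.vac = M.vac := by simpa using hbarV 1
  have bFg : ∀ i x, barV (M.rho (Fg Aodd thOdd i) x) = M.rho (Fg Aodd thOdd i) (barV x) := by
    intro i x
    obtain ⟨a, rfl⟩ := exists_a hM hF x
    rw [← hF, ← Module.End.mul_apply, ← map_mul, ← map_mul, hbarV, hbarV, map_mul, hbarf, map_mul, map_mul, Module.End.mul_apply]
  let bN : NN →+ NN := AddMonoidHom.mk' (fun u => D.Ψ (barV (D.Ψ.symm u))) (fun u v => by rw [map_add, badd, map_add])
  have hbN : ∀ x, bN (D.Ψ x) = D.Ψ (barV x) := fun x => by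
    change D.Ψ (barV (D.Ψ.symm (D.Ψ x))) = _
    rw [LinearEquiv.symm_apply_apply]
  have B : BarD kbar bN := by
    refine ⟨hkb, ?_, ?_, ?_⟩
    · intro c u
      obtain ⟨x, rfl⟩ := D.Ψ.surjective u
      rw [← map_smul, hbN, hbN, bsm, map_smul]
    · rw [← D.h0, hbN, bvac]
    · intro i u
      obtain ⟨x, rfl⟩ := D.Ψ.surjective u
      rw [← D.hF, hbN, hbN, bFg, D.hF]
  have mLb : ∀ x, x ∈ LthBar M Ft barV ↔ ∃ y ∈ Lat A0, D.Ψ x = bN y := by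
    intro x
    constructor
    · intro hx
      refine Submodule.span_induction (p := fun x _ => ∃ y ∈ Lat A0, D.Ψ x = bN y) ?_ ?_ ?_ ?_ hx
      · rintro _ ⟨y, hy, rfl⟩
        exact ⟨D.Ψ y, (D.mem_Lth hEF).mp hy, (hbN y).symm⟩
      · exact ⟨0, zero_mem _, by rw [map_zero, map_zero]⟩
      · rintro x y _ _ ⟨u, hu, e⟩ ⟨v, hv, e'⟩
        exact ⟨u + v, add_mem hu hv, by rw [map_add, map_add, e, e']⟩
      · rintro r x _ ⟨u, hu, e⟩
        refine ⟨algebraMap ℚ KK r • u, Lat_smul (C_mem_A0 r) hu, ?_⟩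
        rw [D.qsmul, e, B.sm]
        congr 1
        simp
    · rintro ⟨y, hy, e⟩
      refine Submodule.subset_span ⟨D.Ψ.symm y, ?_, ?_⟩
      · rw [D.mem_Lth hEF, LinearEquiv.apply_symm_apply]; exact hy
      · exact D.Ψ.injective e
  refine ⟨D.span_top fun g hg => ?_, D.span_top fun g hg => ?_, D.span_top fun g hg => ?_, ?_, ?_⟩
  · refine ⟨D.Ψ.symm (pp g), ?_, ?_⟩
    · change _ ∈ Lth M Ft
      rw [D.mem_Lth hEF, LinearEquiv.apply_symm_apply]; exact Lat_pp _ _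
    · rw [LinearEquiv.apply_symm_apply]; exact ⟨pp_self hg, fun x hx => pp_tri hx⟩
  · refine ⟨D.Ψ.symm (bN (pp g)), ?_, ?_⟩
    · change _ ∈ LthBar M Ft barV
      rw [mLb, LinearEquiv.apply_symm_apply]; exact ⟨_, Lat_pp _ _, rfl⟩
    · rw [LinearEquiv.apply_symm_apply]; exact B.pp g hg hg
  · obtain ⟨X, h1, -, h3, h4⟩ := Mon_exists (fun u => u ∈ D.U Fmap) D.U_zero (fun i k w hw => D.U_FF hF i k w hw) g hg
    refine ⟨D.Ψ.symm X, h1, ?_⟩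
    rw [LinearEquiv.apply_symm_apply]; exact ⟨h3, h4⟩
  · rintro x y hxy
    have h1 : x.1 - y.1 ∈ qLth M Ft := by
      have := (Submodule.Quotient.eq _).mp hxy
      exact this
    have h2 : x.1 - y.1 ∈ Lth M Ft ⊓ LthBar M Ft barV ⊓ UAphi M Fmap := sub_mem x.2 y.2
    obtain ⟨⟨-, h3⟩, h4⟩ := h2
    obtain ⟨u, hu, e⟩ := (mLb _).mp h3
    have h5 := D.UA_Lat hF h4
    have h6 := (D.mem_qLth hEF).mp h1
    have h7 : D.Ψ (x.1 - y.1) = 0 := by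
      rw [e] at h5 h6 ⊢
      exact B.inj hu h5 h6
    have h8 := D.Ψ.map_eq_zero_iff.mp h7
    exact Subtype.ext (sub_eq_zero.mp h8)
  · intro z
    obtain ⟨⟨y, hy⟩, rfl⟩ := Submodule.Quotient.mk_surjective _ z
    obtain ⟨w, hw1, hw2, hw3, hw4⟩ := B.surj D.U_AA D.U_zero (fun i k u hu => D.U_FF hF i k u hu) ((D.mem_Lth hEF).mp hy)
    have hm : D.Ψ.symm w ∈ Lth M Ft := by rw [D.mem_Lth hEF, LinearEquiv.apply_symm_apply]; exact hw3
    refine ⟨⟨D.Ψ.symm w, ⟨hm, ?_⟩, hw2⟩, ?_⟩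
    · refine (mLb _).mpr ⟨w, hw3, ?_⟩
      rw [LinearEquiv.apply_symm_apply, hw1]
    · refine (Submodule.Quotient.eq _).mpr ?_
      change D.Ψ.symm w - y ∈ qLth M Ft
      rw [D.mem_qLth hEF, map_sub, LinearEquiv.apply_symm_apply, ← neg_sub]
      exact hw4.neg
end part19

end GLB

theorem stmt15 (M : BRepQ Aodd thOdd) (hM : IsVtheta Aodd thOdd lam0 M)
    (Et Ft : Iodd → M.carrier → M.carrier) (hEF : ModifiedOpsV M Et Ft)
    -- the embedding `U_q^-(g) → B_θ(g)`, `f_i ↦ F_i`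
    (Fmap : Um Aodd →ₐ[KK] Bth Aodd thOdd)
    (hF : ∀ i, Fmap (fgen Aodd i) = Fg Aodd thOdd i)
    -- the bar involution of `K = ℚ(q)`
    (kbar : KK →+* KK) (hkb : kbar qq = qq⁻¹)
    -- the bar involution of `U_q^-(g)`
    (bar : Um Aodd →+* Um Aodd) (hbarf : ∀ i : Iodd, bar (fgen Aodd i) = fgen Aodd i)
    (hbars : ∀ (c : KK) (x : Um Aodd), bar (c • x) = kbar c • bar x)
    -- the induced bar operator of `V_θ(λ)`
    (barV : M.carrier → M.carrier)
    (hbarV : ∀ a : Um Aodd, barV (M.rho (Fmap a) M.vac) = M.rho (Fmap (bar a)) M.vac) :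
    -- each of the three generates `V_θ(λ)` as a `K`-vector space
    Submodule.span KK ((Lth M Ft : Set M.carrier)) = ⊤ ∧
    Submodule.span KK ((LthBar M Ft barV : Set M.carrier)) = ⊤ ∧
    Submodule.span KK ((UAphi M Fmap : Set M.carrier)) = ⊤ ∧
    -- and `E = L_θ(λ) ∩ L_θ(λ)⁻ ∩ U_A⁻ φ_λ → L_θ(λ)/qL_θ(λ)` is an isomorphism
    Function.Bijective
      (balMap M (Lth M Ft) (Lth M Ft ⊓ LthBar M Ft barV ⊓ UAphi M Fmap)
        (le_trans inf_le_left inf_le_left)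
        ((qLth M Ft).comap (Lth M Ft).subtype)) := by
  by_cases hv : M.vac = 0
  · have hs := GLB.triv_of_vac M hM hv
    refine ⟨Subsingleton.elim _ _, Subsingleton.elim _ _, Subsingleton.elim _ _, ?_, ?_⟩
    · intro x y _
      exact Subtype.ext (Subsingleton.elim _ _)
    · intro z
      obtain ⟨y, rfl⟩ := Submodule.Quotient.mk_surjective _ z
      refine ⟨0, ?_⟩
      unfold balMap
      congr 1
      exact Subtype.ext (Subsingleton.elim _ _)
  · exact GLB.main M hM Et Ft hEF Fmap hF kbar hkb bar hbarf hbars barV hbarV hv
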